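/- If the theory ZFC + "Ord is essentially faint" is consistent, then no sentence φ in the language of set theory satisfies both of the following: (1) ZFC + "Ord is essentially faint" proves φ, and (2) ZFC + φ proves the scheme "Ord is essentially faint". -/

import Mathlib

namespace Paper

/-- First-order formulas in the language of set theory (one binary relation, membership),
using de Bruijn variables; `all` binds the last variable. -/
inductive SetFormula : ℕ → Type
  | mem {n : ℕ} (i j : Fin n) : SetFormula n
  | eq {n : ℕ} (i j : Fin n) : SetFormula n
  | fal {n : ℕ} : SetFormula n
  | imp {n : ℕ} (φ ψ : SetFormula n) : SetFormula n
  | all {n : ℕ} (φ : SetFormula (n + 1)) : SetFormula n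

namespace SetFormula

/-- Negation. -/
def not {n : ℕ} (φ : SetFormula n) : SetFormula n := φ.imp .fal

/-- Conjunction. -/
def and {n : ℕ} (φ ψ : SetFormula n) : SetFormula n := (φ.imp ψ.not).not

/-- Existential quantification (over the last variable). -/
def ex {n : ℕ} (φ : SetFormula (n + 1)) : SetFormula n := (SetFormula.all φ.not).not

end SetFormula

/-- Satisfaction of a set-theoretic formula in a structure `(M, E)`, where `E` interprets
the membership relation. -/
def Realize {M : Type*} (E : M → M → Prop) : ∀ {n : ℕ}, SetFormula n → (Fin n → M) → Prop
  | _, .mem i j, v => E (v i) (v j)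
  | _, .eq i j, v => v i = v j
  | _, .fal, _ => False
  | _, .imp φ ψ, v => Realize E φ v → Realize E ψ v
  | _, .all φ, v => ∀ a, Realize E φ (Fin.snoc v a)

/-- Satisfaction of a formula relativized to the subclass `S` of `M`; all quantifiers
range over `S`, and the assignment is required to take values in `S`. -/
def RealizeIn {M : Type*} (E : M → M → Prop) (S : M → Prop) {n : ℕ}
    (φ : SetFormula n) (v : Fin n → M) : Prop :=
  ∃ h : ∀ i, S (v i),
    Realize (fun a b : {x : M // S x} => E a.1 b.1) φ fun i => ⟨v i, h i⟩

/-- `Δ₀`-formulas: formulas all of whose quantifiers are bounded. -/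
inductive IsDelta0 : ∀ {n : ℕ}, SetFormula n → Prop
  | mem {n : ℕ} (i j : Fin n) : IsDelta0 (.mem i j)
  | eq {n : ℕ} (i j : Fin n) : IsDelta0 (.eq i j)
  | fal {n : ℕ} : IsDelta0 (n := n) .fal
  | imp {n : ℕ} {φ ψ : SetFormula n} : IsDelta0 φ → IsDelta0 ψ → IsDelta0 (φ.imp ψ)
  | ball {n : ℕ} (j : Fin n) {φ : SetFormula (n + 1)} :
      IsDelta0 φ → IsDelta0 (.all ((SetFormula.mem (Fin.last n) j.castSucc).imp φ))
  | bex {n : ℕ} (j : Fin n) {φ : SetFormula (n + 1)} :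
      IsDelta0 φ → IsDelta0 (SetFormula.ex ((SetFormula.mem (Fin.last n) j.castSucc).and φ))

mutual
  /-- `Σₙ`-formulas of the Lévy hierarchy. -/
  inductive IsSigma : ℕ → ∀ {n : ℕ}, SetFormula n → Prop
    | ofDelta0 {k n : ℕ} {φ : SetFormula n} : IsDelta0 φ → IsSigma k φ
    | ofPi {k n : ℕ} {φ : SetFormula n} : IsPi k φ → IsSigma (k + 1) φ
    | ex {k n : ℕ} {φ : SetFormula (n + 1)} : IsSigma (k + 1) φ → IsSigma (k + 1) φ.ex
  /-- `Πₙ`-formulas of the Lévy hierarchy. -/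
  inductive IsPi : ℕ → ∀ {n : ℕ}, SetFormula n → Prop
    | ofDelta0 {k n : ℕ} {φ : SetFormula n} : IsDelta0 φ → IsPi k φ
    | ofSigma {k n : ℕ} {φ : SetFormula n} : IsSigma k φ → IsPi (k + 1) φ
    | all {k n : ℕ} {φ : SetFormula (n + 1)} : IsPi (k + 1) φ → IsPi (k + 1) φ.all
end

end Paper
namespace Paper

section Generic

variable {M : Type*} (E : M → M → Prop)

/-- `x` is a transitive set (relative to the membership relation `E`). -/
def TransE (x : M) : Prop := ∀ y, E y x → ∀ z, E z y → E z x

/-- `x` is an ordinal: a transitive set all of whose elements are transitive. -/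
def OrdE (x : M) : Prop := TransE E x ∧ ∀ y, E y x → TransE E y

/-- `a ⊆ b`. -/
def SubE (a b : M) : Prop := ∀ z, E z a → E z b

/-- `a ≤ b` for ordinals. -/
def LeE (a b : M) : Prop := E a b ∨ a = b

/-- `x` is the empty set. -/
def EmptyE (x : M) : Prop := ∀ z, ¬ E z x

/-- `s = y ∪ {y}`. -/
def SuccSpecE (s y : M) : Prop := ∀ z, E z s ↔ (E z y ∨ z = y)

/-- `l` is a (nonzero) limit ordinal. -/
def LimitE (l : M) : Prop := OrdE E l ∧ (∃ w, E w l) ∧ ∀ α, E α l → ∃ β, E β l ∧ E α β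

/-- `w` is the first infinite ordinal `ω`. -/
def OmegaSpecE (w : M) : Prop := LimitE E w ∧ ∀ x, E x w → ¬ LimitE E x

/-- `x` is an infinite ordinal, i.e. an ordinal with `ω ≤ x`. -/
def InfiniteOrdE (x : M) : Prop := OrdE E x ∧ ∃ w, OmegaSpecE E w ∧ LeE E w x

/-- `p = {a, b}`. -/
def UPairE (p a b : M) : Prop := ∀ z, E z p ↔ (z = a ∨ z = b)

/-- `p` is the Kuratowski ordered pair `⟨a, b⟩`. -/
def OPairE (p a b : M) : Prop :=
  ∃ s t, UPairE E s a a ∧ UPairE E t a b ∧ UPairE E p s t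

/-- The ordered pair `⟨x, y⟩` is an element of `f`. -/
def PairMemE (f x y : M) : Prop := ∃ p, E p f ∧ OPairE E p x y

/-- `f` is (the graph of) a function from `a` to `b`. -/
def IsFuncE (f a b : M) : Prop :=
  (∀ p, E p f → ∃ x y, E x a ∧ E y b ∧ OPairE E p x y) ∧
    ∀ x, E x a → (∃ y, PairMemE E f x y) ∧
      ∀ y y', PairMemE E f x y → PairMemE E f x y' → y = y'

/-- `f` is a surjection from `a` onto `b`. -/
def SurjE (f a b : M) : Prop :=
  IsFuncE E f a b ∧ ∀ y, E y b → ∃ x, E x a ∧ PairMemE E f x y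

/-- `f` is an injection from `a` into `b`. -/
def InjE (f a b : M) : Prop :=
  IsFuncE E f a b ∧ ∀ x x' y, E x a → E x' a →
    PairMemE E f x y → PairMemE E f x' y → x = x'

/-- `f` is a bijection between `a` and `b`. -/
def BijE (f a b : M) : Prop := SurjE E f a b ∧ InjE E f a b

/-- `κ` is a cardinal: an ordinal not in bijection with any of its elements. -/
def CardE (κ : M) : Prop := OrdE E κ ∧ ∀ α, E α κ → ¬ ∃ f, BijE E f α κ

/-- `κ` is an infinite cardinal. -/
def InfCardE (κ : M) : Prop := CardE E κ ∧ InfiniteOrdE E κ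

/-- `b = a ∩ c`. -/
def InterSpecE (b a c : M) : Prop := ∀ z, E z b ↔ (E z a ∧ E z c)

/-- `c` is unbounded in the ordinal `κ`. -/
def UnboundedInE (c κ : M) : Prop := ∀ α, E α κ → ∃ β, E β c ∧ E α β

/-- `c` is closed in the ordinal `κ`: it contains each of its limit points below `κ`. -/
def ClosedInE (c κ : M) : Prop :=
  ∀ l, E l κ → (∃ w, E w l) → (∀ α, E α l → ∃ β, E β c ∧ E α β ∧ E β l) → E l c

/-- `c` is a closed unbounded subset of the ordinal `κ`. -/
def ClubInE (c κ : M) : Prop := SubE E c κ ∧ UnboundedInE E c κ ∧ ClosedInE E c κ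

/-- `f` is (the graph of) a sequence `⟨A_α | α < κ⟩` with `A_α ⊆ α` for all `α < κ`. -/
def SeqSpecE (f κ : M) : Prop :=
  ∀ α, E α κ → (∃ A, PairMemE E f α A ∧ SubE E A α) ∧
    ∀ A A', PairMemE E f α A → PairMemE E f α A' → A = A'

/-- `κ` is a subtle cardinal. -/
def SubtleE (κ : M) : Prop :=
  InfCardE E κ ∧ ∀ f, SeqSpecE E f κ → ∀ c, ClubInE E c κ →
    ∃ α β, E α c ∧ E β c ∧ E α β ∧
      ∃ A B, PairMemE E f α A ∧ PairMemE E f β B ∧ InterSpecE E A B α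

/-- `κ` is a regular ordinal: every function from an element of `κ` to `κ` has
bounded range. -/
def RegularE (κ : M) : Prop :=
  OrdE E κ ∧ ∀ γ f, E γ κ → IsFuncE E f γ κ →
    ∃ β, E β κ ∧ ∀ x y, PairMemE E f x y → E y β

/-- `p = 𝒫(a)`. -/
def PowSpecE (p a : M) : Prop := ∀ z, E z p ↔ SubE E z a

/-- `κ` is a strong limit cardinal: for every `α < κ`, `2^|α| < κ`. -/
def StrongLimitE (κ : M) : Prop :=
  ∀ α, E α κ → ∀ p, PowSpecE E p α → ∃ β f, E β κ ∧ InjE E f p β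

/-- `κ` is a strongly inaccessible cardinal: an uncountable regular strong limit
cardinal. -/
def InaccE (κ : M) : Prop :=
  CardE E κ ∧ (∃ w, OmegaSpecE E w ∧ E w κ) ∧ RegularE E κ ∧ StrongLimitE E κ

/-- `z` belongs to the transitive closure of `x`. -/
def TCMemE (z x : M) : Prop := ∀ t, TransE E t → SubE E x t → E z t

/-- `x ∈ H(θ)`: the transitive closure of `x` has cardinality less than `θ`. -/
def HMemE (x θ : M) : Prop :=
  ∃ t, TransE E t ∧ SubE E x t ∧ ∃ β f, E β θ ∧ SurjE E f β t

/-- `f` is (the graph of) the cumulative-hierarchy sequence `⟨V_β | β < α⟩`,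
determined by the recursion `V_β = {z | ∃ γ < β, z ⊆ V_γ}`. -/
def VHierE (f α : M) : Prop :=
  OrdE E α ∧ ∀ β, E β α →
    (∃ w, PairMemE E f β w ∧
      ∀ z, E z w ↔ ∃ γ, E γ β ∧ ∃ u, PairMemE E f γ u ∧ SubE E z u) ∧
    ∀ w w', PairMemE E f β w → PairMemE E f β w' → w = w'

/-- `x ∈ V_α`. -/
def VMemE (x α : M) : Prop :=
  OrdE E α ∧ ∃ f, VHierE E f α ∧ ∃ β u, E β α ∧ PairMemE E f β u ∧ SubE E x u

/-- The class `S` is a `Σₙ`-elementary subclass of the class `T`. -/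
def SigmaElemPairE (n : ℕ) (S T : M → Prop) : Prop :=
  (∀ x, S x → T x) ∧
    ∀ ⦃k : ℕ⦄ (φ : SetFormula k), IsSigma n φ → ∀ v : Fin k → M, (∀ i, S (v i)) →
      (RealizeIn E S φ v ↔ RealizeIn E T φ v)

/-- The class `S` is a (fully) elementary subclass of the class `T`. -/
def ElemPairE (S T : M → Prop) : Prop :=
  (∀ x, S x → T x) ∧
    ∀ ⦃k : ℕ⦄ (φ : SetFormula k) (v : Fin k → M), (∀ i, S (v i)) →
      (RealizeIn E S φ v ↔ RealizeIn E T φ v)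

/-- `j` is an elementary map from the class `S` into the class `T`. -/
def ElemMapE (S T : M → Prop) (j : M → M) : Prop :=
  (∀ x, S x → T (j x)) ∧
    ∀ ⦃k : ℕ⦄ (φ : SetFormula k) (v : Fin k → M), (∀ i, S (v i)) →
      (RealizeIn E S φ v ↔ RealizeIn E T φ fun i => j (v i))

/-- `α ∈ C⁽ⁿ⁾`: the ordinal `α` is `Σₙ`-correct, i.e. `V_α` is a `Σₙ`-elementary
submodel of the universe. -/
def CnE (n : ℕ) (α : M) : Prop :=
  OrdE E α ∧ SigmaElemPairE E n (fun x => VMemE E x α) fun _ => True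

/-- `κ` is a weakly shrewd cardinal. -/
def WeaklyShrewdE (κ : M) : Prop :=
  CardE E κ ∧ ∀ (φ : SetFormula 2) (θ z : M), CardE E θ → E κ θ → SubE E z κ →
    RealizeIn E (fun x => HMemE E x θ) φ ![z, κ] →
    ∃ κ' θ' z', CardE E κ' ∧ CardE E θ' ∧ E κ' θ' ∧ E κ' κ ∧
      InterSpecE E z' z κ' ∧ RealizeIn E (fun x => HMemE E x θ') φ ![z', κ']

/-- `κ` is a `C⁽ⁿ⁾`-weakly shrewd cardinal. -/
def CnWeaklyShrewdE (n : ℕ) (κ : M) : Prop :=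
  CardE E κ ∧ ∀ (φ : SetFormula 2) (θ z : M), CardE E θ → CnE E n θ → E κ θ →
    SubE E z κ → RealizeIn E (fun x => HMemE E x θ) φ ![z, κ] →
    ∃ κ' θ' z', CardE E κ' ∧ CardE E θ' ∧ CnE E n θ' ∧ E κ' θ' ∧ E κ' κ ∧
      InterSpecE E z' z κ' ∧ RealizeIn E (fun x => HMemE E x θ') φ ![z', κ']

/-- Axiom of extensionality for `(M, E)`. -/
def AxExtE : Prop := ∀ x y : M, (∀ z, E z x ↔ E z y) → x = y

/-- Axiom of pairing for `(M, E)`. -/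
def AxPairE : Prop := ∀ a b : M, ∃ p, UPairE E p a b

/-- Axiom of union for `(M, E)`. -/
def AxUnionE : Prop := ∀ a : M, ∃ u, ∀ z, E z u ↔ ∃ y, E y a ∧ E z y

/-- Axiom of power set for `(M, E)`. -/
def AxPowE : Prop := ∀ a : M, ∃ p, PowSpecE E p a

/-- Axiom of infinity for `(M, E)`. -/
def AxInfE : Prop :=
  ∃ I : M, (∃ e, E e I ∧ EmptyE E e) ∧ ∀ y, E y I → ∃ s, E s I ∧ SuccSpecE E s y

/-- Axiom of foundation for `(M, E)`. -/
def AxFoundE : Prop :=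
  ∀ a : M, (∃ z, E z a) → ∃ m, E m a ∧ ∀ z, E z a → ¬ E z m

/-- Separation scheme for `(M, E)`. -/
def AxSepE : Prop :=
  ∀ (k : ℕ) (φ : SetFormula (k + 1)) (p : Fin k → M) (a : M),
    ∃ s : M, ∀ z, E z s ↔ (E z a ∧ Realize E φ (Fin.cons z p))

/-- Replacement scheme for `(M, E)`. -/
def AxReplE : Prop :=
  ∀ (k : ℕ) (φ : SetFormula (k + 2)) (p : Fin k → M) (a : M),
    (∀ x, E x a → ∀ y y', Realize E φ (Fin.cons x (Fin.cons y p)) →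
      Realize E φ (Fin.cons x (Fin.cons y' p)) → y = y') →
    ∃ b : M, ∀ y, E y b ↔ ∃ x, E x a ∧ Realize E φ (Fin.cons x (Fin.cons y p))

/-- Axiom of choice for `(M, E)`. -/
def AxChoiceE : Prop :=
  ∀ a : M, (∀ x, E x a → ∃ z, E z x) →
    (∀ x y, E x a → E y a → x ≠ y → ¬ ∃ z, E z x ∧ E z y) →
    ∃ c, ∀ x, E x a → ∃ z, E z c ∧ E z x ∧ ∀ z', E z' c → E z' x → z' = z

/-- `(M, E)` is a model of `ZF⁻` (Zermelo–Fraenkel set theory without the power set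
axiom). -/
def IsZFMinusE : Prop :=
  AxExtE E ∧ AxPairE E ∧ AxUnionE E ∧ AxInfE E ∧ AxFoundE E ∧ AxSepE E ∧ AxReplE E

/-- `(M, E)` is a model of `ZFC`. -/
def IsZFCE : Prop :=
  Nonempty M ∧ IsZFMinusE E ∧ AxPowE E ∧ AxChoiceE E

/-- The set `m` is, with the induced membership relation, a transitive model
of `ZF⁻`. -/
def ZFMinusModelE (m : M) : Prop :=
  IsZFMinusE fun a b : {x : M // E x m} => E a.1 b.1

/-- `x` has cardinality `κ`. -/
def CardEqE (x κ : M) : Prop := ∃ f, BijE E f κ x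

/-- `m` is closed under sequences of length less than `κ`: `^{<κ}m ⊆ m`. -/
def SmallSeqClosedE (m κ : M) : Prop := ∀ γ f, E γ κ → IsFuncE E f γ m → E f m

/-- `κ` is a `C⁽ⁿ⁾`-strongly unfoldable cardinal. -/
def CnStronglyUnfoldableE (n : ℕ) (κ : M) : Prop :=
  InaccE E κ ∧ ∀ lam, CnE E n lam → E κ lam →
    ∀ m, TransE E m → ZFMinusModelE E m → CardEqE E m κ → E κ m →
      SmallSeqClosedE E m κ →
      ∃ N j κ', TransE E N ∧ (∀ x, VMemE E x lam → E x N) ∧ IsFuncE E j m N ∧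
        (∀ ⦃k : ℕ⦄ (φ : SetFormula k) (v w : Fin k → M), (∀ i, E (v i) m) →
          (∀ i, PairMemE E j (v i) (w i)) →
          (RealizeIn E (fun x => E x m) φ v ↔ RealizeIn E (fun x => E x N) φ w)) ∧
        (∀ α, E α κ → PairMemE E j α α) ∧ PairMemE E j κ κ' ∧ E lam κ' ∧
        SigmaElemPairE E n (fun x => VMemE E x lam) fun x => E x N ∧ VMemE E x κ'

/-- `x` is ordinal definable. -/
def IsODE (x : M) : Prop :=
  ∃ (k : ℕ) (φ : SetFormula (k + 1)) (p : Fin k → M), (∀ i, OrdE E (p i)) ∧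
    Realize E φ (Fin.cons x p) ∧ ∀ y, Realize E φ (Fin.cons y p) → y = x

/-- `x` is hereditarily ordinal definable, i.e. `x ∈ HOD`. -/
def IsHODE (x : M) : Prop := IsODE E x ∧ ∀ z, TCMemE E z x → IsODE E z

/-- The instance of the principle "`Ord` is essentially faint" for the class
sequence `⟨{A | Efam α A} | α ∈ Ord⟩`. -/
def FaintForE (Efam : M → M → Prop) : Prop :=
  (∀ α, OrdE E α → (∃ A, Efam α A) ∧ ∀ A, Efam α A → SubE E A α) →
    ∀ ξ, OrdE E ξ → ∃ α β A B, OrdE E α ∧ OrdE E β ∧ E ξ α ∧ E α β ∧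
      Efam β A ∧ InterSpecE E B A α ∧ Efam α B

/-- `C` is a closed unbounded class of ordinals. -/
def ClubClassE (C : M → Prop) : Prop :=
  (∀ x, C x → OrdE E x) ∧ (∀ α, OrdE E α → ∃ β, C β ∧ E α β) ∧
    ∀ l, OrdE E l → (∃ w, E w l) → (∀ α, E α l → ∃ β, C β ∧ E α β ∧ E β l) → C l

/-- The instance of the principle "`Ord` is essentially subtle" for the class
sequence `⟨{A | Efam α A} | α ∈ Ord⟩` and the class `C`. -/
def SubtleForE (Efam : M → M → Prop) (C : M → Prop) : Prop :=
  (∀ α, OrdE E α → (∃ A, Efam α A) ∧ ∀ A, Efam α A → SubE E A α) →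
    ClubClassE E C →
    ∃ α β A B, C α ∧ C β ∧ E α β ∧ Efam β A ∧ InterSpecE E B A α ∧ Efam α B

/-- The scheme "`Ord` is essentially faint" holds in `(M, E)`: every instance for a
definable (with parameters) class sequence holds. -/
def OrdFaintDefE : Prop :=
  ∀ (k : ℕ) (φ : SetFormula (k + 2)) (p : Fin k → M),
    FaintForE E fun α A => Realize E φ (Fin.cons α (Fin.cons A p))

/-- The scheme "`Ord` is essentially subtle" holds in `(M, E)`: every instance for
definable (with parameters) class sequences and club classes holds. -/
def OrdSubtleDefE : Prop :=
  ∀ (k k' : ℕ) (φ : SetFormula (k + 2)) (p : Fin k → M)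
    (ψ : SetFormula (k' + 1)) (q : Fin k' → M),
    SubtleForE E (fun α A => Realize E φ (Fin.cons α (Fin.cons A p)))
      fun x => Realize E ψ (Fin.cons x q)

/-- There is a proper class of subtle cardinals in `(M, E)`. -/
def ProperClassSubtleE : Prop := ∀ α, OrdE E α → ∃ κ, SubtleE E κ ∧ E α κ

/-- There are no strongly inaccessible cardinals in `(M, E)`. -/
def NoInaccE : Prop := ∀ κ, ¬ InaccE E κ

end Generic

end Paper

namespace Paper

/-! ## Part 1: renaming of variables and definability -/

namespace SetFormula

/-- Lift a renaming under a quantifier. -/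
def liftF {n m : ℕ} (f : Fin n → Fin m) : Fin (n + 1) → Fin (m + 1) :=
  Fin.snoc (α := fun _ => Fin (m + 1)) (fun i => (f i).castSucc) (Fin.last m)

/-- Rename the variables of a formula. -/
def rename : ∀ {n : ℕ}, SetFormula n → ∀ {m : ℕ}, (Fin n → Fin m) → SetFormula m
  | _, .mem i j, _, f => .mem (f i) (f j)
  | _, .eq i j, _, f => .eq (f i) (f j)
  | _, .fal, _, _ => .fal
  | _, .imp φ ψ, _, f => .imp (φ.rename f) (ψ.rename f)
  | _, .all φ, _, f => .all (φ.rename (liftF f))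

end SetFormula

theorem realize_rename {M : Type*} (E : M → M → Prop) {n : ℕ} (φ : SetFormula n) :
    ∀ {m : ℕ} (f : Fin n → Fin m) (v : Fin m → M),
      Realize E (φ.rename f) v ↔ Realize E φ (fun i => v (f i)) := by
  induction φ with
  | mem i j => intros; rfl
  | eq i j => intros; rfl
  | fal => intros; rfl
  | imp φ ψ h1 h2 =>
    intro m f v
    simp only [SetFormula.rename, Realize, h1, h2]
  | all φ h =>
    intro m f v
    simp only [SetFormula.rename, Realize, h]
    refine forall_congr' fun a => ?_
    have : (fun i => (Fin.snoc v a : Fin (m + 1) → M) (SetFormula.liftF f i)) =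
        (Fin.snoc (fun i => v (f i)) a : Fin _ → M) := by
      funext i
      refine Fin.lastCases ?_ (fun j => ?_) i
      · simp [SetFormula.liftF]
      · simp [SetFormula.liftF]
    rw [this]

section Dfn

variable {M : Type}

/-- A definability structure: a family of relations closed under first-order operations. -/
structure DS (E : M → M → Prop) where
  R : ∀ {n : ℕ}, ((Fin n → M) → Prop) → Prop
  memVar : ∀ {n : ℕ} (i j : Fin n), R (fun v => E (v i) (v j))
  eqVar : ∀ {n : ℕ} (i j : Fin n), R (fun v : Fin n → M => v i = v j)
  fal : ∀ {n : ℕ}, R (fun _ : Fin n → M => False)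
  imp : ∀ {n : ℕ} {P Q : (Fin n → M) → Prop}, R P → R Q → R (fun v => P v → Q v)
  all : ∀ {n : ℕ} {P : (Fin (n + 1) → M) → Prop}, R P → R (fun v => ∀ a, P (Fin.snoc v a))
  reidx : ∀ {n m : ℕ} {P : (Fin n → M) → Prop} (σ : Fin n → Fin m), R P →
    R (fun v => P (fun i => v (σ i)))

/-- Definability of predicates. -/
class Dfn {E : M → M → Prop} (S : DS E) {n : ℕ} (P : (Fin n → M) → Prop) : Prop where
  out : S.R P

/-- Definability of functions. -/
class DFun {E : M → M → Prop} (S : DS E) {n : ℕ} (f : (Fin n → M) → M) : Prop where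
  out : Dfn S (fun w : Fin (n + 1) → M => w (Fin.last n) = f (fun i => w i.castSucc))

/-- Allowed parameter. -/
class InS {E : M → M → Prop} (S : DS E) (c : M) : Prop where
  out : S.R (fun v : Fin 1 → M => v 0 = c)

variable {E : M → M → Prop} {S : DS E} {n : ℕ}

theorem Dfn.congr {P Q : (Fin n → M) → Prop} (h : Dfn S P) (hpq : ∀ v, Q v ↔ P v) :
    Dfn S Q := by
  have : Q = P := funext fun v => propext (hpq v)
  rw [this]; exact h

theorem Dfn.memVar (i j : Fin n) : Dfn S (fun v : Fin n → M => E (v i) (v j)) :=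
  ⟨S.memVar i j⟩

theorem Dfn.eqVar (i j : Fin n) : Dfn S (fun v : Fin n → M => v i = v j) :=
  ⟨S.eqVar i j⟩

theorem Dfn.eqConst (i : Fin n) (c : M) [h : InS S c] :
    Dfn S (fun v : Fin n → M => v i = c) :=
  ⟨S.reidx (fun _ => i) h.out⟩

theorem Dfn.falI : Dfn S (fun _ : Fin n → M => False) := ⟨S.fal⟩

instance Dfn.impI {P Q : (Fin n → M) → Prop} [hP : Dfn S P] [hQ : Dfn S Q] :
    Dfn S (fun v => P v → Q v) := ⟨S.imp hP.out hQ.out⟩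

instance Dfn.allI {Q : (Fin n → M) → M → Prop}
    [h : Dfn S (fun w : Fin (n + 1) → M => Q (fun i => w i.castSucc) (w (Fin.last n)))] :
    Dfn S (fun v => ∀ a : M, Q v a) :=
  Dfn.congr ⟨S.all h.out⟩ fun v => by simp

instance Dfn.constI (p : Prop) : Dfn S (fun _ : Fin n → M => p) := by
  by_cases hp : p
  · exact (Dfn.impI (P := fun _ => False) (Q := fun _ => False) (hP := Dfn.falI)
      (hQ := Dfn.falI)).congr fun v => by simp [hp]
  · exact Dfn.falI.congr fun v => by simp [hp]

instance Dfn.notI {P : (Fin n → M) → Prop} [hP : Dfn S P] :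
    Dfn S (fun v => ¬ P v) :=
  (Dfn.impI (P := P) (Q := fun _ => False)).congr fun v => Iff.rfl

instance Dfn.andI {P Q : (Fin n → M) → Prop} [hP : Dfn S P] [hQ : Dfn S Q] :
    Dfn S (fun v => P v ∧ Q v) :=
  (Dfn.notI (P := fun v => P v → ¬ Q v)).congr fun v => by tauto

instance Dfn.orI {P Q : (Fin n → M) → Prop} [hP : Dfn S P] [hQ : Dfn S Q] :
    Dfn S (fun v => P v ∨ Q v) :=
  (Dfn.impI (P := fun v => ¬ P v) (Q := Q)).congr fun v => by tauto

instance Dfn.iffI {P Q : (Fin n → M) → Prop} [hP : Dfn S P] [hQ : Dfn S Q] :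
    Dfn S (fun v => P v ↔ Q v) :=
  (Dfn.andI (P := fun v => P v → Q v) (Q := fun v => Q v → P v)).congr fun v => by tauto

instance Dfn.exI {Q : (Fin n → M) → M → Prop}
    [h : Dfn S (fun w : Fin (n + 1) → M => Q (fun i => w i.castSucc) (w (Fin.last n)))] :
    Dfn S (fun v => ∃ a : M, Q v a) :=
  (Dfn.notI (P := fun v => ∀ a, ¬ Q v a)).congr fun v => by simp

theorem Dfn.reindex {m : ℕ} {P : (Fin n → M) → Prop} (h : Dfn S P) (σ : Fin n → Fin m) :
    Dfn S (fun v : Fin m → M => P (fun i => v (σ i))) := ⟨S.reidx σ h.out⟩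

theorem DFun.reindex {m : ℕ} {f : (Fin n → M) → M} (h : DFun S f) (σ : Fin n → Fin m) :
    DFun S (fun v : Fin m → M => f (fun i => v (σ i))) := by
  refine ⟨(h.out.reindex (SetFormula.liftF σ)).congr fun v => ?_⟩
  simp [SetFormula.liftF]

instance DFun.varI (i : Fin n) : DFun S (fun v : Fin n → M => v i) :=
  ⟨Dfn.eqVar _ _⟩

instance DFun.constI (c : M) [InS S c] : DFun S (fun _ : Fin n → M => c) :=
  ⟨Dfn.eqConst _ _⟩

theorem DFun.of_graph {f : (Fin n → M) → M} {G : (Fin n → M) → M → Prop}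
    (h : Dfn S (fun w : Fin (n + 1) → M => G (fun i => w i.castSucc) (w (Fin.last n))))
    (hG : ∀ v y, y = f v ↔ G v y) : DFun S f :=
  ⟨h.congr fun v => hG _ _⟩

/-- Unary definable predicates. -/
class D1 {E : M → M → Prop} (S : DS E) (P : M → Prop) : Prop where
  out : Dfn S (fun v : Fin 1 → M => P (v 0))
/-- Binary definable predicates. -/
class D2 {E : M → M → Prop} (S : DS E) (P : M → M → Prop) : Prop where
  out : Dfn S (fun v : Fin 2 → M => P (v 0) (v 1))
/-- Ternary definable predicates. -/
class D3 {E : M → M → Prop} (S : DS E) (P : M → M → M → Prop) : Prop where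
  out : Dfn S (fun v : Fin 3 → M => P (v 0) (v 1) (v 2))
/-- 4-ary definable predicates. -/
class D4 {E : M → M → Prop} (S : DS E) (P : M → M → M → M → Prop) : Prop where
  out : Dfn S (fun v : Fin 4 → M => P (v 0) (v 1) (v 2) (v 3))
/-- Unary definable functions. -/
class F1 {E : M → M → Prop} (S : DS E) (f : M → M) : Prop where
  out : DFun S (fun v : Fin 1 → M => f (v 0))
/-- Binary definable functions. -/
class F2 {E : M → M → Prop} (S : DS E) (f : M → M → M) : Prop where
  out : DFun S (fun v : Fin 2 → M => f (v 0) (v 1))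
/-- Ternary definable functions. -/
class F3 {E : M → M → Prop} (S : DS E) (f : M → M → M → M) : Prop where
  out : DFun S (fun v : Fin 3 → M => f (v 0) (v 1) (v 2))
/-- 4-ary definable functions. -/
class F4 {E : M → M → Prop} (S : DS E) (f : M → M → M → M → M) : Prop where
  out : DFun S (fun v : Fin 4 → M => f (v 0) (v 1) (v 2) (v 3))

/-- Bind one function value. -/
theorem Dfn.bind {f : (Fin n → M) → M} (hf : DFun S f) {Q : (Fin n → M) → M → Prop}
    (h : Dfn S (fun w : Fin (n + 1) → M => Q (fun i => w i.castSucc) (w (Fin.last n)))) :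
    Dfn S (fun v => Q v (f v)) := by
  have := hf.out
  refine Dfn.congr (P := fun v => ∃ a, a = f v ∧ Q v a) ?_ fun v => by simp
  exact Dfn.exI (Q := fun v a => a = f v ∧ Q v a)

theorem DFun.bind {f : (Fin n → M) → M} (hf : DFun S f) {g : (Fin n → M) → M → M}
    (h : DFun S (fun w : Fin (n + 1) → M => g (fun i => w i.castSucc) (w (Fin.last n)))) :
    DFun S (fun v => g v (f v)) := by
  refine ⟨?_⟩
  refine Dfn.bind (f := fun w : Fin (n + 1) → M => f (fun i => w i.castSucc))
    (hf.reindex Fin.castSucc)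
    (Q := fun w a => w (Fin.last n) = g (fun i => w i.castSucc) a) ?_
  let σ : Fin (n + 1 + 1) → Fin (n + 2) :=
    Fin.snoc (α := fun _ => Fin (n + 2)) (Fin.snoc (α := fun _ => Fin (n + 2))
      (fun i => i.castSucc.castSucc) (Fin.last (n + 1))) (Fin.last n).castSucc
  refine (h.out.reindex σ).congr fun v => ?_
  simp [σ]

theorem DFun.weaken {f : (Fin n → M) → M} (h : DFun S f) :
    DFun S (fun v : Fin (n + 1) → M => f (fun i => v i.castSucc)) := h.reindex _

variable {m : ℕ}

theorem Dfn.comp (P : (Fin n → M) → Prop) (hP : Dfn S P) (f : Fin n → (Fin m → M) → M)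
    (hf : ∀ i, DFun S (f i)) : Dfn S (fun v => P (fun i => f i v)) := by
  suffices H : ∀ (k m : ℕ) (P : (Fin (m + k) → M) → Prop), Dfn S P →
      ∀ (f : Fin k → (Fin m → M) → M), (∀ i, DFun S (f i)) →
      Dfn S (fun v => P (Fin.append v (fun i => f i v))) by
    have := H n m (fun w => P (fun i => w (Fin.natAdd m i))) (hP.reindex _) f hf
    simpa using this
  intro k
  induction k with
  | zero =>
    intro m P hP f hf
    refine hP.congr fun v => ?_
    have : Fin.append v (fun i => f i v) = v := by
      funext i
      exact Fin.append_left v _ i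
    rw [this]
  | succ k ih =>
    intro m P hP f hf
    have h1 := ih (m + 1) (fun w : Fin (m + 1 + k) → M => P (fun i => w (Fin.cast (by omega) i)))
      (hP.reindex _) (fun i v => f i.succ (fun j => v j.castSucc)) (fun i => (hf _).reindex _)
    have h2 := Dfn.bind (hf 0) (Q := fun v a => P (fun i => (Fin.append (Fin.snoc v a : Fin (m + 1) → M)
        (fun i => f i.succ v)) (Fin.cast (by omega) i))) (by
        refine h1.congr fun w => ?_
        rw [show (Fin.snoc (fun i => w i.castSucc) (w (Fin.last m)) : Fin (m + 1) → M) = w from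
          Fin.snoc_init_self w])
    refine h2.congr fun v => ?_
    have : Fin.append v (fun i => f i v) = (fun i => (Fin.append (Fin.snoc v (f 0 v) : Fin (m + 1) → M)
        (fun i => f i.succ v)) (Fin.cast (by omega) i)) := by
      funext i
      refine Fin.addCases (fun i => ?_) (fun i => ?_) i
      · rw [Fin.append_left]
        have : Fin.cast (by omega) (Fin.castAdd (k + 1) i) = Fin.castAdd k (i.castSucc) := by
          ext; simp
        rw [this, Fin.append_left]; simp
      · rw [Fin.append_right]
        refine Fin.cases ?_ (fun i => ?_) i
        · have : Fin.cast (by omega) (Fin.natAdd m (0 : Fin (k + 1))) = Fin.castAdd k (Fin.last m) := by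
            ext; simp
          rw [this, Fin.append_left]; simp
        · have : Fin.cast (by omega) (Fin.natAdd m i.succ) = Fin.natAdd (m + 1) i := by
            ext; simp; omega
          rw [this, Fin.append_right]
    rw [this]

theorem DFun.comp (g : (Fin n → M) → M) (hg : DFun S g) (f : Fin n → (Fin m → M) → M)
    (hf : ∀ i, DFun S (f i)) : DFun S (fun v => g (fun i => f i v)) := by
  refine ⟨?_⟩
  have := Dfn.comp (m := m + 1) (fun w : Fin (n + 1) → M => w (Fin.last n) = g (fun i => w i.castSucc))
    hg.out (fun i v => (Fin.snoc (fun i => f i (fun j => v j.castSucc)) (v (Fin.last m)) : Fin (n + 1) → M) i)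
    (by
      intro i
      refine Fin.lastCases ?_ (fun i => ?_) i
      · simp only [Fin.snoc_last]; infer_instance
      · simp only [Fin.snoc_castSucc]; exact (hf i).weaken)
  refine this.congr fun v => ?_
  simp

instance Dfn.memI {f g : (Fin m → M) → M} [hf : DFun S f] [hg : DFun S g] :
    Dfn S (fun v => E (f v) (g v)) :=
  Dfn.comp (fun w : Fin 2 → M => E (w 0) (w 1)) (Dfn.memVar _ _) ![f, g]
    (by intro i; fin_cases i <;> assumption)

instance Dfn.eqI {f g : (Fin m → M) → M} [hf : DFun S f] [hg : DFun S g] :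
    Dfn S (fun v => f v = g v) :=
  Dfn.comp (fun w : Fin 2 → M => w 0 = w 1) (Dfn.eqVar _ _) ![f, g]
    (by intro i; fin_cases i <;> assumption)

instance (priority := 900) Dfn.comp1 {P : M → Prop} {f : (Fin m → M) → M} [hP : D1 S P]
    [hf : DFun S f] : Dfn S (fun v => P (f v)) :=
  Dfn.comp _ hP.out ![f] (by intro i; fin_cases i; assumption)

instance (priority := 900) Dfn.comp2 {P : M → M → Prop} {f g : (Fin m → M) → M} [hP : D2 S P]
    [hf : DFun S f] [hg : DFun S g] : Dfn S (fun v => P (f v) (g v)) :=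
  Dfn.comp _ hP.out ![f, g] (by intro i; fin_cases i <;> assumption)

instance (priority := 900) Dfn.comp3 {P : M → M → M → Prop} {f g h : (Fin m → M) → M} [hP : D3 S P]
    [hf : DFun S f] [hg : DFun S g] [hh : DFun S h] :
    Dfn S (fun v => P (f v) (g v) (h v)) :=
  Dfn.comp _ hP.out ![f, g, h] (by intro i; fin_cases i <;> assumption)

instance (priority := 900) Dfn.comp4 {P : M → M → M → M → Prop} {f g h k : (Fin m → M) → M}
    [hP : D4 S P] [hf : DFun S f] [hg : DFun S g] [hh : DFun S h] [hk : DFun S k] :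
    Dfn S (fun v => P (f v) (g v) (h v) (k v)) :=
  Dfn.comp _ hP.out ![f, g, h, k] (by intro i; fin_cases i <;> assumption)

instance (priority := 900) DFun.comp1 {P : M → M} {f : (Fin m → M) → M} [hP : F1 S P]
    [hf : DFun S f] : DFun S (fun v => P (f v)) :=
  DFun.comp _ hP.out ![f] (by intro i; fin_cases i; assumption)

instance (priority := 900) DFun.comp2 {P : M → M → M} {f g : (Fin m → M) → M} [hP : F2 S P]
    [hf : DFun S f] [hg : DFun S g] : DFun S (fun v => P (f v) (g v)) :=
  DFun.comp _ hP.out ![f, g] (by intro i; fin_cases i <;> assumption)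

instance (priority := 900) DFun.comp3 {P : M → M → M → M} {f g h : (Fin m → M) → M} [hP : F3 S P]
    [hf : DFun S f] [hg : DFun S g] [hh : DFun S h] :
    DFun S (fun v => P (f v) (g v) (h v)) :=
  DFun.comp _ hP.out ![f, g, h] (by intro i; fin_cases i <;> assumption)

instance (priority := 900) DFun.comp4 {P : M → M → M → M → M} {f g h k : (Fin m → M) → M}
    [hP : F4 S P] [hf : DFun S f] [hg : DFun S g] [hh : DFun S h] [hk : DFun S k] :
    DFun S (fun v => P (f v) (g v) (h v) (k v)) :=
  DFun.comp _ hP.out ![f, g, h, k] (by intro i; fin_cases i <;> assumption)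

instance : D1 S (TransE E) := ⟨by unfold TransE; infer_instance⟩
instance : D1 S (OrdE E) := ⟨by unfold OrdE; infer_instance⟩
instance : D2 S (SubE E) := ⟨by unfold SubE; infer_instance⟩
instance : D3 S (UPairE E) := ⟨by unfold UPairE; infer_instance⟩
instance : D3 S (InterSpecE E) := ⟨by unfold InterSpecE; infer_instance⟩

end Dfn

end Paper

namespace Paper

/-! ## Part 2: parameter definability, the class of ZF structures, basic sets -/

section pDS
variable {M : Type}

theorem append0 {n : ℕ} (p : Fin 0 → M) (v : Fin n → M) (i : Fin n) :
    Fin.append p v (Fin.natAdd 0 i) = v i := Fin.append_right p v i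

/-- Unary definability, in unfolded form. -/
abbrev Q1 {E : M → M → Prop} (S : DS E) (P : M → Prop) : Prop := Dfn S (fun v : Fin 1 → M => P (v 0))
/-- Binary definability, in unfolded form. -/
abbrev Q2 {E : M → M → Prop} (S : DS E) (P : M → M → Prop) : Prop :=
  Dfn S (fun v : Fin 2 → M => P (v 0) (v 1))
/-- Unary definable function, in unfolded form. -/
abbrev G1 {E : M → M → Prop} (S : DS E) (P : M → M) : Prop := DFun S (fun v : Fin 1 → M => P (v 0))
/-- Binary definable function, in unfolded form. -/
abbrev G2 {E : M → M → Prop} (S : DS E) (P : M → M → M) : Prop :=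
  DFun S (fun v : Fin 2 → M => P (v 0) (v 1))

/-- Definability with parameters from `S`. -/
def pDS (E : M → M → Prop) (S : Set M) : DS E where
  R := fun {n} P => ∃ (k : ℕ) (p : Fin k → M) (φ : SetFormula (k + n)), (∀ i, p i ∈ S) ∧
    ∀ v, P v ↔ Realize E φ (Fin.append p v)
  memVar := fun i j => ⟨0, Fin.elim0, .mem (Fin.natAdd 0 i) (Fin.natAdd 0 j), fun i => i.elim0,
    fun v => by simp only [Realize, append0]⟩
  eqVar := fun i j => ⟨0, Fin.elim0, .eq (Fin.natAdd 0 i) (Fin.natAdd 0 j), fun i => i.elim0,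
    fun v => by simp only [Realize, append0]⟩
  fal := ⟨0, Fin.elim0, .fal, fun i => i.elim0, fun v => by simp only [Realize]⟩
  imp := by
    rintro n P Q ⟨k, p, φ, hp, hφ⟩ ⟨l, q, ψ, hq, hψ⟩
    let f : Fin (k + n) → Fin (k + l + n) :=
      Fin.addCases (fun i => Fin.castAdd n (Fin.castAdd l i)) (fun i => Fin.natAdd (k + l) i)
    let g : Fin (l + n) → Fin (k + l + n) :=
      Fin.addCases (fun i => Fin.castAdd n (Fin.natAdd k i)) (fun i => Fin.natAdd (k + l) i)
    refine ⟨k + l, Fin.append p q, .imp (φ.rename f) (ψ.rename g), ?_, fun v => ?_⟩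
    · intro i
      refine Fin.addCases (fun i => ?_) (fun i => ?_) i
      · simpa using hp i
      · simpa using hq i
    · simp only [Realize, realize_rename, hφ, hψ]
      have h1 : (fun i => Fin.append (Fin.append p q) v (f i)) = Fin.append p v := by
        funext i
        refine Fin.addCases (fun i => ?_) (fun i => ?_) i <;> simp [f]
      have h2 : (fun i => Fin.append (Fin.append p q) v (g i)) = Fin.append q v := by
        funext i
        refine Fin.addCases (fun i => ?_) (fun i => ?_) i <;> simp [g]
      rw [h1, h2]
  all := by
    rintro n P ⟨k, p, φ, hp, hφ⟩
    refine ⟨k, p, .all φ, hp, fun v => ?_⟩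
    simp only [Realize]
    refine forall_congr' fun a => ?_
    rw [hφ, Fin.append_snoc]
  reidx := by
    rintro n m P σ ⟨k, p, φ, hp, hφ⟩
    let f : Fin (k + n) → Fin (k + m) :=
      Fin.addCases (fun i => Fin.castAdd m i) (fun i => Fin.natAdd k (σ i))
    refine ⟨k, p, φ.rename f, hp, fun v => ?_⟩
    show P _ ↔ _
    rw [hφ, realize_rename]
    have h1 : (fun i => Fin.append p v (f i)) = Fin.append p (fun i => v (σ i)) := by
      funext i
      refine Fin.addCases (fun i => ?_) (fun i => ?_) i <;> simp [f]
    rw [h1]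

theorem pDS_const (E : M → M → Prop) (S : Set M) {c : M} (hc : c ∈ S) : InS (pDS E S) c :=
  ⟨1, fun _ => c, .eq (Fin.natAdd 1 0) (Fin.castAdd 1 0), fun _ => hc, fun v => by
    simp only [Realize, Fin.append_left, Fin.append_right]⟩

instance (E : M → M → Prop) (c : M) : InS (pDS E Set.univ) c := pDS_const E _ trivial

theorem pDS_mono (E : M → M → Prop) {S T : Set M} (hST : S ⊆ T) {n : ℕ}
    {P : (Fin n → M) → Prop} (h : (pDS E S).R P) : (pDS E T).R P := by
  obtain ⟨k, p, φ, hp, hφ⟩ := h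
  exact ⟨k, p, φ, fun i => hST (hp i), hφ⟩

theorem DS.realize {E : M → M → Prop} (S : DS E) {n : ℕ} (φ : SetFormula n) :
    S.R (fun v => Realize E φ v) := by
  induction φ with
  | mem i j => exact S.memVar i j
  | eq i j => exact S.eqVar i j
  | fal => exact S.fal
  | imp φ ψ h1 h2 => exact S.imp h1 h2
  | all φ h => exact S.all h

/-- Fixing parameters at the end. -/
theorem Dfn.fix {E : M → M → Prop} {S : DS E} {n k : ℕ} {P : (Fin (n + k) → M) → Prop}
    (h : Dfn S P) (p : Fin k → M) (hp : ∀ i, InS S (p i)) :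
    Dfn S (fun v : Fin n → M => P (Fin.append v p)) := by
  have := Dfn.comp (m := n) P h (fun i v => Fin.append v p i) (by
    intro i
    refine Fin.addCases (fun i => ?_) (fun i => ?_) i
    · simp only [Fin.append_left]; infer_instance
    · simp only [Fin.append_right]
      have := hp i
      infer_instance)
  exact this

theorem Dfn.allN {E : M → M → Prop} {S : DS E} {m : ℕ} (n : ℕ) {P : (Fin (m + n) → M) → Prop}
    (h : Dfn S P) : Dfn S (fun v : Fin m → M => ∀ u : Fin n → M, P (Fin.append v u)) := by
  induction n with
  | zero =>
    refine h.congr fun v => ?_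
    constructor
    · intro h
      have := h Fin.elim0
      simpa using this
    · intro h u
      have : Fin.append v u = v := by
        funext i
        exact Fin.append_left v _ i
      rw [this]; exact h
  | succ n ih =>
    have := ih (P := fun w : Fin (m + n) → M => ∀ a, P (Fin.snoc w a)) ⟨S.all h.out⟩
    refine this.congr fun v => ?_
    constructor
    · intro h u a
      rw [← Fin.append_snoc]; exact h _
    · intro h u
      have := h (fun i => u i.castSucc) (u (Fin.last n))
      rw [← Fin.append_snoc] at this
      have h2 : (Fin.snoc (fun i => u i.castSucc) (u (Fin.last n)) : Fin (n+1) → M) = u :=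
        Fin.snoc_init_self u
      rw [h2] at this
      exact this

theorem Dfn.exN {E : M → M → Prop} {S : DS E} {m : ℕ} (n : ℕ) {P : (Fin (m + n) → M) → Prop}
    (h : Dfn S P) : Dfn S (fun v : Fin m → M => ∃ u : Fin n → M, P (Fin.append v u)) := by
  have h1 : Dfn S (fun w : Fin (m + n) → M => ¬ P w) := inferInstance
  exact (Dfn.notI (hP := Dfn.allN n h1)).congr fun v => by simp

end pDS

/-- Structures satisfying ZF with respect to a definability structure. -/
class ZF (M : Type) where
  E : M → M → Prop
  T : DS E
  ne : Nonempty M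
  consts : ∀ c, InS T c
  ext : AxExtE E
  pair : AxPairE E
  union : AxUnionE E
  pow : AxPowE E
  inf : AxInfE E
  found : AxFoundE E
  sep : ∀ P : M → Prop, D1 T P → ∀ a, ∃ s, ∀ z, E z s ↔ E z a ∧ P z
  repl : ∀ P : M → M → Prop, D2 T P → ∀ a, (∀ x, E x a → ∀ y y', P x y → P x y' → y = y') →
    ∃ b, ∀ y, E y b ↔ ∃ x, E x a ∧ P x y

infix:50 "∊" => ZF.E
notation "𝕋" => ZF.T

variable {M : Type} [ZF M]

instance (c : M) : InS 𝕋 c := ZF.consts c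

theorem ext {x y : M} (h : ∀ z, z ∊ x ↔ z ∊ y) : x = y := ZF.ext x y h

section the
open Classical

theorem exists_empty : ∃ e : M, ∀ z, ¬ z ∊ e := by
  obtain ⟨I, ⟨e, _, he⟩, _⟩ := ZF.inf (M := M)
  exact ⟨e, he⟩

/-- The empty set. -/
noncomputable def emp : M := exists_empty.choose
@[simp] theorem not_mem_emp (z : M) : ¬ z ∊ emp := exists_empty.choose_spec z

theorem eq_emp_iff {x : M} : x = emp ↔ ∀ z, ¬ z ∊ x := by
  constructor
  · rintro rfl; simp
  · intro h; apply ext; intro z; simp [h z]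

/-- The unique object with a property (junk: the empty set). -/
noncomputable def the (P : M → Prop) : M := if h : ∃! y, P y then h.choose else emp

theorem the_spec {P : M → Prop} (h : ∃! y, P y) : P (the P) := by
  unfold the; rw [dif_pos h]; exact h.choose_spec.1

theorem the_eq {P : M → Prop} {y : M} (hy : P y) (h : ∀ z, P z → z = y) : the P = y := by
  have : ∃! y, P y := ⟨y, hy, h⟩
  exact h _ (the_spec this)

theorem the_junk {P : M → Prop} (h : ¬ ∃! y, P y) : the P = emp := by
  unfold the; rw [dif_neg h]

instance DFun.theI {S : DS (ZF.E (M := M))} {n : ℕ} {Q : (Fin n → M) → M → Prop}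
    [h : Dfn S (fun w : Fin (n + 1) → M => Q (fun i => w i.castSucc) (w (Fin.last n)))] :
    DFun S (fun v => the (fun y => Q v y)) := by
  refine DFun.of_graph (G := fun v y => (Q v y ∧ ∀ z, Q v z → z = y) ∨
    ((¬ ∃ y, Q v y ∧ ∀ z, Q v z → z = y) ∧ ∀ z, ¬ z ∊ y)) ?_ ?_
  · have h2 : Dfn S (fun w : Fin (n + 1 + 1) → M =>
        Q (fun i => w i.castSucc.castSucc) (w (Fin.last (n + 1)))) := by
      refine (h.reindex (SetFormula.liftF Fin.castSucc)).congr fun v => ?_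
      simp [SetFormula.liftF]
    have h3 : Dfn S (fun w : Fin (n + 1 + 1 + 1) → M =>
        Q (fun i => w i.castSucc.castSucc.castSucc) (w (Fin.last (n + 2)))) := by
      refine (h.reindex (SetFormula.liftF (fun i => i.castSucc.castSucc))).congr fun v => ?_
      simp [SetFormula.liftF]
    infer_instance
  · intro v y
    by_cases hu : ∃! y, Q v y
    · constructor
      · rintro rfl
        left
        refine ⟨the_spec hu, fun z hz => hu.unique hz (the_spec hu)⟩
      · rintro (⟨h1, h2⟩ | ⟨h1, _⟩)
        · exact (the_eq h1 h2).symm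
        · exact absurd hu h1
    · rw [the_junk hu, eq_emp_iff]
      constructor
      · intro h
        right
        exact ⟨hu, h⟩
      · rintro (⟨h1, h2⟩ | ⟨_, h2⟩)
        · exact absurd ⟨y, h1, h2⟩ hu
        · exact h2

/-- Class term. -/
noncomputable def cls (P : M → Prop) : M := the (fun s => ∀ z, z ∊ s ↔ P z)

theorem mem_cls {P : M → Prop} (h : ∃ s : M, ∀ z, z ∊ s ↔ P z) (z : M) : z ∊ cls P ↔ P z := by
  obtain ⟨s, hs⟩ := h
  have : cls P = s := the_eq hs fun t ht => ext fun z => by rw [ht, hs]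
  rw [this, hs]

instance DFun.clsI {S : DS (ZF.E (M := M))} {n : ℕ} {Q : (Fin n → M) → M → Prop}
    [h : Dfn S (fun w : Fin (n + 1) → M => Q (fun i => w i.castSucc) (w (Fin.last n)))] :
    DFun S (fun v => cls (fun y => Q v y)) := by
  have h3 : Dfn S (fun w : Fin (n + 1 + 1) → M =>
        Q (fun i => w i.castSucc.castSucc) (w (Fin.last (n + 1)))) := by
      refine (h.reindex (SetFormula.liftF Fin.castSucc)).congr fun v => ?_
      simp [SetFormula.liftF]
  unfold cls
  infer_instance

end the

instance InS.emp {S : DS (ZF.E (M := M))} : InS S emp := ⟨by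
  have : Dfn S (fun v : Fin 1 → M => ∀ z, ¬ z ∊ v 0) := inferInstance
  exact (this.congr fun v => eq_emp_iff).out⟩

/-- Separation term. -/
noncomputable def sep (a : M) (P : M → Prop) : M := cls (fun z => z ∊ a ∧ P z)
theorem mem_sep {a : M} {P : M → Prop} [h : Q1 𝕋 P] {z : M} : z ∊ sep a P ↔ z ∊ a ∧ P z :=
  mem_cls (ZF.sep P ⟨h⟩ a) z

/-- Image term. -/
noncomputable def img (G : M → M) (a : M) : M := cls (fun y => ∃ x, x ∊ a ∧ y = G x)
theorem mem_img {a : M} {G : M → M} [h : G1 𝕋 G] {z : M} :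
    z ∊ img G a ↔ ∃ x, x ∊ a ∧ z = G x :=
  mem_cls (ZF.repl (fun x y => y = G x) (have : F1 𝕋 G := ⟨h⟩; ⟨inferInstance⟩) a (by rintro x _ y y' rfl rfl; rfl)) z

instance DFun.sepI {S : DS (ZF.E (M := M))} {n : ℕ} {a : (Fin n → M) → M}
    {Q : (Fin n → M) → M → Prop} [ha : DFun S a]
    [h : Dfn S (fun w : Fin (n + 1) → M => Q (fun i => w i.castSucc) (w (Fin.last n)))] :
    DFun S (fun v => sep (a v) (fun y => Q v y)) := by
  have := ha.weaken
  unfold sep; infer_instance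

instance DFun.imgI {S : DS (ZF.E (M := M))} {n : ℕ} {a : (Fin n → M) → M}
    {G : (Fin n → M) → M → M} [ha : DFun S a]
    [h : DFun S (fun w : Fin (n + 1) → M => G (fun i => w i.castSucc) (w (Fin.last n)))] :
    DFun S (fun v => img (fun y => G v y) (a v)) := by
  have := ha.weaken.weaken
  have h3 : DFun S (fun w : Fin (n + 1 + 1) → M =>
        G (fun i => w i.castSucc.castSucc) (w (Fin.last (n + 1)))) := by
    have := (h.reindex (SetFormula.liftF (fun i : Fin n => i.castSucc)))
    simpa [SetFormula.liftF] using this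
  unfold img
  infer_instance

/-- Unordered pair. -/
noncomputable def up (a b : M) : M := cls (fun z => z = a ∨ z = b)
@[simp] theorem mem_up {a b z : M} : z ∊ up a b ↔ z = a ∨ z = b := mem_cls (ZF.pair a b) z
instance {S : DS (ZF.E (M := M))} : F2 S up := ⟨by unfold up; infer_instance⟩

/-- Union. -/
noncomputable def sU (a : M) : M := cls (fun z => ∃ y, y ∊ a ∧ z ∊ y)
@[simp] theorem mem_sU {a z : M} : z ∊ sU a ↔ ∃ y, y ∊ a ∧ z ∊ y := mem_cls (ZF.union a) z
instance {S : DS (ZF.E (M := M))} : F1 S sU := ⟨by unfold sU; infer_instance⟩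

/-- Power set. -/
noncomputable def pw (a : M) : M := cls (fun z => SubE ZF.E z a)
@[simp] theorem mem_pw {a z : M} : z ∊ pw a ↔ SubE ZF.E z a := mem_cls (ZF.pow a) z
instance {S : DS (ZF.E (M := M))} : F1 S pw := ⟨by unfold pw; infer_instance⟩

/-- Ordered pair. -/
noncomputable def pr (a b : M) : M := up (up a a) (up a b)
instance {S : DS (ZF.E (M := M))} : F2 S pr := ⟨by unfold pr; infer_instance⟩

theorem up_inj {a b c d : M} (h : up a b = up c d) : (a = c ∧ b = d) ∨ (a = d ∧ b = c) := by
  have h1 : ∀ z, (z = a ∨ z = b) ↔ (z = c ∨ z = d) := fun z => by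
    rw [← mem_up, h, mem_up]
  have := h1 a; have := h1 b; have := h1 c; have := h1 d
  grind

theorem pr_inj {a b c d : M} : pr a b = pr c d ↔ a = c ∧ b = d := by
  constructor
  · intro h
    unfold pr at h
    rcases up_inj h with ⟨h1, h2⟩ | ⟨h1, h2⟩ <;> have h1 := up_inj h1 <;> have h2 := up_inj h2 <;>
      grind
  · rintro ⟨rfl, rfl⟩; rfl

/-- Binary union. -/
noncomputable def bU (a b : M) : M := sU (up a b)
@[simp] theorem mem_bU {a b z : M} : z ∊ bU a b ↔ z ∊ a ∨ z ∊ b := by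
  unfold bU; rw [mem_sU]; simp
instance {S : DS (ZF.E (M := M))} : F2 S bU := ⟨by unfold bU; infer_instance⟩

/-- Binary intersection. -/
noncomputable def bI (a b : M) : M := sep a (fun z => z ∊ b)
@[simp] theorem mem_bI {a b z : M} : z ∊ bI a b ↔ z ∊ a ∧ z ∊ b := by
  unfold bI
  rw [mem_sep]
instance {S : DS (ZF.E (M := M))} : F2 S bI := ⟨by unfold bI; infer_instance⟩

/-- Successor. -/
noncomputable def sc (a : M) : M := bU a (up a a)
@[simp] theorem mem_sc {a z : M} : z ∊ sc a ↔ z ∊ a ∨ z = a := by unfold sc; simp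
instance {S : DS (ZF.E (M := M))} : F1 S sc := ⟨by unfold sc; infer_instance⟩

end Paper

namespace Paper
variable {M : Type} [ZF M]

/-! ## Part 3: ordinals and recursion -/

/-- Ordinals. -/
abbrev Od (x : M) : Prop := OrdE ZF.E x
/-- Inclusion. -/
abbrev Sb (x y : M) : Prop := SubE ZF.E x y
/-- Transitive sets. -/
abbrev Tr (x : M) : Prop := TransE ZF.E x

theorem Sb.rfl' {x : M} : Sb x x := fun _ h => h
theorem Sb.trans' {x y z : M} (h : Sb x y) (h' : Sb y z) : Sb x z := fun _ hz => h' _ (h _ hz)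
theorem Sb.antisymm' {x y : M} (h : Sb x y) (h' : Sb y x) : x = y :=
  ext fun z => ⟨h z, h' z⟩

theorem found (P : M → Prop) [Q1 𝕋 P] (a : M) (h : ∃ z, z ∊ a ∧ P z) :
    ∃ m, m ∊ a ∧ P m ∧ ∀ z, z ∊ m → ¬ (z ∊ a ∧ P z) := by
  obtain ⟨m, hm, hm2⟩ := ZF.found (sep a P) (by
    obtain ⟨z, hz⟩ := h; exact ⟨z, mem_sep.2 hz⟩)
  rw [mem_sep] at hm
  exact ⟨m, hm.1, hm.2, fun z hz hz2 => hm2 z (mem_sep.2 hz2) hz⟩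

theorem mem_irrefl (x : M) : ¬ x ∊ x := by
  intro h
  obtain ⟨m, hm, hm2⟩ := ZF.found (up x x) ⟨x, by simp⟩
  simp at hm hm2
  exact hm2 (hm ▸ h)

theorem mem_asymm {x y : M} (h : x ∊ y) (h' : y ∊ x) : False := by
  obtain ⟨m, hm, hm2⟩ := ZF.found (up x y) ⟨x, by simp⟩
  simp at hm hm2
  rcases hm with rfl | rfl
  · exact hm2.2 h'
  · exact hm2.1 h

theorem mem_asymm3 {x y z : M} (h : x ∊ y) (h' : y ∊ z) (h'' : z ∊ x) : False := by
  obtain ⟨m, hm, hm2⟩ := ZF.found (bU (up x y) (up z z)) ⟨x, by simp⟩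
  simp at hm hm2
  rcases hm with (rfl | rfl) | rfl
  · exact hm2 _ (Or.inr rfl) h''
  · exact hm2 _ (Or.inl (Or.inl rfl)) h
  · exact hm2 _ (Or.inl (Or.inr rfl)) h'

theorem Od.mem {α β : M} (h : Od α) (hβ : β ∊ α) : Od β :=
  ⟨h.2 β hβ, fun y hy => h.2 y (h.1 β hβ y hy)⟩

theorem Od.trans {α β γ : M} (h : Od α) (h1 : γ ∊ β) (h2 : β ∊ α) : γ ∊ α := h.1 β h2 γ h1

theorem Od.sub {α β : M} (h : Od α) (h2 : β ∊ α) : Sb β α := h.1 β h2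

theorem least (P : M → Prop) [Q1 𝕋 P] {α : M} (hα : Od α) (h : P α) :
    ∃ β, Od β ∧ P β ∧ ∀ γ, γ ∊ β → ¬ P γ := by
  by_cases h1 : ∃ z, z ∊ α ∧ P z
  · obtain ⟨m, hm, hm2, hm3⟩ := found P α h1
    exact ⟨m, hα.mem hm, hm2, fun γ hγ hp => hm3 γ hγ ⟨hα.trans hγ hm, hp⟩⟩
  · exact ⟨α, hα, h, fun γ hγ hp => h1 ⟨γ, hγ, hp⟩⟩

theorem ord_ind (P : M → Prop) [hP : Q1 𝕋 P] (h : ∀ α, Od α → (∀ β, β ∊ α → P β) → P α) :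
    ∀ α, Od α → P α := by
  intro α hα
  by_contra hc
  have : D1 𝕋 P := ⟨hP⟩
  obtain ⟨β, h1, h2, h3⟩ := least (fun x => ¬ P x) hα hc
  exact h2 (h β h1 fun γ hγ => by simpa using h3 γ hγ)

theorem trich {α β : M} (hα : Od α) (hβ : Od β) : α ∊ β ∨ α = β ∨ β ∊ α := by
  by_contra hc
  obtain ⟨a, ha, ⟨b0, hb0, hb1⟩, ha2⟩ :=
    least (fun a => ∃ b, Od b ∧ ¬ (a ∊ b ∨ a = b ∨ b ∊ a)) hα ⟨β, hβ, hc⟩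
  obtain ⟨b, hb, hb2, hb3⟩ := least (fun b => ¬ (a ∊ b ∨ a = b ∨ b ∊ a)) hb0 hb1
  apply hb2
  right; left
  apply ext
  intro z
  constructor
  · intro hz
    have h1 : ¬ ∃ b, Od b ∧ ¬ (z ∊ b ∨ z = b ∨ b ∊ z) := ha2 z hz
    have h2 : z ∊ b ∨ z = b ∨ b ∊ z := by
      by_contra h; exact h1 ⟨b, hb, h⟩
    rcases h2 with h | rfl | h
    · exact h
    · exact absurd (Or.inr (Or.inr hz)) hb2
    · exact absurd (Or.inr (Or.inr (ha.trans h hz))) hb2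
  · intro hz
    have h2 : a ∊ z ∨ a = z ∨ z ∊ a := by
      by_contra h; exact hb3 z hz h
    rcases h2 with h | rfl | h
    · exact absurd (Or.inl (hb.trans h hz)) hb2
    · exact absurd (Or.inl hz) hb2
    · exact h

theorem not_mem_iff {α β : M} (hα : Od α) (hβ : Od β) : ¬ α ∊ β ↔ Sb β α := by
  constructor
  · intro h
    rcases trich hα hβ with h1 | rfl | h1
    · exact absurd h1 h
    · exact Sb.rfl'
    · exact hα.sub h1
  · intro h h1
    exact mem_irrefl α (h α h1)

theorem sub_iff {α β : M} (hα : Od α) (hβ : Od β) : Sb α β ↔ α ∊ β ∨ α = β := by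
  constructor
  · intro h
    rcases trich hα hβ with h1 | rfl | h1
    · exact Or.inl h1
    · exact Or.inr rfl
    · exact absurd (h _ h1) (mem_irrefl β)
  · rintro (h | rfl)
    · exact hβ.sub h
    · exact Sb.rfl'

theorem mem_of_sub_mem {α β γ : M} (hα : Od α) (hγ : Od γ) (h : Sb α β) (h' : β ∊ γ) : α ∊ γ := by
  rcases (sub_iff hα (hγ.mem h')).1 h with h1 | rfl
  · exact hγ.trans h1 h'
  · exact h'

theorem od_emp : Od (emp : M) := ⟨fun y hy => by simp at hy, fun y hy => by simp at hy⟩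

theorem od_sc {α : M} (hα : Od α) : Od (sc α) := by
  refine ⟨fun y hy z hz => ?_, fun y hy => ?_⟩
  · rw [mem_sc] at hy ⊢
    rcases hy with hy | rfl
    · exact Or.inl (hα.trans hz hy)
    · exact Or.inl hz
  · rw [mem_sc] at hy
    rcases hy with hy | rfl
    · exact hα.2 _ hy
    · exact hα.1

theorem mem_sc_iff {α β : M} (hα : Od α) (hβ : Od β) : β ∊ sc α ↔ Sb β α := by
  rw [mem_sc, sub_iff hβ hα]

@[simp] theorem mem_sc_self (α : M) : α ∊ sc α := by simp

theorem sc_sub {α β : M} (hβ : Od β) (h : α ∊ β) : Sb (sc α) β := by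
  intro z hz
  rw [mem_sc] at hz
  rcases hz with hz | rfl
  · exact hβ.trans hz h
  · exact h

theorem sc_inj {α β : M} (h : sc α = sc β) : α = β := by
  have h1 : α ∊ sc β := h ▸ mem_sc_self α
  have h2 : β ∊ sc α := h ▸ mem_sc_self β
  rw [mem_sc] at h1 h2
  rcases h1 with h1 | h1
  · rcases h2 with h2 | h2
    · exact (mem_asymm h1 h2).elim
    · exact h2.symm
  · exact h1

theorem sc_ne_emp (α : M) : sc α ≠ emp := by
  intro h
  have := mem_sc_self α
  rw [h] at this
  simp at this

theorem od_sU {a : M} (h : ∀ x, x ∊ a → Od x) : Od (sU a) := by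
  refine ⟨fun y hy z hz => ?_, fun y hy => ?_⟩
  · rw [mem_sU] at hy ⊢
    obtain ⟨x, hx, hyx⟩ := hy
    exact ⟨x, hx, (h x hx).trans hz hyx⟩
  · rw [mem_sU] at hy
    obtain ⟨x, hx, hyx⟩ := hy
    exact (h x hx).2 y hyx

theorem sub_sU {a x : M} (h : x ∊ a) : Sb x (sU a) := fun z hz => mem_sU.2 ⟨x, h, hz⟩

theorem od_bU {a b : M} (ha : Od a) (hb : Od b) : Od (bU a b) :=
  od_sU (by intro x hx; simp at hx; rcases hx with rfl | rfl <;> assumption)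

theorem bU_mem {a b c : M} (hc : Od c) (ha : a ∊ c) (hb : b ∊ c) : bU a b ∊ c := by
  rcases trich (hc.mem ha) (hc.mem hb) with h | rfl | h
  · have : bU a b = b := ext fun z => by
      rw [mem_bU]
      exact ⟨fun hz => hz.elim (fun h1 => (hc.mem hb).trans h1 h) id, Or.inr⟩
    rwa [this]
  · have : bU a a = a := ext fun z => by simp
    rwa [this]
  · have : bU a b = a := ext fun z => by
      rw [mem_bU]
      exact ⟨fun hz => hz.elim id (fun h1 => (hc.mem ha).trans h1 h), Or.inl⟩
    rwa [this]

theorem emp_mem {α : M} (hα : Od α) (h : ∃ w, w ∊ α) : emp ∊ α := by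
  rcases trich od_emp hα with h1 | rfl | h1
  · exact h1
  · obtain ⟨w, hw⟩ := h; simp at hw
  · simp at h1

theorem no_all_ord (a : M) : ∃ α, Od α ∧ ¬ α ∊ a := by
  let b := sep a (fun x => Od x)
  have hb : ∀ x, x ∊ b → Od x := fun x hx => (mem_sep.1 hx).2
  refine ⟨sc (sU b), od_sc (od_sU hb), fun h => ?_⟩
  have : sc (sU b) ∊ b := mem_sep.2 ⟨h, od_sc (od_sU hb)⟩
  exact mem_irrefl (sU b) (mem_sU.2 ⟨_, this, mem_sc_self _⟩)

/-- Limit ordinals. -/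
def Lim (α : M) : Prop := Od α ∧ (∃ w, w ∊ α) ∧ ∀ β, β ∊ α → sc β ∊ α
instance {S : DS (ZF.E (M := M))} : D1 S (Lim (M := M)) := ⟨by unfold Lim; infer_instance⟩

theorem Lim.emp_mem {α : M} (h : Lim α) : emp ∊ α := Paper.emp_mem h.1 h.2.1

theorem zero_succ_lim {α : M} (hα : Od α) : α = emp ∨ (∃ β, Od β ∧ α = sc β) ∨ Lim α := by
  by_cases h : ∃ w, w ∊ α
  · right
    by_cases h2 : ∀ β, β ∊ α → sc β ∊ α
    · exact Or.inr ⟨hα, h, h2⟩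
    · left
      push Not at h2
      obtain ⟨β, hβ, h3⟩ := h2
      refine ⟨β, hα.mem hβ, ?_⟩
      rcases trich (od_sc (hα.mem hβ)) hα with h4 | h4 | h4
      · exact absurd h4 h3
      · exact h4.symm
      · rw [mem_sc] at h4
        rcases h4 with h4 | rfl
        · exact (mem_asymm h4 hβ).elim
        · exact (mem_irrefl _ hβ).elim
  · left
    rw [eq_emp_iff]
    exact fun z hz => h ⟨z, hz⟩

theorem not_lim_sc (α : M) : ¬ Lim (sc α) := by
  rintro ⟨h1, _, h3⟩
  exact mem_irrefl _ (h3 α (mem_sc_self α))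

theorem exists_lim : ∃ l : M, Lim l := by
  obtain ⟨I, ⟨e, heI, he⟩, hI⟩ := ZF.inf (M := M)
  have he : e = emp := eq_emp_iff.2 he
  subst he
  have hI : ∀ y, y ∊ I → sc y ∊ I := by
    intro y hy
    obtain ⟨s, hs, hs2⟩ := hI y hy
    have : s = sc y := ext fun z => by rw [hs2, mem_sc]
    exact this ▸ hs
  let X := sep I (fun x => Od x)
  have hX : ∀ x, x ∊ X ↔ x ∊ I ∧ Od x := fun x => mem_sep
  have hXo : Od (sU X) := od_sU fun x hx => ((hX x).1 hx).2
  refine ⟨sU X, hXo, ⟨emp, ?_⟩, fun β hβ => ?_⟩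
  · rw [mem_sU]
    exact ⟨sc emp, (hX _).2 ⟨hI _ heI, od_sc od_emp⟩, mem_sc_self _⟩
  · rw [mem_sU] at hβ ⊢
    obtain ⟨x, hx, hβ⟩ := hβ
    rw [hX] at hx
    refine ⟨sc x, (hX _).2 ⟨hI _ hx.1, od_sc hx.2⟩, ?_⟩
    rw [mem_sc_iff hx.2 (od_sc (hx.2.mem hβ))]
    exact sc_sub hx.2 hβ

/-- Least ordinal operator. -/
noncomputable def lst (P : M → Prop) : M := the (fun α => Od α ∧ P α ∧ ∀ β, β ∊ α → ¬ P β)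

instance DFun.lstI {S : DS (ZF.E (M := M))} {n : ℕ} {Q : (Fin n → M) → M → Prop}
    [h : Dfn S (fun w : Fin (n + 1) → M => Q (fun i => w i.castSucc) (w (Fin.last n)))] :
    DFun S (fun v => lst (fun y => Q v y)) := by
  have h3 : Dfn S (fun w : Fin (n + 1 + 1) → M =>
        Q (fun i => w i.castSucc.castSucc) (w (Fin.last (n + 1)))) := by
      refine (h.reindex (SetFormula.liftF Fin.castSucc)).congr fun v => ?_
      simp [SetFormula.liftF]
  unfold lst
  infer_instance

theorem lst_spec {P : M → Prop} [Q1 𝕋 P] (h : ∃ α, Od α ∧ P α) :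
    Od (lst P) ∧ P (lst P) ∧ ∀ β, β ∊ lst P → ¬ P β := by
  obtain ⟨α, hα, h⟩ := h
  obtain ⟨β, h1, h2, h3⟩ := least P hα h
  have : ∃! α, Od α ∧ P α ∧ ∀ β, β ∊ α → ¬ P β := by
    refine ⟨β, ⟨h1, h2, h3⟩, ?_⟩
    rintro γ ⟨k1, k2, k3⟩
    rcases trich k1 h1 with h | h | h
    · exact absurd k2 (h3 _ h)
    · exact h
    · exact absurd h2 (k3 _ h)
  exact the_spec this

theorem lst_le {P : M → Prop} [Q1 𝕋 P] {α : M} (hα : Od α) (h : P α) : Sb (lst P) α := by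
  obtain ⟨h1, h2, h3⟩ := lst_spec ⟨α, hα, h⟩
  rw [← not_mem_iff hα h1]
  exact fun h4 => h3 α h4 h

theorem od_lst (P : M → Prop) [Q1 𝕋 P] : Od (lst P) := by
  by_cases h : ∃ α, Od α ∧ P α
  · exact (lst_spec h).1
  · unfold lst
    rw [the_junk]
    · exact od_emp
    · rintro ⟨a, ⟨h1, h2, _⟩, _⟩
      exact h ⟨a, h1, h2⟩

/-- The least limit ordinal. -/
noncomputable def om : M := lst Lim
theorem lim_om : Lim (om : M) := by
  obtain ⟨l, hl⟩ := exists_lim (M := M)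
  exact (lst_spec ⟨l, hl.1, hl⟩).2.1
theorem om_le {l : M} (h : Lim l) : Sb om l := lst_le h.1 h
theorem not_lim_of_mem_om {l : M} (h : l ∊ om) : ¬ Lim l := fun hl =>
  mem_irrefl l (om_le hl l h)

/-! ### Recursion -/

theorem img_congr {G G' : M → M} {a : M} (h : ∀ x, x ∊ a → G x = G' x) : img G a = img G' a := by
  unfold img
  congr 1
  funext y
  apply propext
  constructor <;> rintro ⟨x, hx, rfl⟩
  · exact ⟨x, hx, h x hx⟩
  · exact ⟨x, hx, (h x hx).symm⟩

/-- Graph of a function on a set. -/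
noncomputable def gr (G : M → M) (a : M) : M := img (fun β => pr β (G β)) a

instance DFun.grI {S : DS (ZF.E (M := M))} {n : ℕ} {a : (Fin n → M) → M}
    {G : (Fin n → M) → M → M} [ha : DFun S a]
    [h : DFun S (fun w : Fin (n + 1) → M => G (fun i => w i.castSucc) (w (Fin.last n)))] :
    DFun S (fun v => gr (fun y => G v y) (a v)) := by
  unfold gr
  infer_instance

theorem gr_congr {G G' : M → M} {a : M} (h : ∀ x, x ∊ a → G x = G' x) : gr G a = gr G' a :=
  img_congr fun x hx => by rw [h x hx]

theorem mem_gr {G : M → M} [hG : G1 𝕋 G] {a p : M} : p ∊ gr G a ↔ ∃ x, x ∊ a ∧ p = pr x (G x) := by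
  have : F1 𝕋 G := ⟨hG⟩
  exact mem_img

/-- Application of a set function. -/
noncomputable def ap (f x : M) : M := the (fun y => pr x y ∊ f)
instance {S : DS (ZF.E (M := M))} : F2 S ap := ⟨by unfold ap; infer_instance⟩

theorem ap_gr {G : M → M} [hG : G1 𝕋 G] {a x : M} (hx : x ∊ a) : ap (gr G a) x = G x := by
  refine the_eq (mem_gr.2 ⟨x, hx, rfl⟩) fun z hz => ?_
  rw [mem_gr] at hz
  obtain ⟨y, _, h⟩ := hz
  rw [pr_inj] at h
  rw [h.2, h.1]

/-- First projection. -/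
noncomputable def fst (p : M) : M := the (fun x => ∃ y, p = pr x y)
/-- Second projection. -/
noncomputable def snd (p : M) : M := the (fun y => ∃ x, p = pr x y)
instance {S : DS (ZF.E (M := M))} : F1 S fst := ⟨by unfold fst; infer_instance⟩
instance {S : DS (ZF.E (M := M))} : F1 S snd := ⟨by unfold snd; infer_instance⟩
@[simp] theorem fst_pr (x y : M) : fst (pr x y) = x :=
  the_eq ⟨y, rfl⟩ (by rintro z ⟨w, h⟩; rw [pr_inj] at h; exact h.1.symm)
@[simp] theorem snd_pr (x y : M) : snd (pr x y) = y :=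
  the_eq ⟨x, rfl⟩ (by rintro z ⟨w, h⟩; rw [pr_inj] at h; exact h.2.symm)

/-- Approximations to a recursion. -/
def Appr (H : M → M → M) (α f : M) : Prop :=
  f = gr (ap f) α ∧ ∀ β, β ∊ α → ap f β = H β (gr (ap f) β)

/-- Recursive function on the ordinals. -/
noncomputable def rec (H : M → M → M) (α : M) : M := the (fun y => ∃ f, Appr H α f ∧ y = H α f)

instance recF1 {S : DS (ZF.E (M := M))} (H : M → M → M) [hH : G2 S H] : F1 S (rec H) := by
  have : F2 S H := ⟨hH⟩
  constructor
  unfold rec Appr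
  infer_instance

theorem appr_unique {H : M → M → M} [hH : G2 𝕋 H] {α α' f f' : M} (hα : Od α) (hα' : Od α')
    (h : Appr H α f) (h' : Appr H α' f') : ∀ β, β ∊ α → β ∊ α' → ap f β = ap f' β := by
  have : ∀ β, Od β → (β ∊ α → β ∊ α' → ap f β = ap f' β) := by
    refine ord_ind _ ?_
    intro β hβ ih h1 h2
    rw [h.2 β h1, h'.2 β h2, gr_congr (G := ap f) (G' := ap f')]
    intro x hx
    exact ih x hx (hα.trans hx h1) (hα'.trans hx h2)
  exact fun β h1 => this β (hα.mem h1) h1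

theorem rec_of_appr {H : M → M → M} [hH : G2 𝕋 H] {α f : M} (hα : Od α) (h : Appr H α f) :
    rec H α = H α f := by
  refine the_eq ⟨f, h, rfl⟩ ?_
  rintro z ⟨f', h', rfl⟩
  rw [h.1, h'.1]
  rw [gr_congr]
  intro x hx
  exact appr_unique hα hα h' h x hx hx

theorem appr_res {H : M → M → M} [hH : G2 𝕋 H] {α β f : M} (hα : Od α) (h : Appr H α f)
    (hβ : β ∊ α) : Appr H β (gr (ap f) β) := by
  have key : ∀ γ, γ ∊ β → ap (gr (ap f) β) γ = ap f γ := fun γ hγ => ap_gr hγ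
  refine ⟨(gr_congr key).symm, fun γ hγ => ?_⟩
  rw [key γ hγ, h.2 γ (hα.trans hγ hβ)]
  rw [gr_congr (G := ap (gr (ap f) β)) (G' := ap f)]
  intro x hx
  exact key x ((hα.mem hβ).trans hx hγ)

theorem appr_exists {H : M → M → M} [hH : G2 𝕋 H] : ∀ α, Od α → Appr H α (gr (rec H) α) := by
  have hF : F2 𝕋 H := ⟨hH⟩
  have hD : D2 𝕋 (Appr H) := ⟨by unfold Appr; infer_instance⟩
  refine ord_ind (fun α => Appr H α (gr (rec H) α)) ?_
  intro α hα ih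
  have key : ∀ γ, γ ∊ α → ap (gr (rec H) α) γ = rec H γ := fun γ hγ => ap_gr hγ
  refine ⟨(gr_congr key).symm, fun γ hγ => ?_⟩
  rw [key γ hγ, rec_of_appr (hα.mem hγ) (ih γ hγ)]
  rw [gr_congr (G := ap (gr (rec H) α)) (G' := rec H)]
  intro x hx
  exact key x (hα.trans hx hγ)

theorem rec_eq (H : M → M → M) [hH : G2 𝕋 H] {α : M} (hα : Od α) :
    rec H α = H α (gr (rec H) α) := rec_of_appr hα (appr_exists α hα)

theorem img_snd_gr (G : M → M) [hG : G1 𝕋 G] (a : M) : img snd (gr G a) = img G a := by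
  apply ext
  intro z
  rw [mem_img, mem_img]
  constructor
  · rintro ⟨p, hp, rfl⟩
    rw [mem_gr] at hp
    obtain ⟨x, hx, rfl⟩ := hp
    exact ⟨x, hx, by simp⟩
  · rintro ⟨x, hx, rfl⟩
    exact ⟨pr x (G x), mem_gr.2 ⟨x, hx, rfl⟩, by simp⟩

/-- Recursion depending on the set of previous values. -/
noncomputable def recI (H : M → M → M) : M → M := rec (fun α f => H α (img snd f))
instance recIF1 {S : DS (ZF.E (M := M))} (H : M → M → M) [hH : G2 S H] : F1 S (recI H) := by
  have : F2 S H := ⟨hH⟩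
  unfold recI; infer_instance

theorem recI_eq (H : M → M → M) [hH : G2 𝕋 H] {α : M} (hα : Od α) :
    recI H α = H α (img (recI H) α) := by
  have hF : F2 𝕋 H := ⟨hH⟩
  have := recIF1 (S := 𝕋) H
  conv_lhs => unfold recI
  rw [rec_eq _ hα]
  show H α (img snd (gr (recI H) α)) = _
  rw [img_snd_gr]

/-- Union of a function over a set. -/
noncomputable def iU (G : M → M) (a : M) : M := sU (img G a)
instance DFun.iUI {S : DS (ZF.E (M := M))} {n : ℕ} {a : (Fin n → M) → M}
    {G : (Fin n → M) → M → M} [ha : DFun S a]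
    [h : DFun S (fun w : Fin (n + 1) → M => G (fun i => w i.castSucc) (w (Fin.last n)))] :
    DFun S (fun v => iU (fun y => G v y) (a v)) := by
  unfold iU
  infer_instance
theorem mem_iU {G : M → M} [hG : G1 𝕋 G] {a z : M} : z ∊ iU G a ↔ ∃ x, x ∊ a ∧ z ∊ G x := by
  unfold iU
  rw [mem_sU]
  constructor
  · rintro ⟨y, hy, hz⟩
    obtain ⟨x, hx, rfl⟩ := mem_img.1 hy
    exact ⟨x, hx, hz⟩
  · rintro ⟨x, hx, hz⟩
    exact ⟨G x, mem_img.2 ⟨x, hx, rfl⟩, hz⟩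

theorem od_iU {G : M → M} [hG : G1 𝕋 G] {a : M} (h : ∀ x, x ∊ a → Od (G x)) : Od (iU G a) :=
  od_sU fun y hy => by
    obtain ⟨x, hx, rfl⟩ := mem_img.1 hy
    exact h x hx

theorem iU_img {G G' : M → M} [hG : G1 𝕋 G] [hG : G1 𝕋 G'] {a : M} :
    iU G (img G' a) = iU (fun x => G (G' x)) a := by
  have : F1 𝕋 G := ⟨by assumption⟩
  have : F1 𝕋 G' := ⟨by assumption⟩
  apply ext
  intro z
  rw [mem_iU, mem_iU]
  constructor
  · rintro ⟨y, hy, hz⟩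
    obtain ⟨x, hx, rfl⟩ := mem_img.1 hy
    exact ⟨x, hx, hz⟩
  · rintro ⟨x, hx, hz⟩
    exact ⟨_, mem_img.2 ⟨x, hx, rfl⟩, hz⟩

end Paper

namespace Paper

/-! ## Part 4: the cumulative hierarchy, closure points, reflection -/

section
variable {M : Type} [ZF M]

/-- The cumulative hierarchy. -/
noncomputable def Vh : M → M := recI (fun _ s => iU pw s)
instance {S : DS (ZF.E (M := M))} : F1 S (Vh (M := M)) := by unfold Vh; infer_instance

theorem mem_V {α x : M} (hα : Od α) : x ∊ Vh α ↔ ∃ β, β ∊ α ∧ Sb x (Vh β) := by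
  have h : Vh α = iU pw (img Vh α) := recI_eq (fun _ s : M => iU pw s) hα
  rw [h, iU_img, mem_iU]
  simp only [mem_pw]

theorem V_mono {α β : M} (hα : Od α) (hβ : Od β) (h : Sb α β) : Sb (Vh α) (Vh β) := by
  intro x hx
  rw [mem_V hα] at hx
  obtain ⟨γ, hγ, hx⟩ := hx
  exact (mem_V hβ).2 ⟨γ, h _ hγ, hx⟩

theorem V_mem {α β : M} (hα : Od α) (h : β ∊ α) : Sb (Vh β) (Vh α) :=
  V_mono (hα.mem h) hα (hα.sub h)

theorem V_down {α x y : M} (hα : Od α) (h : x ∊ Vh α) (hy : Sb y x) : y ∊ Vh α := by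
  rw [mem_V hα] at h ⊢
  obtain ⟨β, hβ, h⟩ := h
  exact ⟨β, hβ, hy.trans' h⟩

theorem V_trans {α : M} (hα : Od α) : Tr (Vh α) := by
  intro y hy z hz
  obtain ⟨β, hβ, h⟩ := (mem_V hα).1 hy
  exact V_mem hα hβ z (h z hz)

theorem V_sc {α x : M} (hα : Od α) : x ∊ Vh (sc α) ↔ Sb x (Vh α) := by
  rw [mem_V (od_sc hα)]
  constructor
  · rintro ⟨β, hβ, h⟩
    rw [mem_sc] at hβ
    rcases hβ with hβ | rfl
    · exact h.trans' (V_mem hα hβ)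
    · exact h
  · exact fun h => ⟨α, mem_sc_self α, h⟩

/-- Transitive sets including a given set. -/
theorem exists_tr (x : M) : ∃ t, Tr t ∧ Sb x t := by
  let U : M → M := recI (fun _ s => bU x (iU sU s))
  have hU : ∀ α z, Od α → (z ∊ U α ↔ z ∊ x ∨ ∃ β, β ∊ α ∧ z ∊ sU (U β)) := by
    intro α z hα
    have h : U α = bU x (iU sU (img U α)) := recI_eq (fun _ s : M => bU x (iU sU s)) hα
    rw [h, iU_img, mem_bU, mem_iU]
  have hom := lim_om (M := M)
  have h1 : ∀ y, y ∊ U om → ∃ β, β ∊ om ∧ y ∊ U β := by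
    intro y hy
    rw [hU _ _ hom.1] at hy
    rcases hy with hy | ⟨β, hβ, hy⟩
    · exact ⟨emp, hom.emp_mem, (hU _ _ od_emp).2 (Or.inl hy)⟩
    · refine ⟨sc β, hom.2.2 β hβ, (hU _ _ (od_sc (hom.1.mem hβ))).2 (Or.inr ⟨β, by simp, hy⟩)⟩
  refine ⟨U om, ?_, ?_⟩
  · intro y hy z hz
    obtain ⟨β, hβ, hy⟩ := h1 y hy
    exact (hU _ _ hom.1).2 (Or.inr ⟨β, hβ, mem_sU.2 ⟨y, hy, hz⟩⟩)
  · intro z hz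
    exact (hU _ _ hom.1).2 (Or.inl hz)

/-- The rank operation: least `α` with `x ⊆ V_α`. -/
noncomputable def rk (x : M) : M := lst (fun α => Sb x (Vh α))
instance {S : DS (ZF.E (M := M))} : F1 S (rk (M := M)) := ⟨by unfold rk; infer_instance⟩
theorem od_rk (x : M) : Od (rk x) := by unfold rk; exact od_lst _

theorem exists_sub_V_of_elems {y : M} (h : ∀ z, z ∊ y → ∃ α, Od α ∧ z ∊ Vh α) :
    ∃ α, Od α ∧ Sb y (Vh α) := by
  let r : M → M := fun z => lst (fun α => z ∊ Vh α)
  have : F1 𝕋 r := ⟨by unfold r; infer_instance⟩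
  have ho : Od (iU r y) := od_iU fun x hx => (lst_spec (h x hx)).1
  refine ⟨iU r y, ho, fun z hz => ?_⟩
  have h2 := lst_spec (h z hz)
  exact V_mono h2.1 ho (fun w hw => mem_iU.2 ⟨z, hz, hw⟩) _ h2.2.1

theorem exists_V (x : M) : ∃ α, Od α ∧ x ∊ Vh α := by
  suffices h : ∃ α, Od α ∧ Sb x (Vh α) by
    obtain ⟨α, hα, h⟩ := h
    exact ⟨sc α, od_sc hα, (V_sc hα).2 h⟩
  apply exists_sub_V_of_elems
  obtain ⟨t, ht, hxt⟩ := exists_tr x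
  by_contra hc
  push Not at hc
  obtain ⟨z, hz, hz2⟩ := hc
  obtain ⟨m, hm, hm2, hm3⟩ := found (fun z : M => ¬ ∃ α : M, Od α ∧ z ∊ Vh α) t
    ⟨z, hxt z hz, by push Not; exact hz2⟩
  apply hm2
  obtain ⟨α, hα, h⟩ := exists_sub_V_of_elems (y := m) (fun w hw => by
    by_contra hc
    exact hm3 w hw ⟨ht m hm w hw, hc⟩)
  exact ⟨sc α, od_sc hα, (V_sc hα).2 h⟩

theorem sub_V_rk (x : M) : Sb x (Vh (rk x)) := by
  obtain ⟨α, hα, h⟩ := exists_V x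
  exact (lst_spec (P := fun α => Sb x (Vh α)) ⟨α, hα, V_trans hα x h⟩).2.1

theorem rk_le {x α : M} (hα : Od α) (h : Sb x (Vh α)) : Sb (rk x) α :=
  lst_le (P := fun α => Sb x (Vh α)) hα h

theorem mem_V_iff {x α : M} (hα : Od α) : x ∊ Vh α ↔ rk x ∊ α := by
  constructor
  · intro h
    obtain ⟨β, hβ, h⟩ := (mem_V hα).1 h
    exact mem_of_sub_mem (od_rk x) hα (rk_le (hα.mem hβ) h) hβ
  · intro h
    exact (mem_V hα).2 ⟨_, h, sub_V_rk x⟩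

theorem rk_mem {x y : M} (h : y ∊ x) : rk y ∊ rk x :=
  (mem_V_iff (od_rk x)).1 (sub_V_rk x y h)

/-- Class foundation. -/
theorem cfound (P : M → Prop) [hP : Q1 𝕋 P] (h : ∃ x, P x) : ∃ x, P x ∧ ∀ z, z ∊ x → ¬ P z := by
  obtain ⟨x, hx⟩ := h
  have : D1 𝕋 P := ⟨hP⟩
  obtain ⟨β, h1, ⟨y, hy, hr⟩, h3⟩ := least (fun α => ∃ x, P x ∧ α = rk x) (od_rk x) ⟨x, hx, rfl⟩
  refine ⟨y, hy, fun z hz hp => h3 (rk z) ?_ ⟨z, hp, rfl⟩⟩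
  rw [hr]; exact rk_mem hz

theorem ord_sub_V : ∀ α : M, Od α → Sb α (Vh α) := by
  refine ord_ind _ ?_
  intro α hα ih β hβ
  exact (mem_V hα).2 ⟨β, hβ, ih β hβ⟩

theorem not_mem_V_self : ∀ α : M, Od α → ¬ α ∊ Vh α := by
  refine ord_ind _ ?_
  intro α hα ih h
  obtain ⟨β, hβ, h⟩ := (mem_V hα).1 h
  exact ih β hβ (h β hβ)

theorem ord_mem_V {α β : M} (hα : Od α) (hβ : Od β) : β ∊ Vh α ↔ β ∊ α := by
  constructor
  · intro h
    rcases trich hβ hα with h1 | rfl | h1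
    · exact h1
    · exact absurd h (not_mem_V_self _ hα)
    · exact absurd (V_trans hα β h α h1) (not_mem_V_self _ hα)
  · exact fun h => ord_sub_V α hα β h

theorem rk_ord {α : M} (hα : Od α) : rk α = α := by
  apply Sb.antisymm'
  · exact rk_le hα (ord_sub_V α hα)
  · rw [← not_mem_iff (od_rk α) hα, ← mem_V_iff hα]
    exact not_mem_V_self α hα

theorem V_up {α x y : M} (hα : Lim α) (hx : x ∊ Vh α) (hy : y ∊ Vh α) : up x y ∊ Vh α := by
  have hx := (mem_V_iff hα.1).1 hx
  have hy := (mem_V_iff hα.1).1 hy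
  have h := bU_mem hα.1 hx hy
  refine (mem_V hα.1).2 ⟨sc (bU (rk x) (rk y)), hα.2.2 _ h, ?_⟩
  have ho := od_sc (hα.1.mem h)
  intro z hz
  rw [mem_up] at hz
  rw [mem_V_iff ho, mem_sc_iff (hα.1.mem h) (od_rk z)]
  rcases hz with rfl | rfl <;> intro w hw <;> simp [hw]

theorem V_pr {α x y : M} (hα : Lim α) (hx : x ∊ Vh α) (hy : y ∊ Vh α) : pr x y ∊ Vh α :=
  V_up hα (V_up hα hx hx) (V_up hα hx hy)

theorem V_pw {α x : M} (hα : Lim α) (hx : x ∊ Vh α) : pw x ∊ Vh α := by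
  obtain ⟨β, hβ, h⟩ := (mem_V hα.1).1 hx
  refine (mem_V hα.1).2 ⟨sc β, hα.2.2 β hβ, fun z hz => ?_⟩
  rw [V_sc (hα.1.mem hβ)]
  exact Sb.trans' (mem_pw.1 hz) h

theorem V_sU {α x : M} (hα : Od α) (hx : x ∊ Vh α) : sU x ∊ Vh α := by
  obtain ⟨β, hβ, h⟩ := (mem_V hα).1 hx
  refine (mem_V hα).2 ⟨β, hβ, fun z hz => ?_⟩
  obtain ⟨y, hy, hz⟩ := mem_sU.1 hz
  exact V_trans (hα.mem hβ) y (h y hy) z hz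

/-- Closure points of class functions. -/
theorem cl_pts (g : M → M) [hG : G1 𝕋 g] (hg : ∀ α, Od α → Od (g α)) {ξ : M} (hξ : Od ξ) :
    ∃ β, Lim β ∧ ξ ∊ β ∧ ∀ η, η ∊ β → g η ∊ β := by
  have : F1 𝕋 g := ⟨hG⟩
  let step : M → M := fun δ => bU (sc δ) (iU (fun η => sc (g η)) δ)
  have hs : F1 𝕋 step := ⟨by unfold step; infer_instance⟩
  let h : M → M := recI (fun _ s => bU (sc ξ) (iU step s))
  have hh : ∀ α z, Od α → (z ∊ h α ↔ z ∊ sc ξ ∨ ∃ β, β ∊ α ∧ z ∊ step (h β)) := by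
    intro α z hα
    have e : h α = bU (sc ξ) (iU step (img h α)) := recI_eq (fun _ s : M => bU (sc ξ) (iU step s)) hα
    rw [e, iU_img, mem_bU, mem_iU]
  have so : ∀ δ, Od δ → Od (step δ) := fun δ hδ =>
    od_bU (od_sc hδ) (od_iU fun x hx => od_sc (hg x (hδ.mem hx)))
  have ho : ∀ α, Od α → Od (h α) := by
    refine ord_ind _ ?_
    intro α hα ih
    have e : h α = bU (sc ξ) (iU step (img h α)) := recI_eq (fun _ s : M => bU (sc ξ) (iU step s)) hα
    rw [e, iU_img]
    exact od_bU (od_sc hξ) (od_iU fun x hx => so _ (ih x hx))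
  have hom := lim_om (M := M)
  have h1 : ∀ y, y ∊ h om → ∃ β, β ∊ om ∧ y ∊ h β := by
    intro y hy
    rw [hh _ _ hom.1] at hy
    rcases hy with hy | ⟨β, hβ, hy⟩
    · exact ⟨emp, hom.emp_mem, (hh _ _ od_emp).2 (Or.inl hy)⟩
    · refine ⟨sc β, hom.2.2 β hβ, (hh _ _ (od_sc (hom.1.mem hβ))).2 (Or.inr ⟨β, by simp, hy⟩)⟩
  have hx : ξ ∊ h om := (hh _ _ hom.1).2 (Or.inl (by simp))
  refine ⟨h om, ⟨ho _ hom.1, ⟨_, hx⟩, ?_⟩, hx, ?_⟩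
  · intro γ hγ
    obtain ⟨β, hβ, hγ⟩ := h1 γ hγ
    refine (hh _ _ hom.1).2 (Or.inr ⟨β, hβ, mem_bU.2 (Or.inl ?_)⟩)
    have hb := ho _ (hom.1.mem hβ)
    rw [mem_sc_iff hb (od_sc (hb.mem hγ))]
    exact sc_sub hb hγ
  · intro γ hγ
    obtain ⟨β, hβ, hγ⟩ := h1 γ hγ
    refine (hh _ _ hom.1).2 (Or.inr ⟨β, hβ, mem_bU.2 (Or.inr ?_)⟩)
    exact mem_iU.2 ⟨γ, hγ, by simp⟩

theorem coll (P : M → M → Prop) [hP : Q2 𝕋 P] (a : M) :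
    ∃ α, Od α ∧ ∀ x, x ∊ a → (∃ y, P x y) → ∃ y, y ∊ Vh α ∧ P x y := by
  have : D2 𝕋 P := ⟨hP⟩
  let r : M → M := fun x => lst (fun ρ => ∃ y, y ∊ Vh ρ ∧ P x y)
  have hr : F1 𝕋 r := ⟨by unfold r; infer_instance⟩
  have ho : ∀ x, Od (r x) := fun x => od_lst (fun ρ => ∃ y, y ∊ Vh ρ ∧ P x y)
  have ho' : Od (iU r a) := od_iU fun x _ => ho x
  refine ⟨_, ho', fun x hx ⟨y, hy⟩ => ?_⟩
  obtain ⟨ρ, hρ, hyρ⟩ := exists_V y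
  obtain ⟨_, ⟨z, hz, hz2⟩, _⟩ := lst_spec (P := fun ρ => ∃ y, y ∊ Vh ρ ∧ P x y) ⟨ρ, hρ, y, hyρ, hy⟩
  exact ⟨z, V_mono (ho x) ho' (fun w hw => mem_iU.2 ⟨x, hx, hw⟩) z hz, hz2⟩

/-! ### Tuples -/

/-- Tuple codes. -/
noncomputable def tup : ∀ {n : ℕ}, (Fin n → M) → M
  | 0, _ => emp
  | (n + 1), v => pr (tup (fun i : Fin n => v i.castSucc)) (v (Fin.last n))

theorem tup_snoc {n : ℕ} (v : Fin n → M) (a : M) :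
    tup (Fin.snoc v a : Fin (n + 1) → M) = pr (tup v) a := by
  simp [tup]

theorem tupDFun {S : DS (ZF.E (M := M))} (n : ℕ) : DFun S (fun v : Fin n → M => tup v) := by
  induction n with
  | zero => simp only [tup]; infer_instance
  | succ n ih =>
    simp only [tup]
    have := ih.weaken
    infer_instance

theorem tup_inj {n : ℕ} {v w : Fin n → M} (h : tup v = tup w) : v = w := by
  induction n with
  | zero => funext i; exact i.elim0
  | succ n ih =>
    simp only [tup, pr_inj] at h
    have h1 := ih h.1
    funext i
    refine Fin.lastCases h.2 (fun j => congrFun h1 j) i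

theorem tup_mem_V {α : M} (hα : Lim α) {n : ℕ} (v : Fin n → M) (h : ∀ i, v i ∊ Vh α) :
    tup v ∊ Vh α := by
  induction n with
  | zero => exact ord_sub_V _ hα.1 _ hα.emp_mem
  | succ n ih => exact V_pr hα (ih _ fun i => h _) (h _)

theorem finV {α : M} (hα : Lim α) {n : ℕ} (v : Fin n → M) (h : ∀ i, v i ∊ Vh α) :
    ∃ η, η ∊ α ∧ ∀ i, v i ∊ Vh η := by
  obtain ⟨β, hβ, h2⟩ := (mem_V hα.1).1 (tup_mem_V hα v h)
  refine ⟨sc β, hα.2.2 _ hβ, ?_⟩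
  clear h
  have hb := hα.1.mem hβ
  have hbs := od_sc hb
  replace h2 : tup v ∊ Vh (sc β) := (V_sc hb).2 h2
  clear hβ
  induction n with
  | zero => exact fun i => i.elim0
  | succ n ih =>
    have h3 : up (tup fun i : Fin n => v i.castSucc) (v (Fin.last n)) ∊ Vh (sc β) :=
      V_trans hbs _ h2 _ (by simp [tup, pr])
    intro i
    refine Fin.lastCases ?_ (fun j => ?_) i
    · exact V_trans hbs _ h3 _ (by simp)
    · exact ih (fun i => v i.castSucc) (V_trans hbs _ h3 _ (by simp)) j

end

theorem Dfn.finAll {M : Type} {E : M → M → Prop} {S : DS E} {m : ℕ} : ∀ {n : ℕ}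
    {P : Fin n → (Fin m → M) → Prop}, (∀ i, Dfn S (P i)) → Dfn S (fun v => ∀ i, P i v)
  | 0, P, _ => (Dfn.constI True).congr fun v => by simp
  | n + 1, P, h => by
    have h1 := Dfn.finAll (P := fun i : Fin n => P i.succ) (fun i => h _)
    have h0 := h 0
    exact (Dfn.andI (P := P 0) (Q := fun v => ∀ i : Fin n, P i.succ v)).congr fun v => by
      rw [Fin.forall_fin_succ]

/-- Relativization. -/
def Rel {M : Type} (E : M → M → Prop) (A : M → Prop) : ∀ {n : ℕ}, SetFormula n → (Fin n → M) → Prop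
  | _, .mem i j, v => E (v i) (v j)
  | _, .eq i j, v => v i = v j
  | _, .fal, _ => False
  | _, .imp φ ψ, v => Rel E A φ v → Rel E A ψ v
  | _, .all φ, v => ∀ a, A a → Rel E A φ (Fin.snoc v a)

theorem rel_sub {M : Type} (E : M → M → Prop) (A : M → Prop) {n : ℕ} (φ : SetFormula n) :
    ∀ v : Fin n → {x // A x}, Realize (fun a b : {x // A x} => E a.1 b.1) φ v ↔
      Rel E A φ (fun i => (v i).1) := by
  induction φ with
  | mem i j => intro v; rfl
  | eq i j => intro v; exact Subtype.ext_iff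
  | fal => intro v; rfl
  | imp φ ψ h1 h2 => intro v; simp only [Realize, Rel, h1, h2]
  | all φ h =>
    intro v
    simp only [Realize, Rel]
    have key : ∀ a : {x // A x}, (fun i => ((Fin.snoc v a : Fin _ → {x // A x}) i).1) =
        (Fin.snoc (fun i => (v i).1) a.1 : Fin _ → M) := by
      intro a
      funext i
      refine Fin.lastCases ?_ (fun j => ?_) i <;> simp
    constructor
    · intro h1 a ha
      have := (h _).1 (h1 ⟨a, ha⟩)
      rwa [key] at this
    · intro h1 a
      rw [h, key]
      exact h1 a.1 a.2

theorem relDfn {M : Type} {E : M → M → Prop} (S : DS E) {n k : ℕ} (A : (Fin k → M) → M → Prop)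
    (hA : Dfn S (fun w : Fin (k + 1) → M => A (fun i => w i.castSucc) (w (Fin.last k))))
    (φ : SetFormula n) :
    Dfn S (fun w : Fin (k + n) → M => Rel E (A (fun i => w (Fin.castAdd n i))) φ
      (fun i => w (Fin.natAdd k i))) := by
  induction φ with
  | mem i j => simp only [Rel]; infer_instance
  | eq i j => simp only [Rel]; infer_instance
  | fal => simp only [Rel]; infer_instance
  | imp φ ψ h1 h2 => simp only [Rel]; infer_instance
  | @all n φ h =>
    simp only [Rel]
    have h1 : Dfn S (fun w : Fin (k + n + 1) → M => A (fun i => w (Fin.castAdd n i).castSucc)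
        (w (Fin.last _))) := by
      refine (hA.reindex (m := k + n + 1) (Fin.snoc (α := fun _ => Fin (k + n + 1))
        (fun i => (Fin.castAdd n i).castSucc) (Fin.last _))).congr fun v => ?_
      simp
    refine Dfn.allI (Q := fun w a => A (fun i => w (Fin.castAdd n i)) a →
      Rel E (A (fun i => w (Fin.castAdd n i))) φ (Fin.snoc (fun i => w (Fin.natAdd k i)) a))
      (h := ?_)
    refine Dfn.impI (hP := h1) (hQ := ?_)
    refine h.congr fun v => ?_
    have : (Fin.snoc (fun i => v (Fin.natAdd k i).castSucc) (v (Fin.last (k + n))) : Fin (n + 1) → M) =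
        fun i => v (Fin.natAdd k i) := by
      funext i
      refine Fin.lastCases ?_ (fun j => ?_) i
      · simp
      · simp
    rw [this]
    rfl

/-- Reflection. -/
theorem reflect {M : Type} [ZF M] {n : ℕ} (ψ : SetFormula n) :
    ∃ g : M → M, F1 𝕋 g ∧ (∀ α, Od α → Od (g α)) ∧ ∀ β, Lim β → (∀ η, η ∊ β → g η ∊ β) →
      ∀ v : Fin n → M, (∀ i, v i ∊ Vh β) →
        (Realize ZF.E ψ v ↔ Rel ZF.E (fun x => x ∊ Vh β) ψ v) := by
  induction ψ with
  | mem i j => exact ⟨fun x => x, ⟨inferInstance⟩, fun _ h => h, fun _ _ _ v _ => Iff.rfl⟩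
  | eq i j => exact ⟨fun x => x, ⟨inferInstance⟩, fun _ h => h, fun _ _ _ v _ => Iff.rfl⟩
  | fal => exact ⟨fun x => x, ⟨inferInstance⟩, fun _ h => h, fun _ _ _ v _ => Iff.rfl⟩
  | imp φ ψ h1 h2 =>
    obtain ⟨g1, d1, o1, h1⟩ := h1
    obtain ⟨g2, d2, o2, h2⟩ := h2
    refine ⟨fun x => bU (g1 x) (g2 x), ⟨inferInstance⟩, fun α h => od_bU (o1 α h) (o2 α h), ?_⟩
    intro β hβ hc v hv
    have c1 : ∀ η, η ∊ β → g1 η ∊ β := fun η h => mem_of_sub_mem (o1 _ (hβ.1.mem h)) hβ.1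
      (fun z hz => mem_bU.2 (Or.inl hz)) (hc η h)
    have c2 : ∀ η, η ∊ β → g2 η ∊ β := fun η h => mem_of_sub_mem (o2 _ (hβ.1.mem h)) hβ.1
      (fun z hz => mem_bU.2 (Or.inr hz)) (hc η h)
    simp only [Realize, Rel, h1 β hβ c1 v hv, h2 β hβ c2 v hv]
  | @all n φ h =>
    obtain ⟨g1, d1, o1, h1⟩ := h
    let Q : M → M → Prop := fun η ρ => ∀ v : Fin n → M, (∀ i, v i ∊ Vh η) →
      (∃ a, ¬ Realize ZF.E φ (Fin.snoc v a)) → ∃ a, a ∊ Vh ρ ∧ ¬ Realize ZF.E φ (Fin.snoc v a)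
    have hφ : Dfn 𝕋 (fun v : Fin (n + 1) → M => Realize ZF.E φ v) := ⟨DS.realize 𝕋 φ⟩
    have hsn : ∀ k, Dfn 𝕋 (fun w : Fin (k + n + 1) → M =>
        Realize ZF.E φ (Fin.snoc (fun i => w (Fin.natAdd k i).castSucc) (w (Fin.last _)))) := by
      intro k
      refine (hφ.reindex (m := k + n + 1) (fun i => Fin.natAdd k i)).congr fun v => ?_
      have : (Fin.snoc (fun i => v (Fin.natAdd k i).castSucc) (v (Fin.last (k + n))) :
          Fin (n + 1) → M) = fun i => v (Fin.natAdd k i) := by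
        funext i
        refine Fin.lastCases ?_ (fun j => ?_) i
        · simp
        · simp
      rw [this]
    have hQ : D2 𝕋 Q := by
      constructor
      have hs := hsn 2
      have h3 : Dfn 𝕋 (fun w : Fin (2 + n) → M => ∀ i : Fin n, w (Fin.natAdd 2 i) ∊ Vh (w (Fin.castAdd n 0))) :=
        Dfn.finAll fun i => inferInstance
      have h4 : Dfn 𝕋 (fun w : Fin (2 + n) → M =>
          (∀ i : Fin n, w (Fin.natAdd 2 i) ∊ Vh (w (Fin.castAdd n 0))) →
          (∃ a, ¬ Realize ZF.E φ (Fin.snoc (fun i => w (Fin.natAdd 2 i)) a)) →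
          ∃ a, a ∊ Vh (w (Fin.castAdd n 1)) ∧ ¬ Realize ZF.E φ (Fin.snoc (fun i => w (Fin.natAdd 2 i)) a)) := by
        infer_instance
      refine (Dfn.allN n h4).congr fun v => ?_
      simp only [Fin.append_left, Fin.append_right]
      rfl
    have hex : ∀ η, Od η → ∃ ρ, Od ρ ∧ Q η ρ := by
      intro η hη
      obtain ⟨l, hl, hηl, _⟩ := cl_pts (fun x : M => x) (fun _ h => h) hη
      have hR : D2 𝕋 (fun t x : M => ∃ v : Fin n → M, t = tup v ∧ ¬ Realize ZF.E φ (Fin.snoc v x)) := by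
        constructor
        have := (tupDFun (S := 𝕋) (M := M) n).reindex (m := 2 + n) (Fin.natAdd 2)
        have h4 : Dfn 𝕋 (fun w : Fin (2 + n) → M => Realize ZF.E φ
            (Fin.snoc (fun i => w (Fin.natAdd 2 i)) (w (Fin.castAdd n 1)))) := by
          refine (hφ.reindex (m := 2 + n) (Fin.snoc (α := fun _ => Fin (2 + n))
            (fun i => Fin.natAdd 2 i) (Fin.castAdd n 1))).congr fun v => ?_
          have : (Fin.snoc (fun i => v (Fin.natAdd 2 i)) (v (Fin.castAdd n 1)) : Fin (n + 1) → M) =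
            (fun i => v ((Fin.snoc (α := fun _ => Fin (2 + n))
            (fun i => Fin.natAdd 2 i) (Fin.castAdd n 1) : Fin (n + 1) → Fin (2 + n)) i)) := by
            funext i
            refine Fin.lastCases ?_ (fun j => ?_) i <;> simp
          rw [this]
        have h5 : Dfn 𝕋 (fun w : Fin (2 + n) → M => w (Fin.castAdd n 0) = tup (fun i => w (Fin.natAdd 2 i))
            ∧ ¬ Realize ZF.E φ (Fin.snoc (fun i => w (Fin.natAdd 2 i)) (w (Fin.castAdd n 1)))) := by
          infer_instance
        refine (Dfn.exN n h5).congr fun v => ?_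
        simp only [Fin.append_left, Fin.append_right]
      obtain ⟨ρ, hρ, h2⟩ := coll (fun t x : M => ∃ v : Fin n → M, t = tup v ∧
        ¬ Realize ZF.E φ (Fin.snoc v x)) (hP := hR.out) (Vh l)
      refine ⟨ρ, hρ, fun v hv ⟨a, ha⟩ => ?_⟩
      obtain ⟨y, hy, w, hw, hy2⟩ := h2 (tup v) (tup_mem_V hl v fun i => V_mem hl.1 hηl _ (hv i))
        ⟨a, v, rfl, ha⟩
      have := tup_inj hw
      subst this
      exact ⟨y, hy, hy2⟩
    refine ⟨fun η => bU (g1 η) (lst (fun ρ => Q η ρ)), ⟨inferInstance⟩, fun α hα => od_bU (o1 _ hα) (od_lst _), ?_⟩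
    intro β hβ hc v hv
    have c1 : ∀ η, η ∊ β → g1 η ∊ β := fun η h => mem_of_sub_mem (o1 _ (hβ.1.mem h)) hβ.1
      (fun z hz => mem_bU.2 (Or.inl hz)) (hc η h)
    have c2 : ∀ η, η ∊ β → lst (fun ρ => Q η ρ) ∊ β := fun η h => mem_of_sub_mem (od_lst _) hβ.1
      (fun z hz => mem_bU.2 (Or.inr hz)) (hc η h)
    have hsv : ∀ a, a ∊ Vh β → ∀ i, (Fin.snoc v a : Fin (n + 1) → M) i ∊ Vh β := by
      intro a ha i
      refine Fin.lastCases ?_ (fun j => ?_) i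
      · simpa using ha
      · simpa using hv j
    simp only [Realize, Rel]
    constructor
    · intro h a ha
      exact (h1 β hβ c1 _ (hsv a ha)).1 (h a)
    · intro h a
      by_contra hn
      obtain ⟨η, hη, hvη⟩ := finV hβ v hv
      obtain ⟨_, hq, _⟩ := lst_spec (P := fun ρ => Q η ρ) (hex η (hβ.1.mem hη))
      obtain ⟨a', ha', hn'⟩ := hq v hvη ⟨a, hn⟩
      have ha2 := V_mem hβ.1 (c2 η hη) a' ha'
      exact hn' ((h1 β hβ c1 _ (hsv a' ha2)).2 (h a' ha2))

end Paper

namespace Paper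

/-! ## Part 5: enumerations of classes by ordinals -/

section
variable {M : Type} [ZF M]

/-- Lexicographic comparison of keys. -/
def Lx (k1 k2 k3 : M → M) (x y : M) : Prop :=
  k1 x ∊ k1 y ∨ (k1 x = k1 y ∧ (k2 x ∊ k2 y ∨ (k2 x = k2 y ∧ k3 x ∊ k3 y)))

/-- The enumeration of the class `C` along the keys. -/
noncomputable def enum (C : M → Prop) (k1 k2 k3 : M → M) : M → M :=
  recI (fun _ s => the (fun x => (C x ∧ ¬ x ∊ s) ∧ ∀ y, C y → ¬ y ∊ s → ¬ Lx k1 k2 k3 y x))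

theorem lxD {S : DS (ZF.E (M := M))} (k1 k2 k3 : M → M)
    [G1 S k1] [G1 S k2] [G1 S k3] : D2 S (Lx k1 k2 k3) := by
  have : F1 S k1 := ⟨by assumption⟩
  have : F1 S k2 := ⟨by assumption⟩
  have : F1 S k3 := ⟨by assumption⟩
  exact ⟨by unfold Lx; infer_instance⟩

theorem enumF1 {S : DS (ZF.E (M := M))} (C : M → Prop) (k1 k2 k3 : M → M) [hC : Q1 S C]
    [G1 S k1] [G1 S k2] [G1 S k3] : F1 S (enum C k1 k2 k3) := by
  have : D1 S C := ⟨hC⟩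
  have := lxD (S := S) k1 k2 k3
  unfold enum
  infer_instance

/-- The standing hypotheses for an enumeration. -/
structure EnumH (C : M → Prop) (k1 k2 k3 : M → M) : Prop where
  dC : D1 𝕋 C
  d1 : F1 𝕋 k1
  d2 : F1 𝕋 k2
  d3 : F1 𝕋 k3
  o1 : ∀ x, C x → Od (k1 x)
  o2 : ∀ x, C x → Od (k2 x)
  o3 : ∀ x, C x → Od (k3 x)
  inj : ∀ x y, C x → C y → k1 x = k1 y → k2 x = k2 y → k3 x = k3 y → x = y
  bdd : ∀ μ, Od μ → ∃ a, ∀ x, C x → Sb (k1 x) μ → x ∊ a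
  prop : ∀ s, ∃ x, C x ∧ ¬ x ∊ s

variable {C : M → Prop} {k1 k2 k3 : M → M}

theorem leastKey (k : M → M) [hk : G1 𝕋 k] (P : M → Prop) [hP : Q1 𝕋 P] (ho : ∀ x, P x → Od (k x))
    (h : ∃ x, P x) : ∃ x, P x ∧ ∀ y, P y → ¬ k y ∊ k x := by
  have : F1 𝕋 k := ⟨hk⟩
  have : D1 𝕋 P := ⟨hP⟩
  obtain ⟨x, hx⟩ := h
  obtain ⟨β, h1, ⟨y, hy, hr⟩, h3⟩ := least (fun α => ∃ x, P x ∧ α = k x) (ho x hx) ⟨x, hx, rfl⟩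
  refine ⟨y, hy, fun z hz hp => h3 (k z) (hr ▸ hp) ⟨z, hz, rfl⟩⟩

theorem EnumH.leastC (H : EnumH C k1 k2 k3) (s : M) :
    ∃ x, (C x ∧ ¬ x ∊ s) ∧ ∀ y, C y → ¬ y ∊ s → ¬ Lx k1 k2 k3 y x := by
  have := H.dC; have := H.d1; have := H.d2; have := H.d3
  obtain ⟨x1, hx1, h1⟩ := leastKey k1 (fun x => C x ∧ ¬ x ∊ s) (fun x h => H.o1 x h.1) (H.prop s)
  obtain ⟨x2, hx2, h2⟩ := leastKey k2 (fun x => (C x ∧ ¬ x ∊ s) ∧ k1 x = k1 x1)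
    (fun x h => H.o2 x h.1.1) ⟨x1, hx1, rfl⟩
  obtain ⟨x3, hx3, h3⟩ := leastKey k3 (fun x => ((C x ∧ ¬ x ∊ s) ∧ k1 x = k1 x1) ∧ k2 x = k2 x2)
    (fun x h => H.o3 x h.1.1.1) ⟨x2, hx2, rfl⟩
  refine ⟨x3, hx3.1.1, fun y hy hys => ?_⟩
  rintro (h | ⟨h, h' | ⟨h', h''⟩⟩)
  · rw [hx3.1.2] at h; exact h1 y ⟨hy, hys⟩ h
  · rw [hx3.2] at h'
    exact h2 y ⟨⟨hy, hys⟩, h.trans hx3.1.2⟩ h'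
  · exact h3 y ⟨⟨⟨hy, hys⟩, h.trans hx3.1.2⟩, h'.trans hx3.2⟩ h''

theorem EnumH.tot (H : EnumH C k1 k2 k3) {x y : M} (hx : C x) (hy : C y) (h : ¬ Lx k1 k2 k3 y x)
    (hne : x ≠ y) : Lx k1 k2 k3 x y := by
  have t1 := trich (H.o1 x hx) (H.o1 y hy)
  have t2 := trich (H.o2 x hx) (H.o2 y hy)
  have t3 := trich (H.o3 x hx) (H.o3 y hy)
  have := H.inj x y hx hy
  unfold Lx at *
  grind

theorem EnumH.spec (H : EnumH C k1 k2 k3) {α : M} (hα : Od α) :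
    (C (enum C k1 k2 k3 α) ∧ ∀ β, β ∊ α → enum C k1 k2 k3 α ≠ enum C k1 k2 k3 β) ∧
    ∀ y, C y → (∀ β, β ∊ α → y ≠ enum C k1 k2 k3 β) → ¬ Lx k1 k2 k3 y (enum C k1 k2 k3 α) := by
  have := H.dC; have := H.d1; have := H.d2; have := H.d3
  have := lxD (S := 𝕋) k1 k2 k3
  have he := enumF1 (S := 𝕋) C k1 k2 k3
  have eq : enum C k1 k2 k3 α = the (fun x => (C x ∧ ¬ x ∊ img (enum C k1 k2 k3) α) ∧
      ∀ y, C y → ¬ y ∊ img (enum C k1 k2 k3) α → ¬ Lx k1 k2 k3 y x) :=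
    recI_eq (fun _ s : M => the (fun x => (C x ∧ ¬ x ∊ s) ∧ ∀ y, C y → ¬ y ∊ s → ¬ Lx k1 k2 k3 y x)) hα
  have mi : ∀ y, ¬ y ∊ img (enum C k1 k2 k3) α ↔ ∀ β, β ∊ α → y ≠ enum C k1 k2 k3 β := by
    intro y; rw [mem_img]; push Not; rfl
  have ex : ∃! x, (C x ∧ ¬ x ∊ img (enum C k1 k2 k3) α) ∧
      ∀ y, C y → ¬ y ∊ img (enum C k1 k2 k3) α → ¬ Lx k1 k2 k3 y x := by
    obtain ⟨x, hx, hm⟩ := H.leastC (img (enum C k1 k2 k3) α)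
    refine ⟨x, ⟨hx, hm⟩, ?_⟩
    rintro y ⟨hy, hym⟩
    by_contra hne
    exact hym x hx.1 hx.2 (H.tot hx.1 hy.1 (hm y hy.1 hy.2) (Ne.symm hne))
  have := the_spec ex
  rw [← eq] at this
  simp only [mi] at this
  exact this

theorem EnumH.cls' (H : EnumH C k1 k2 k3) {α : M} (hα : Od α) : C (enum C k1 k2 k3 α) :=
  (H.spec hα).1.1

theorem EnumH.mono (H : EnumH C k1 k2 k3) {α β : M} (hβ : Od β) (h : α ∊ β) :
    Lx k1 k2 k3 (enum C k1 k2 k3 α) (enum C k1 k2 k3 β) := by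
  have hα := hβ.mem h
  have h1 := (H.spec hβ).1.2 α h
  refine H.tot (H.cls' hα) (H.cls' hβ) ?_ h1.symm
  refine (H.spec hα).2 _ (H.cls' hβ) fun γ hγ => (H.spec hβ).1.2 γ (hβ.trans hγ h)

theorem EnumH.einj (H : EnumH C k1 k2 k3) {α β : M} (hα : Od α) (hβ : Od β)
    (h : enum C k1 k2 k3 α = enum C k1 k2 k3 β) : α = β := by
  rcases trich hα hβ with h1 | h1 | h1
  · exact absurd h.symm ((H.spec hβ).1.2 α h1)
  · exact h1
  · exact absurd h ((H.spec hα).1.2 β h1)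

theorem EnumH.surj (H : EnumH C k1 k2 k3) {x : M} (hx : C x) :
    ∃ α, Od α ∧ x = enum C k1 k2 k3 α := by
  have := H.dC; have := H.d1; have := H.d2; have := H.d3
  have he := enumF1 (S := 𝕋) C k1 k2 k3
  by_contra hc
  push Not at hc
  obtain ⟨a, ha⟩ := H.bdd (k1 x) (H.o1 x hx)
  have h1 : ∀ α, Od α → enum C k1 k2 k3 α ∊ a := by
    intro α hα
    have h2 := (H.spec hα).2 x hx fun β hβ => hc β (hα.mem hβ)
    apply ha _ (H.cls' hα)
    rw [← not_mem_iff (H.o1 x hx) (H.o1 _ (H.cls' hα))]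
    exact fun h => h2 (Or.inl h)
  obtain ⟨α, hα, h2⟩ := no_all_ord (img (fun y => lst (fun α => y = enum C k1 k2 k3 α)) a)
  apply h2
  rw [mem_img]
  refine ⟨_, h1 α hα, ?_⟩
  have := lst_spec (P := fun β => enum C k1 k2 k3 α = enum C k1 k2 k3 β) ⟨α, hα, rfl⟩
  exact H.einj hα this.1 this.2.1

/-- The inverse of the enumeration. -/
noncomputable def enumI (C : M → Prop) (k1 k2 k3 : M → M) (x : M) : M :=
  lst (fun α => x = enum C k1 k2 k3 α)

theorem enumIF1 {S : DS (ZF.E (M := M))} (C : M → Prop) (k1 k2 k3 : M → M) [hC : Q1 S C]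
    [G1 S k1] [G1 S k2] [G1 S k3] : F1 S (enumI C k1 k2 k3) := by
  have := enumF1 (S := S) C k1 k2 k3
  exact ⟨by unfold enumI; infer_instance⟩

theorem EnumH.od_I (H : EnumH C k1 k2 k3) (x : M) : Od (enumI C k1 k2 k3 x) := by
  have := H.dC; have := H.d1; have := H.d2; have := H.d3
  have he := enumF1 (S := 𝕋) C k1 k2 k3
  unfold enumI
  exact od_lst _

theorem EnumH.enum_I (H : EnumH C k1 k2 k3) {x : M} (hx : C x) :
    enum C k1 k2 k3 (enumI C k1 k2 k3 x) = x := by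
  have := H.dC; have := H.d1; have := H.d2; have := H.d3
  have he := enumF1 (S := 𝕋) C k1 k2 k3
  exact (lst_spec (P := fun β => x = enum C k1 k2 k3 β) (H.surj hx)).2.1.symm

theorem EnumH.I_enum (H : EnumH C k1 k2 k3) {α : M} (hα : Od α) :
    enumI C k1 k2 k3 (enum C k1 k2 k3 α) = α :=
  H.einj (H.od_I _) hα (H.enum_I (H.cls' hα))

/-! ### Pairs of ordinals -/

/-- Pairs of ordinals. -/
def OPr (p : M) : Prop := ∃ a b, (Od a ∧ Od b) ∧ p = pr a b
instance {S : DS (ZF.E (M := M))} : D1 S (OPr (M := M)) := ⟨by unfold OPr; infer_instance⟩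

/-- Maximum of the components. -/
noncomputable def mx (p : M) : M := bU (fst p) (snd p)
instance {S : DS (ZF.E (M := M))} : F1 S (mx (M := M)) := ⟨by unfold mx; infer_instance⟩

theorem opr_H : EnumH (OPr (M := M)) mx fst snd where
  dC := inferInstance
  d1 := inferInstance
  d2 := inferInstance
  d3 := inferInstance
  o1 := by rintro x ⟨a, b, ⟨ha, hb⟩, rfl⟩; simp only [mx, fst_pr, snd_pr]; exact od_bU ha hb
  o2 := by rintro x ⟨a, b, ⟨ha, hb⟩, rfl⟩; simpa using ha
  o3 := by rintro x ⟨a, b, ⟨ha, hb⟩, rfl⟩; simpa using hb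
  inj := by
    rintro x y ⟨a, b, ⟨ha, hb⟩, rfl⟩ ⟨a', b', ⟨ha', hb'⟩, rfl⟩ _ h1 h2
    simp at h1 h2
    rw [h1, h2]
  bdd := by
    intro μ hμ
    obtain ⟨l, hl, hηl, _⟩ := cl_pts (fun x : M => x) (fun _ h => h) hμ
    refine ⟨Vh l, ?_⟩
    rintro x ⟨a, b, ⟨ha, hb⟩, rfl⟩ h
    simp only [mx, fst_pr, snd_pr] at h
    apply V_pr hl
    · rw [ord_mem_V hl.1 ha]
      exact mem_of_sub_mem ha hl.1 (fun z hz => h z (mem_bU.2 (Or.inl hz))) hηl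
    · rw [ord_mem_V hl.1 hb]
      exact mem_of_sub_mem hb hl.1 (fun z hz => h z (mem_bU.2 (Or.inr hz))) hηl
  prop := by
    intro s
    obtain ⟨α, hα, h⟩ := no_all_ord (img fst s)
    refine ⟨pr α α, ⟨α, α, ⟨hα, hα⟩, rfl⟩, fun h2 => h ?_⟩
    exact mem_img.2 ⟨_, h2, by simp⟩

/-- The decoding of ordinals as pairs of ordinals. -/
noncomputable def unp : M → M := enum OPr mx fst snd
instance {S : DS (ZF.E (M := M))} : F1 S (unp (M := M)) := enumF1 _ _ _ _

theorem unp_surj {a b : M} (ha : Od a) (hb : Od b) : ∃ α, Od α ∧ unp α = pr a b := by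
  obtain ⟨α, h1, h2⟩ := opr_H.surj (x := pr a b) ⟨a, b, ⟨ha, hb⟩, rfl⟩
  exact ⟨α, h1, h2.symm⟩

theorem unp_mx {α : M} (hα : Od α) : Sb (mx (unp α)) α := by
  have key : ∀ μ : M, Od μ → ∀ β, Od β → Sb μ (mx (unp β)) → Sb μ β := by
    refine ord_ind (fun μ : M => ∀ β, Od β → Sb μ (mx (unp β)) → Sb μ β) ?_
    intro μ hμ ih β hβ h ν hν
    have hν' := hμ.mem hν
    obtain ⟨γ, hγ, h2⟩ := unp_surj (od_emp (M := M)) hν'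
    have hm : mx (unp γ) = ν := by
      rw [h2]; simp only [mx, fst_pr, snd_pr]; apply ext; intro z; simp
    have h3 := ih ν hν γ hγ (by rw [hm]; exact Sb.rfl')
    refine mem_of_sub_mem hν' hβ h3 ?_
    have hl : mx (unp γ) ∊ mx (unp β) := by rw [hm]; exact h ν hν
    rcases trich hγ hβ with h4 | h4 | h4
    · exact h4
    · subst h4; exact absurd hl (mem_irrefl _)
    · exfalso
      rcases opr_H.mono hγ h4 with h5 | ⟨h5, _⟩
      · exact mem_asymm hl h5
      · change mx (unp β) = mx (unp γ) at h5
        rw [h5] at hl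
        exact mem_irrefl _ hl
  exact key _ (opr_H.o1 _ (opr_H.cls' hα)) α hα Sb.rfl'

theorem unp_spec {α : M} (hα : Od α) : Od (fst (unp α)) ∧ Od (snd (unp α)) ∧
    Sb (fst (unp α)) α ∧ Sb (snd (unp α)) α := by
  have h := opr_H.cls' hα
  refine ⟨opr_H.o2 _ h, opr_H.o3 _ h, ?_, ?_⟩
  · exact fun z hz => unp_mx hα z (mem_bU.2 (Or.inl hz))
  · exact fun z hz => unp_mx hα z (mem_bU.2 (Or.inr hz))

end

end Paper

namespace Paper

/-! ## Part 6: set models -/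

section
variable {M : Type} (E : M → M → Prop)

/-- Bounded unordered pairs. -/
def IsUp (u a b : M) : Prop := E a u ∧ E b u ∧ ∀ z, E z u → z = a ∨ z = b
/-- Bounded ordered pairs. -/
def IsPr (p a b : M) : Prop := (∃ u, E u p ∧ IsUp E u a a) ∧ (∃ u, E u p ∧ IsUp E u a b) ∧
  ∀ u, E u p → IsUp E u a a ∨ IsUp E u a b
/-- Membership of a pair. -/
def PM (R x y : M) : Prop := ∃ p, E p R ∧ IsPr E p x y

/-- Finitely many closure conditions, relativized to `m`. -/
def AxB (m : M) : Prop :=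
  (∀ y, E y m → ∀ z, E z y → E z m) ∧
  (∀ a, E a m → ∀ b, E b m → ∃ p, E p m ∧ ∀ z, E z m → (E z p ↔ (z = a ∨ z = b))) ∧
  (∀ a, E a m → ∃ u, E u m ∧ ∀ z, E z m → (E z u ↔ ∃ y, E y m ∧ E y a ∧ E z y)) ∧
  (∀ a, E a m → ∃ p, E p m ∧ ∀ z, E z m → (E z p ↔ ∀ w, E w m → E w z → E w a)) ∧
  (∃ I, E I m ∧ (∃ e, E e m ∧ E e I ∧ ∀ z, E z m → ¬ E z e) ∧
    ∀ y, E y m → E y I → ∃ s, E s m ∧ E s I ∧ ∀ z, E z m → (E z s ↔ (E z y ∨ z = y))) ∧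
  (∀ a, E a m → (∀ x, E x m → E x a → ∃ z, E z m ∧ E z x) →
    (∀ x, E x m → ∀ y, E y m → E x a → E y a → x ≠ y → ¬ ∃ z, E z m ∧ E z x ∧ E z y) →
    ∃ c, E c m ∧ ∀ x, E x m → E x a → ∃ z, E z m ∧ E z c ∧ E z x ∧
      ∀ z', E z' m → E z' c → E z' x → z' = z)

/-- The family `F` of relations on `V` is closed under the basic operations. -/
def Cl (V : M) (F : M → Prop) : Prop :=
  (∃ R, F R ∧ ∀ t, E t V → ¬ E t R) ∧
  (∀ R, F R → ∀ R', F R' → ∃ S, F S ∧ ∀ t, E t V → (E t S ↔ (E t R → E t R'))) ∧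
  (∀ R, F R → ∃ S, F S ∧ ∀ t, E t V → (E t S ↔ ∀ a, E a V → PM E R t a)) ∧
  (∃ S, F S ∧ ∀ p, E p V → ∀ s, E s V → ∀ a, E a V → IsPr E p s a →
    ∀ b, E b V → (PM E S p b ↔ b = a)) ∧
  (∀ Q, F Q → ∃ S, F S ∧ ∀ p, E p V → ∀ s, E s V → ∀ a, E a V → IsPr E p s a →
    ∀ b, E b V → (PM E S p b ↔ PM E Q s b)) ∧
  (∀ Q, F Q → ∀ Q', F Q' → ∃ S, F S ∧ ∀ t, E t V →
    (E t S ↔ ∃ x, E x V ∧ ∃ y, E y V ∧ PM E Q t x ∧ PM E Q' t y ∧ E x y)) ∧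
  (∀ Q, F Q → ∀ Q', F Q' → ∃ S, F S ∧ ∀ t, E t V →
    (E t S ↔ ∃ x, E x V ∧ ∃ y, E y V ∧ PM E Q t x ∧ PM E Q' t y ∧ x = y))

/-- Separation and replacement for the family `D`. -/
def SRD (m D : M) : Prop :=
  (∀ R, E R D → ∀ t, E t m → ∀ a, E a m → ∃ s, E s m ∧ ∀ z, E z m → (E z s ↔ (E z a ∧ PM E R t z))) ∧
  (∀ R, E R D → ∀ t, E t m → ∀ a, E a m →
    (∀ x, E x m → E x a → ∀ y, E y m → ∀ y', E y' m → ∀ p, E p m → IsPr E p t x →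
      PM E R p y → PM E R p y' → y = y') →
    ∃ b, E b m ∧ ∀ y, E y m → (E y b ↔ ∃ x, E x m ∧ E x a ∧ ∃ p, E p m ∧ IsPr E p t x ∧ PM E R p y))

/-- The main predicate: `m` is a set model. -/
def PP (φ : SetFormula 0) (m : M) : Prop :=
  AxB E m ∧ Rel E (fun x => E x m) φ ![] ∧ ∃ D, Cl E m (fun x => E x D) ∧ SRD E m D

instance {S : DS E} : D3 S (IsUp E) := ⟨by unfold IsUp; infer_instance⟩
instance {S : DS E} : D3 S (IsPr E) := ⟨by unfold IsPr; infer_instance⟩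
instance {S : DS E} : D3 S (PM E) := ⟨by unfold PM; infer_instance⟩
instance {S : DS E} {n : ℕ} {f g : (Fin n → M) → M} [DFun S f] [DFun S g] :
    Dfn S (fun v => f v ≠ g v) := by unfold Ne; infer_instance
set_option synthInstance.maxHeartbeats 400000 in
set_option synthInstance.maxSize 2000 in
instance {S : DS E} : D1 S (AxB E) := ⟨by unfold AxB; infer_instance⟩
set_option synthInstance.maxHeartbeats 400000 in
set_option synthInstance.maxSize 2000 in
instance {S : DS E} : D2 S (SRD E) := ⟨by unfold SRD; infer_instance⟩
set_option synthInstance.maxHeartbeats 400000 in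
set_option synthInstance.maxSize 2000 in
instance {S : DS E} (φ : SetFormula 0) : D1 S (PP E φ) := ⟨by
  have h : Dfn S (fun v : Fin 1 → M => Rel E (fun x => E x (v 0)) φ ![]) := by
    have := relDfn S (k := 1) (fun w a => E a (w 0)) inferInstance φ
    refine Dfn.congr this fun v => ?_
    have e : (fun i : Fin 0 => v (Fin.natAdd 1 i)) = ![] := by funext i; exact i.elim0
    rw [e]; rfl
  have h2 : Dfn S (fun v : Fin 2 → M => Cl E (v 0) (fun x => E x (v 1))) := by
    unfold Cl; beta_reduce; infer_instance
  have h3 : Dfn S (fun v : Fin 2 → M => Cl E (v 0) (fun x => E x (v 1)) ∧ SRD E (v 0) (v 1)) := by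
    infer_instance
  have h4 : Dfn S (fun v : Fin 1 → M => ∃ D, Cl E (v 0) (fun x => E x D) ∧ SRD E (v 0) D) :=
    Dfn.exI (h := h3)
  unfold PP
  infer_instance⟩

/-! ### Absoluteness to transitive classes -/

variable {E} {A : M → Prop}

/-- The induced structure. -/
abbrev sE (E : M → M → Prop) (A : M → Prop) : {x // A x} → {x // A x} → Prop := fun a b => E a.1 b.1

theorem ball_abs (hA : ∀ x, A x → ∀ y, E y x → A y) (a : {x // A x}) (Q : M → Prop) :
    (∀ x, E x a.1 → Q x) ↔ ∀ x : {x // A x}, E x.1 a.1 → Q x.1 :=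
  ⟨fun h x => h x.1, fun h x hx => h ⟨x, hA _ a.2 x hx⟩ hx⟩

theorem bex_abs (hA : ∀ x, A x → ∀ y, E y x → A y) (a : {x // A x}) (Q : M → Prop) :
    (∃ x, E x a.1 ∧ Q x) ↔ ∃ x : {x // A x}, E x.1 a.1 ∧ Q x.1 :=
  ⟨fun ⟨x, h, h'⟩ => ⟨⟨x, hA _ a.2 x h⟩, h, h'⟩, fun ⟨x, h⟩ => ⟨x.1, h⟩⟩

theorem rel_abs (hA : ∀ x, A x → ∀ y, E y x → A y) (m : {x // A x}) {n : ℕ} (φ : SetFormula n) :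
    ∀ v : Fin n → {x // A x}, Rel (sE E A) (fun x => E x.1 m.1) φ v ↔
      Rel E (fun x => E x m.1) φ (fun i => (v i).1) := by
  induction φ with
  | mem i j => intro v; rfl
  | eq i j => intro v; exact Subtype.ext_iff
  | fal => intro v; rfl
  | imp φ ψ h1 h2 => intro v; simp only [Rel, h1, h2]
  | all φ h =>
    intro v
    simp only [Rel]
    rw [ball_abs hA]
    refine forall_congr' fun a => imp_congr Iff.rfl ?_
    rw [h]
    have key : (fun i => ((Fin.snoc v a : Fin _ → {x // A x}) i).1) =
        (Fin.snoc (fun i => (v i).1) a.1 : Fin _ → M) := by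
      funext i
      refine Fin.lastCases ?_ (fun j => ?_) i <;> simp
    rw [key]

theorem pp_abs (hA : ∀ x, A x → ∀ y, E y x → A y) (φ : SetFormula 0) (m : {x // A x})
    (h : PP (sE E A) φ m) : PP E φ m.1 := by
  obtain ⟨h1, h2, D, h3, h4⟩ := h
  refine ⟨?_, ?_, D.1, ?_, ?_⟩
  · unfold AxB at h1 ⊢
    simp only [ball_abs hA, bex_abs hA, Subtype.val_inj, ne_eq]
    exact h1
  · have := (rel_abs hA m φ ![]).1 h2
    have e : (fun i => ((![] : Fin 0 → {x // A x}) i).1) = ![] := by funext i; exact i.elim0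
    rwa [e] at this
  · unfold Cl PM IsPr IsUp at h3 ⊢
    simp only [ball_abs hA, bex_abs hA, Subtype.val_inj]
    exact h3
  · unfold SRD PM IsPr IsUp at h4 ⊢
    simp only [ball_abs hA, bex_abs hA, Subtype.val_inj]
    exact h4

end

section
variable {M : Type} [ZF M]

theorem isUp_iff {u a b : M} : IsUp ZF.E u a b ↔ u = up a b := by
  constructor
  · rintro ⟨h1, h2, h3⟩
    apply ext
    intro z
    rw [mem_up]
    exact ⟨h3 z, by rintro (rfl | rfl) <;> assumption⟩
  · rintro rfl
    simp [IsUp]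

theorem isPr_iff {p a b : M} : IsPr ZF.E p a b ↔ p = pr a b := by
  unfold IsPr
  simp only [isUp_iff]
  constructor
  · rintro ⟨⟨u, h1, rfl⟩, ⟨u', h2, rfl⟩, h3⟩
    apply ext
    intro z
    unfold pr
    rw [mem_up]
    exact ⟨h3 z, by rintro (rfl | rfl) <;> assumption⟩
  · rintro rfl
    simp [pr]

theorem pm_iff {R x y : M} : PM ZF.E R x y ↔ pr x y ∊ R := by
  simp [PM, isPr_iff]

variable {V : M} {F : M → Prop}

theorem cl_var (hV : ∀ x y : M, x ∊ V → y ∊ V → pr x y ∊ V) (he : emp ∊ V) (h : Cl ZF.E V F) :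
    ∀ (n : ℕ), (∀ v : Fin n → M, (∀ i, v i ∊ V) → tup v ∊ V) ∧ ∀ (i : Fin n),
    ∃ Q, F Q ∧ ∀ v : Fin n → M, (∀ i, v i ∊ V) → ∀ b, b ∊ V → (pr (tup v) b ∊ Q ↔ b = v i) := by
  obtain ⟨-, -, -, h4, h5, -, -⟩ := h
  simp only [isPr_iff, pm_iff] at h4 h5
  intro n
  induction n with
  | zero => exact ⟨fun v _ => he, fun i => i.elim0⟩
  | succ n ih =>
    refine ⟨fun v hv => hV _ _ (ih.1 _ fun i => hv _) (hv _), ?_⟩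
    intro i
    refine Fin.lastCases ?_ (fun j => ?_) i
    · obtain ⟨S, hS, h⟩ := h4
      refine ⟨S, hS, fun v hv b hb => ?_⟩
      have ht := ih.1 (fun i => v i.castSucc) fun i => hv _
      exact h _ (hV _ _ ht (hv (Fin.last n))) _ ht _ (hv (Fin.last n)) rfl b hb
    · obtain ⟨Q, hQ, h⟩ := ih.2 j
      obtain ⟨S, hS, h'⟩ := h5 Q hQ
      refine ⟨S, hS, fun v hv b hb => ?_⟩
      have ht := ih.1 (fun i => v i.castSucc) fun i => hv _
      exact (h' _ (hV _ _ ht (hv (Fin.last n))) _ ht _ (hv (Fin.last n)) rfl b hb).trans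
        (h _ (fun i => hv _) b hb)

/-- The family contains all definable relations. -/
theorem cl_formula (hV : ∀ x y : M, x ∊ V → y ∊ V → pr x y ∊ V) (he : emp ∊ V) (h : Cl ZF.E V F)
    {n : ℕ} (φ : SetFormula n) : ∃ R, F R ∧ ∀ v : Fin n → M, (∀ i, v i ∊ V) →
      (tup v ∊ R ↔ Rel ZF.E (fun x => x ∊ V) φ v) := by
  have hv := cl_var hV he h
  obtain ⟨h1, h2, h3, -, -, h6, h7⟩ := h
  simp only [pm_iff] at h3 h6 h7
  induction φ with
  | @mem n i j =>
    obtain ⟨Q, hQ, hi⟩ := (hv n).2 i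
    obtain ⟨Q', hQ', hj⟩ := (hv n).2 j
    obtain ⟨S, hS, h⟩ := h6 Q hQ Q' hQ'
    refine ⟨S, hS, fun v hV' => ?_⟩
    rw [h _ ((hv n).1 v hV')]
    simp only [Rel]
    constructor
    · rintro ⟨x, hx, y, hy, h8, h9, h10⟩
      rw [hi v hV' x hx] at h8
      rw [hj v hV' y hy] at h9
      subst h8 h9; exact h10
    · intro h10
      exact ⟨_, hV' i, _, hV' j, (hi v hV' _ (hV' i)).2 rfl, (hj v hV' _ (hV' j)).2 rfl, h10⟩
  | @eq n i j =>
    obtain ⟨Q, hQ, hi⟩ := (hv n).2 i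
    obtain ⟨Q', hQ', hj⟩ := (hv n).2 j
    obtain ⟨S, hS, h⟩ := h7 Q hQ Q' hQ'
    refine ⟨S, hS, fun v hV' => ?_⟩
    rw [h _ ((hv n).1 v hV')]
    simp only [Rel]
    constructor
    · rintro ⟨x, hx, y, hy, h8, h9, h10⟩
      rw [hi v hV' x hx] at h8
      rw [hj v hV' y hy] at h9
      subst h8 h9; exact h10
    · intro h10
      exact ⟨_, hV' i, _, hV' j, (hi v hV' _ (hV' i)).2 rfl, (hj v hV' _ (hV' j)).2 rfl, h10⟩
  | @fal n =>
    obtain ⟨R, hR, h⟩ := h1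
    refine ⟨R, hR, fun v hV' => ?_⟩
    simp only [Rel, iff_false]
    exact h _ ((hv n).1 v hV')
  | @imp n φ ψ i1 i2 =>
    obtain ⟨R, hR, i1⟩ := i1
    obtain ⟨R', hR', i2⟩ := i2
    obtain ⟨S, hS, h⟩ := h2 R hR R' hR'
    refine ⟨S, hS, fun v hV' => ?_⟩
    rw [h _ ((hv n).1 v hV'), i1 v hV', i2 v hV']
    rfl
  | @all n φ ih =>
    obtain ⟨R, hR, ih⟩ := ih
    obtain ⟨S, hS, h⟩ := h3 R hR
    refine ⟨S, hS, fun v hV' => ?_⟩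
    rw [h _ ((hv n).1 v hV')]
    simp only [Rel]
    refine forall_congr' fun a => imp_congr_right fun ha => ?_
    rw [← tup_snoc]
    apply ih
    intro i
    refine Fin.lastCases ?_ (fun j => ?_) i
    · simpa using ha
    · simpa using hV' j

theorem axB_pr {m : M} (h : AxB ZF.E m) : (∀ x y : M, x ∊ m → y ∊ m → pr x y ∊ m) ∧ emp ∊ m := by
  obtain ⟨h1, h2, -, -, h5, -⟩ := h
  have hu : ∀ x y : M, x ∊ m → y ∊ m → up x y ∊ m := by
    intro x y hx hy
    obtain ⟨p, hp, h⟩ := h2 x hx y hy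
    have : p = up x y := by
      apply ext; intro z
      rw [mem_up]
      constructor
      · intro hz; exact (h z (h1 p hp z hz)).1 hz
      · intro hz
        refine (h z ?_).2 hz
        rcases hz with rfl | rfl <;> assumption
    exact this ▸ hp
  refine ⟨fun x y hx hy => hu _ _ (hu _ _ hx hx) (hu _ _ hx hy), ?_⟩
  obtain ⟨I, hI, ⟨e, hem, heI, he⟩, _⟩ := h5
  have : e = emp := eq_emp_iff.2 fun z hz => he z (h1 e hem z hz) hz
  exact this ▸ hem

/-- Set models satisfy ZFC. -/
theorem sub_ZFC {m D : M} (h : AxB ZF.E m) (hc : Cl ZF.E m (fun x => x ∊ D)) (hs : SRD ZF.E m D) :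
    IsZFCE (sE ZF.E (fun x : M => x ∊ m)) := by
  obtain ⟨hpr, hemp⟩ := axB_pr h
  have hform := fun {n : ℕ} (φ : SetFormula n) => cl_formula hpr hemp hc φ
  have htup : ∀ {n : ℕ} (p : Fin n → {x : M // x ∊ m}), tup (fun i => (p i).1) ∊ m :=
    fun {n} p => (cl_var hpr hemp hc n).1 _ fun i => (p i).2
  obtain ⟨h1, h2, h3, h4, h5, h6⟩ := h
  obtain ⟨s1, s2⟩ := hs
  simp only [pm_iff, isPr_iff] at s1 s2
  refine ⟨⟨⟨emp, hemp⟩⟩, ⟨?_, ?_, ?_, ?_, ?_, ?_, ?_⟩, ?_, ?_⟩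
  · intro x y h
    apply Subtype.ext
    apply ext
    intro z
    exact ⟨fun hz => (h ⟨z, h1 _ x.2 z hz⟩).1 hz, fun hz => (h ⟨z, h1 _ y.2 z hz⟩).2 hz⟩
  · simpa [sE, AxPairE, UPairE] using h2
  · simpa [sE, AxUnionE, and_left_comm] using h3
  · simpa [sE, and_left_comm, AxInfE, EmptyE, SuccSpecE] using h5
  · intro a ⟨z, hz⟩
    obtain ⟨w, hw, hw2⟩ := ZF.found a.1 ⟨z.1, hz⟩
    exact ⟨⟨w, h1 _ a.2 w hw⟩, hw, fun z hz => hw2 z.1 hz⟩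
  · intro k φ p a
    obtain ⟨R, hR, hφ⟩ := hform (φ.rename (Fin.cons (Fin.last k) Fin.castSucc))
    obtain ⟨s, hsm, hs⟩ := s1 R hR _ (htup p) a.1 a.2
    refine ⟨⟨s, hsm⟩, fun z => ?_⟩
    refine (hs z.1 z.2).trans (and_congr Iff.rfl ?_)
    rw [← tup_snoc, hφ]
    · have e : (Fin.snoc (fun i => (p i).1) z.1 : Fin (k + 1) → M) =
          fun i => ((Fin.snoc p z : Fin (k + 1) → {x : M // x ∊ m}) i).1 := by
        funext i
        refine Fin.lastCases ?_ (fun j => ?_) i <;> simp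
      rw [e, ← rel_sub, realize_rename]
      refine iff_of_eq (congrArg _ ?_)
      funext i
      refine Fin.cases ?_ (fun j => ?_) i <;> simp
    · intro i
      refine Fin.lastCases ?_ (fun j => ?_) i
      · simpa using z.2
      · simpa using (p j).2
  · intro k φ p a
    obtain ⟨R, hR, hφ⟩ := hform (φ.rename (Fin.cons (Fin.last k).castSucc
      (Fin.cons (Fin.last (k + 1)) (fun i => i.castSucc.castSucc))))
    have key : ∀ x y : {x : M // x ∊ m}, pr (pr (tup (fun i => (p i).1)) x.1) y.1 ∊ R ↔
        Realize (sE ZF.E (fun x : M => x ∊ m)) φ (Fin.cons x (Fin.cons y p)) := by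
      intro x y
      rw [← tup_snoc, ← tup_snoc, hφ]
      · have e : (Fin.snoc (Fin.snoc (fun i => (p i).1) x.1 : Fin (k + 1) → M) y.1 : Fin (k + 2) → M) =
            fun i => ((Fin.snoc (Fin.snoc p x : Fin (k + 1) → {x : M // x ∊ m}) y
              : Fin (k + 2) → {x : M // x ∊ m}) i).1 := by
          funext i
          refine Fin.lastCases ?_ (fun j => ?_) i
          · simp
          · refine Fin.lastCases ?_ (fun j => ?_) j <;> simp
        rw [e, ← rel_sub, realize_rename]
        refine iff_of_eq (congrArg _ ?_)
        funext i
        refine Fin.cases ?_ (fun j => ?_) i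
        · simp
        · refine Fin.cases ?_ (fun j => ?_) j <;> simp
      · intro i
        refine Fin.lastCases ?_ (fun j => ?_) i
        · simpa using y.2
        · refine Fin.lastCases ?_ (fun j => ?_) j
          · simpa using x.2
          · simpa using (p j).2
    intro hf
    obtain ⟨b, hb, h⟩ := s2 R hR _ (htup p) a.1 a.2 (by
      rintro x hx hxa y hy y' hy' _ _ rfl r1 r2
      exact congrArg Subtype.val (hf ⟨x, hx⟩ hxa ⟨y, hy⟩ ⟨y', hy'⟩
        ((key ⟨x, hx⟩ ⟨y, hy⟩).1 r1) ((key ⟨x, hx⟩ ⟨y', hy'⟩).1 r2)))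
    refine ⟨⟨b, hb⟩, fun y => (h y.1 y.2).trans ?_⟩
    constructor
    · rintro ⟨x, hx, hxa, _, _, rfl, r⟩
      exact ⟨⟨x, hx⟩, hxa, (key ⟨x, hx⟩ y).1 r⟩
    · rintro ⟨x, hxa, r⟩
      exact ⟨x.1, x.2, hxa, _, hpr _ _ (htup p) x.2, rfl, (key x y).2 r⟩
  · simpa [sE, AxPowE, PowSpecE, SubE] using h4
  · intro a ha hd
    obtain ⟨c, hc, h⟩ := h6 a.1 a.2 (fun x hx hxa => by
        obtain ⟨z, hz⟩ := ha ⟨x, hx⟩ hxa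
        exact ⟨z.1, z.2, hz⟩) (by
        rintro x hx y hy hxa hya hne ⟨z, hz, hz1, hz2⟩
        exact hd ⟨x, hx⟩ ⟨y, hy⟩ hxa hya (fun h => hne (congrArg Subtype.val h)) ⟨⟨z, hz⟩, hz1, hz2⟩)
    refine ⟨⟨c, hc⟩, fun x hxa => ?_⟩
    obtain ⟨z, hz, hzc, hzx, hu⟩ := h x.1 x.2 hxa
    exact ⟨⟨z, hz⟩, hzc, hzx, fun z' hz' hz'x => Subtype.ext (hu z'.1 z'.2 hz' hz'x)⟩

end

end Paper

namespace Paper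

/-! ## Part 7: conversions; faintness -/

section
variable {M : Type}

theorem consDfn1 {E : M → M → Prop} {S : DS E} {k : ℕ} (φ : SetFormula (k + 1)) (p : Fin k → M)
    (hp : ∀ i, InS S (p i)) : D1 S (fun z => Realize E φ (Fin.cons z p)) := ⟨by
  refine Dfn.comp (m := 1) (fun v => Realize E φ v) ⟨DS.realize S φ⟩
    (fun i v => (Fin.cons (v 0) p : Fin (k + 1) → M) i) ?_
  intro i
  refine Fin.cases ?_ (fun j => ?_) i
  · simp only [Fin.cons_zero]; infer_instance
  · simp only [Fin.cons_succ]
    have := hp j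
    infer_instance⟩

theorem consDfn2 {E : M → M → Prop} {S : DS E} {k : ℕ} (φ : SetFormula (k + 2)) (p : Fin k → M)
    (hp : ∀ i, InS S (p i)) : D2 S (fun z w => Realize E φ (Fin.cons z (Fin.cons w p))) := ⟨by
  refine Dfn.comp (m := 2) (fun v => Realize E φ v) ⟨DS.realize S φ⟩
    (fun i v => (Fin.cons (v 0) (Fin.cons (v 1) p : Fin (k + 1) → M) : Fin (k + 2) → M) i) ?_
  intro i
  refine Fin.cases ?_ (fun j => ?_) i
  · simp only [Fin.cons_zero]; infer_instance
  · simp only [Fin.cons_succ]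
    refine Fin.cases ?_ (fun j => ?_) j
    · simp only [Fin.cons_zero]; infer_instance
    · simp only [Fin.cons_succ]
      have := hp j
      infer_instance⟩

theorem pDS1 {E : M → M → Prop} {S : Set M} {P : M → Prop} (h : D1 (pDS E S) P) :
    ∃ (k : ℕ) (φ : SetFormula (k + 1)) (p : Fin k → M), ∀ z, P z ↔ Realize E φ (Fin.cons z p) := by
  obtain ⟨⟨k, p, φ, -, hφ⟩⟩ := h
  refine ⟨k, φ.rename (Fin.addCases (fun i => i.succ) (fun _ => 0)), p, fun z => ?_⟩
  rw [realize_rename]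
  have := hφ ![z]
  simp only [Matrix.cons_val_zero] at this
  rw [this]
  refine iff_of_eq (congrArg _ ?_)
  funext i
  refine Fin.addCases (fun i => ?_) (fun i => ?_) i
  · simp
  · have : i = 0 := Subsingleton.elim _ _
    subst this
    simp only [Fin.append_right, Fin.addCases_right]; rfl

theorem pDS2 {E : M → M → Prop} {S : Set M} {P : M → M → Prop} (h : D2 (pDS E S) P) :
    ∃ (k : ℕ) (φ : SetFormula (k + 2)) (p : Fin k → M),
      ∀ z w, P z w ↔ Realize E φ (Fin.cons z (Fin.cons w p)) := by
  obtain ⟨⟨k, p, φ, -, hφ⟩⟩ := h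
  refine ⟨k, φ.rename (Fin.addCases (fun i => i.succ.succ) ![0, Fin.succ 0]), p, fun z w => ?_⟩
  rw [realize_rename]
  have := hφ ![z, w]
  simp only [Matrix.cons_val_zero, Matrix.cons_val_one] at this
  rw [this]
  refine iff_of_eq (congrArg _ ?_)
  funext i
  refine Fin.addCases (fun i => ?_) (fun i => ?_) i
  · simp
  · simp only [Fin.append_right, Fin.addCases_right]
    fin_cases i <;> rfl

/-- The ZF structure of a model of ZFC. -/
@[reducible] noncomputable def zfOf {E : M → M → Prop} (h : IsZFCE E) : ZF M where
  E := E
  T := pDS E Set.univ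
  ne := h.1
  consts := fun c => inferInstance
  ext := h.2.1.1
  pair := h.2.1.2.1
  union := h.2.1.2.2.1
  pow := h.2.2.1
  inf := h.2.1.2.2.2.1
  found := h.2.1.2.2.2.2.1
  sep := by
    intro P hP a
    obtain ⟨k, φ, p, hφ⟩ := pDS1 hP
    obtain ⟨s, hs⟩ := h.2.1.2.2.2.2.2.1 k φ p a
    exact ⟨s, fun z => by rw [hs, hφ]⟩
  repl := by
    intro P hP a
    obtain ⟨k, φ, p, hφ⟩ := pDS2 hP
    simp only [hφ]
    exact h.2.1.2.2.2.2.2.2 k φ p a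

/-- Faintness for all definable families. -/
def Faint (M : Type) [ZF M] : Prop := ∀ P : M → M → Prop, D2 𝕋 P → FaintForE ZF.E P

theorem faint_of {E : M → M → Prop} (h : IsZFCE E) (hf : OrdFaintDefE E) : @Faint M (zfOf h) := by
  intro P hP
  obtain ⟨k, φ, p, hφ⟩ := pDS2 hP
  have := hf k φ p
  have e : P = fun α A => Realize E φ (Fin.cons α (Fin.cons A p)) := by
    funext α A; exact propext (hφ α A)
  rw [e]; exact this

variable [ZF M]

theorem ordFaint_of (hf : Faint M) : OrdFaintDefE (ZF.E (M := M)) := by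
  intro k φ p
  exact hf _ (consDfn2 φ p fun i => inferInstance)

theorem isZFC_of (hc : AxChoiceE (ZF.E (M := M))) : IsZFCE (ZF.E (M := M)) := by
  refine ⟨ZF.ne, ⟨ZF.ext, ZF.pair, ZF.union, ZF.inf, ZF.found, ?_, ?_⟩, ZF.pow, hc⟩
  · intro k φ p a
    exact ZF.sep _ (consDfn1 φ p fun i => inferInstance) a
  · intro k φ p a h
    exact ZF.repl _ (consDfn2 φ p fun i => inferInstance) a h

theorem ac_of_idx (ix : M → M) [hix : G1 𝕋 ix] (ho : ∀ x, Od (ix x))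
    (hi : ∀ x y, ix x = ix y → x = y) : AxChoiceE (ZF.E (M := M)) := by
  have : F1 𝕋 ix := ⟨hix⟩
  intro a ha hd
  refine ⟨sep (sU a) (fun z => ∃ x, x ∊ a ∧ z ∊ x ∧ ∀ z', z' ∊ x → ¬ ix z' ∊ ix z), fun x hx => ?_⟩
  obtain ⟨z, hz, hz2⟩ := leastKey ix (fun z => z ∊ x) (fun z _ => ho z) (ha x hx)
  refine ⟨z, mem_sep.2 ⟨mem_sU.2 ⟨x, hx, hz⟩, x, hx, hz, fun z' hz' h => hz2 z' hz' h⟩, hz, ?_⟩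
  intro z' h1 h2
  obtain ⟨-, y, hy, hzy, h3⟩ := mem_sep.1 h1
  have : x = y := by
    by_contra hne
    exact hd x y hx hy hne ⟨z', h2, hzy⟩
  subst this
  apply hi
  rcases trich (ho z') (ho z) with h | h | h
  · exact (hz2 z' h2 h).elim
  · exact h
  · exact (h3 z hz h).elim

/-- Formula definability with arbitrary parameters is definability. -/
theorem pDS_T {S : Set M} {n : ℕ} {P : (Fin n → M) → Prop} (h : Dfn (pDS ZF.E S) P) : Dfn 𝕋 P := by
  obtain ⟨k, p, φ, -, hφ⟩ := h
  have := Dfn.comp (S := 𝕋) (m := n) (fun v => Realize ZF.E φ v) ⟨DS.realize _ φ⟩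
    (fun i v => Fin.append p v i) (by
      intro i
      refine Fin.addCases (fun i => ?_) (fun i => ?_) i
      · simp only [Fin.append_left]; infer_instance
      · simp only [Fin.append_right]; infer_instance)
  exact this.congr fun v => hφ v

end
end Paper

namespace Paper

/-! ## Part 8: an inner model with a definable enumeration -/

section
variable {M : Type} [ZF M]

/-- Numerals. -/
noncomputable def nm : ℕ → M
  | 0 => emp
  | n + 1 => sc (nm n)

instance nmIn {S : DS (ZF.E (M := M))} (n : ℕ) : InS S (nm n : M) := by
  induction n with
  | zero => exact InS.emp
  | succ n ih => exact ⟨(inferInstance : Dfn S (fun v : Fin 1 → M => v 0 = sc (nm n))).out⟩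

theorem od_nm (n : ℕ) : Od (nm n : M) := by
  induction n with
  | zero => exact od_emp
  | succ n ih => exact od_sc ih

theorem nm_inj : ∀ {n k : ℕ}, (nm n : M) = nm k ↔ n = k
  | 0, 0 => by simp
  | 0, k + 1 => by simp [nm, (sc_ne_emp _).symm]
  | n + 1, 0 => by simp [nm, (sc_ne_emp _)]
  | n + 1, k + 1 => by
    constructor
    · intro h; rw [nm_inj.1 (sc_inj h)]
    · intro h; rw [h]

/-- Operations. -/
noncomputable def opImp (b y z : M) : M := sep (Vh b) (fun t => t ∊ y → t ∊ z)
noncomputable def opAll (b y : M) : M := sep (Vh b) (fun t => ∀ a, a ∊ Vh b → pr t a ∊ y)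
noncomputable def opLast (b : M) : M := sep (Vh b) (fun q => ∃ s a, q = pr (pr s a) a)
noncomputable def opLift (b y : M) : M := sep (Vh b) (fun q => ∃ s a c, q = pr (pr s a) c ∧ pr s c ∊ y)
noncomputable def opMem (b y z : M) : M := sep (Vh b) (fun t =>
  ∃ x, x ∊ Vh b ∧ ∃ x', x' ∊ Vh b ∧ pr t x ∊ y ∧ pr t x' ∊ z ∧ x ∊ x')
noncomputable def opEq (b y z : M) : M := sep (Vh b) (fun t =>
  ∃ x, x ∊ Vh b ∧ ∃ x', x' ∊ Vh b ∧ pr t x ∊ y ∧ pr t x' ∊ z ∧ x = x')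
noncomputable def opI (b y z : M) : M := the (fun a => a ∊ Vh b ∧ pr z a ∊ y)

variable {S : DS (ZF.E (M := M))}
instance : F3 S (opImp (M := M)) := ⟨by unfold opImp; infer_instance⟩
instance : F2 S (opAll (M := M)) := ⟨by unfold opAll; infer_instance⟩
instance : F1 S (opLast (M := M)) := ⟨by unfold opLast; infer_instance⟩
instance : F2 S (opLift (M := M)) := ⟨by unfold opLift; infer_instance⟩
instance : F3 S (opMem (M := M)) := ⟨by unfold opMem; infer_instance⟩
instance : F3 S (opEq (M := M)) := ⟨by unfold opEq; infer_instance⟩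
instance : F3 S (opI (M := M)) := ⟨by unfold opI; infer_instance⟩

/-- The combined operation. -/
noncomputable def opG (i b y z : M) : M := the (fun r =>
  (i = nm 0 ∧ r = b) ∨ (i = nm 1 ∧ r = pr y z) ∨ (i = nm 2 ∧ r = opImp b y z) ∨
  (i = nm 3 ∧ r = opAll b y) ∨ (i = nm 4 ∧ r = opLast b) ∨ (i = nm 5 ∧ r = opLift b y) ∨
  (i = nm 6 ∧ r = opMem b y z) ∨ (i = nm 7 ∧ r = opEq b y z) ∨ (i = nm 8 ∧ r = opI b y z))
set_option synthInstance.maxHeartbeats 400000 in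
set_option synthInstance.maxSize 2000 in
instance : F4 S (opG (M := M)) := ⟨by unfold opG; infer_instance⟩

/-- Predecessor. -/
noncomputable def pd (α : M) : M := the (fun δ => α = sc δ)
instance : F1 S (pd (M := M)) := ⟨by unfold pd; infer_instance⟩
theorem pd_sc (α : M) : pd (sc α) = α := the_eq rfl fun _ h => (sc_inj h).symm

/-- One step of the enumeration. -/
noncomputable def stp (α f : M) : M :=
  opG (fst (unp (fst (unp (pd α))))) (snd (unp (fst (unp (pd α)))))
    (ap f (fst (unp (snd (unp (pd α)))))) (ap f (snd (unp (snd (unp (pd α))))))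
instance : F2 S (stp (M := M)) := ⟨by unfold stp; infer_instance⟩
/-- The enumeration. -/
noncomputable def eF : M → M := rec stp
instance : F1 S (eF (M := M)) := recF1 (hH := F2.out)

/-- The range of the enumeration. -/
def KK (x : M) : Prop := ∃ α, Od α ∧ x = eF α
instance : D1 S (KK (M := M)) := ⟨by unfold KK; infer_instance⟩

theorem kk_op {i b y z : M} (hi : Od i) (hb : Od b) (hy : KK y) (hz : KK z) : KK (opG i b y z) := by
  obtain ⟨c, hc, rfl⟩ := hy
  obtain ⟨d, hd, rfl⟩ := hz
  obtain ⟨p, hp, ep⟩ := unp_surj hi hb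
  obtain ⟨q, hq, eq⟩ := unp_surj hc hd
  obtain ⟨δ, hδ, eδ⟩ := unp_surj hp hq
  refine ⟨sc δ, od_sc hδ, ?_⟩
  have h1 := unp_spec hδ
  have h2 := unp_spec hq
  rw [eδ] at h1
  rw [eq] at h2
  simp only [fst_pr, snd_pr] at h1 h2
  have hcδ : c ∊ sc δ := (mem_sc_iff hδ hc).2 (h2.2.2.1.trans' h1.2.2.2)
  have hdδ : d ∊ sc δ := (mem_sc_iff hδ hd).2 (h2.2.2.2.trans' h1.2.2.2)
  have := rec_eq (stp (M := M)) (od_sc hδ)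
  unfold eF
  rw [this]
  unfold stp
  rw [pd_sc, eδ]
  simp only [fst_pr, snd_pr]
  rw [ep, eq]
  simp only [fst_pr, snd_pr]
  rw [ap_gr hcδ, ap_gr hdδ]

theorem kk_ord {b : M} (hb : Od b) : KK b := by
  have h : KK (eF (emp : M)) := ⟨emp, od_emp, rfl⟩
  have := kk_op (od_nm 0) hb h h
  unfold opG at this
  simpa [nm_inj, the_eq (P := fun r => r = b) rfl] using this

theorem kk_pr {y z : M} (hy : KK y) (hz : KK z) : KK (pr y z) := by
  have := kk_op (od_nm 1) od_emp hy hz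
  unfold opG at this
  simpa [nm_inj, the_eq (P := fun r => r = pr y z) rfl] using this

theorem kk_cl {β : M} (hβ : Lim β) : Cl ZF.E (Vh β) KK := by
  have h0 := kk_ord (od_emp (M := M))
  have hp : ∀ {x y : M}, x ∊ Vh β → y ∊ Vh β → pr x y ∊ Vh β := fun h h' => V_pr hβ h h'
  unfold Cl
  simp only [isPr_iff, pm_iff]
  refine ⟨⟨emp, h0, by simp⟩, ?_, ?_, ?_, ?_, ?_, ?_⟩
  · intro R hR R' hR'
    have := kk_op (od_nm 2) hβ.1 hR hR'
    unfold opG at this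
    simp [nm_inj, the_eq (P := fun r => r = opImp β R R') rfl] at this
    refine ⟨_, this, fun t ht => ?_⟩
    unfold opImp
    rw [mem_sep]; simp [ht]
  · intro R hR
    have := kk_op (od_nm 3) hβ.1 hR hR
    unfold opG at this
    simp [nm_inj, the_eq (P := fun r => r = opAll β R) rfl] at this
    refine ⟨_, this, fun t ht => ?_⟩
    unfold opAll
    rw [mem_sep]; simp [ht]
  · have := kk_op (od_nm 4) hβ.1 h0 h0
    unfold opG at this
    simp [nm_inj, the_eq (P := fun r => r = opLast β) rfl] at this
    refine ⟨_, this, ?_⟩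
    rintro _ hpv s hs a ha rfl b hb
    unfold opLast
    rw [mem_sep]
    simp only [hp hpv hb, true_and, pr_inj]
    constructor
    · rintro ⟨s', a', ⟨rfl, rfl⟩, rfl⟩; rfl
    · rintro rfl; exact ⟨s, b, ⟨rfl, rfl⟩, rfl⟩
  · intro R hR
    have := kk_op (od_nm 5) hβ.1 hR hR
    unfold opG at this
    simp [nm_inj, the_eq (P := fun r => r = opLift β R) rfl] at this
    refine ⟨_, this, ?_⟩
    rintro _ hpv s hs a ha rfl b hb
    unfold opLift
    rw [mem_sep]
    simp only [hp hpv hb, true_and, pr_inj]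
    constructor
    · rintro ⟨s', a', c, ⟨⟨rfl, rfl⟩, rfl⟩, h⟩; exact h
    · intro h; exact ⟨s, a, b, ⟨⟨rfl, rfl⟩, rfl⟩, h⟩
  · intro R hR R' hR'
    have := kk_op (od_nm 6) hβ.1 hR hR'
    unfold opG at this
    simp [nm_inj, the_eq (P := fun r => r = opMem β R R') rfl] at this
    refine ⟨_, this, fun t ht => ?_⟩
    unfold opMem
    rw [mem_sep]; simp only [ht, true_and]
  · intro R hR R' hR'
    have := kk_op (od_nm 7) hβ.1 hR hR'
    unfold opG at this
    simp [nm_inj, the_eq (P := fun r => r = opEq β R R') rfl] at this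
    refine ⟨_, this, fun t ht => ?_⟩
    unfold opEq
    rw [mem_sep]; simp only [ht, true_and]

theorem kk_tup {n : ℕ} (p : Fin n → M) (h : ∀ i, KK (p i)) : KK (tup p) := by
  induction n with
  | zero => exact kk_ord od_emp
  | succ n ih => exact kk_pr (ih _ fun i => h _) (h _)

theorem pr_V {α a b : M} (hα : Od α) (h : pr a b ∊ Vh α) : a ∊ Vh α ∧ b ∊ Vh α := by
  have hu : up a b ∊ Vh α := V_trans hα _ h _ (by simp [pr])
  exact ⟨V_trans hα _ hu _ (by simp), V_trans hα _ hu _ (by simp)⟩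

theorem tup_V {α : M} (hα : Od α) {n : ℕ} (v : Fin n → M) (h : tup v ∊ Vh α) : ∀ i, v i ∊ Vh α := by
  induction n with
  | zero => intro i; exact i.elim0
  | succ n ih =>
    have := pr_V hα h
    intro i
    refine Fin.lastCases this.2 (fun j => ih _ this.1 j) i

theorem kk_od {x : M} (h : InS (pDS ZF.E {x : M | KK x}) x) : KK x := by
  obtain ⟨k, p, φ, hp, hφ⟩ := h
  obtain ⟨g, hg1, hg2, hg⟩ := reflect (M := M) φ
  obtain ⟨ξ, hξ, hxξ⟩ := exists_V (tup (Fin.snoc p x : Fin (k + 1) → M))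
  obtain ⟨β, hβ, hξβ, hcl⟩ := cl_pts (hG := hg1.out) g hg2 hξ
  have hv := tup_V hβ.1 _ (V_mem hβ.1 hξβ _ hxξ)
  have he : emp ∊ Vh β := ord_sub_V β hβ.1 _ hβ.emp_mem
  obtain ⟨R, hR, hRφ⟩ := cl_formula (fun x y => V_pr hβ) he (kk_cl hβ) φ
  have hpV : ∀ i, p i ∊ Vh β := fun i => by simpa using hv i.castSucc
  have hxV : x ∊ Vh β := by simpa using hv (Fin.last k)
  have key : ∀ a, a ∊ Vh β → (pr (tup p) a ∊ R ↔ a = x) := by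
    intro a ha
    have e : (Fin.snoc p a : Fin (k + 1) → M) = Fin.append p ![a] := by
      funext i
      refine Fin.lastCases ?_ (fun j => ?_) i
      · have : Fin.last k = Fin.natAdd k (0 : Fin 1) := rfl
        rw [this, Fin.append_right]
        rw [← this]; simp
      · have : j.castSucc = Fin.castAdd 1 j := rfl
        rw [this, Fin.append_left]
        rw [← this]; simp
    have hall : ∀ i, (Fin.snoc p a : Fin (k + 1) → M) i ∊ Vh β := by
      intro i
      refine Fin.lastCases ?_ (fun j => ?_) i
      · simpa using ha
      · simpa using hpV j
    rw [← tup_snoc, hRφ _ hall, ← hg β hβ hcl _ hall, e, ← hφ ![a]]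
    simp
  have := kk_op (od_nm 8) hβ.1 hR (kk_tup p hp)
  unfold opG at this
  simp [nm_inj, the_eq (P := fun r => r = opI β R (tup p)) rfl] at this
  have e : opI β R (tup p) = x := by
    unfold opI
    exact the_eq ⟨hxV, (key x hxV).2 rfl⟩ fun z hz => (key z hz.1).1 hz.2
  rwa [e] at this

/-- The definability structure with parameters from the range. -/
noncomputable abbrev KD (M : Type) [ZF M] : DS (ZF.E (M := M)) := pDS ZF.E {x : M | KK x}

theorem kk_in {x : M} (h : KK x) : InS (KD M) x := pDS_const _ _ h

/-- The inner model. -/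
def WW (x : M) : Prop := ∃ t, Tr t ∧ x ∊ t ∧ ∀ z, z ∊ t → KK z
instance : D1 S (WW (M := M)) := ⟨by unfold WW; infer_instance⟩

theorem ww_tr (x : M) (h : WW x) (y : M) (hy : y ∊ x) : WW y := by
  obtain ⟨t, h1, h2, h3⟩ := h
  exact ⟨t, h1, h1 x h2 y hy, h3⟩
theorem ww_kk {x : M} (h : WW x) : KK x := by
  obtain ⟨t, h1, h2, h3⟩ := h
  exact h3 x h2
theorem ww_in {x : M} (h : WW x) : InS (KD M) x := kk_in (ww_kk h)
theorem ww_def {y : M} (h : InS (KD M) y) (hs : ∀ z, z ∊ y → WW z) : WW y := by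
  have hy := kk_od h
  refine ⟨bU (sep (Vh (rk y)) WW) (up y y), ?_, by simp, ?_⟩
  · intro a ha b hb
    rw [mem_bU, mem_sep, mem_up] at ha ⊢
    left
    rcases ha with ha | ha
    · exact ⟨V_trans (od_rk y) _ ha.1 _ hb, ww_tr _ ha.2 _ hb⟩
    · have ha : a = y := by simpa using ha
      subst ha
      exact ⟨sub_V_rk _ _ hb, hs _ hb⟩
  · intro z hz
    rw [mem_bU, mem_sep, mem_up] at hz
    rcases hz with hz | hz
    · exact ww_kk hz.2
    · have hz : z = y := by simpa using hz
      subst hz; exact hy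
theorem ww_ord {α : M} (hα : Od α) : WW α :=
  ⟨sc α, (od_sc hα).1, by simp, fun z hz => kk_ord ((od_sc hα).mem hz)⟩

/-- Lifting predicates on the inner model. -/
def wl {n : ℕ} (P : (Fin n → {x : M // WW x}) → Prop) (v : Fin n → M) : Prop :=
  ∃ h : ∀ i, WW (v i), P (fun i => ⟨v i, h i⟩)

theorem wlDfn {n : ℕ} {P : (Fin n → {x : M // WW x}) → Prop} {Q : (Fin n → M) → Prop}
    (hQ : Dfn (KD M) Q) (h : ∀ v : Fin n → {x : M // WW x}, P v ↔ Q (fun i => (v i).1)) :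
    (KD M).R (wl P) := by
  have h1 : Dfn (KD M) (fun v : Fin n → M => ∀ i, WW (v i)) := Dfn.finAll fun i => inferInstance
  have h2 := Dfn.andI (hP := h1) (hQ := hQ)
  refine (h2.congr fun v => ?_).out
  constructor
  · rintro ⟨h3, h4⟩
    exact ⟨h3, (h _).1 h4⟩
  · rintro ⟨h3, h4⟩
    exact ⟨h3, (h _).2 h4⟩

theorem wl_iff {n : ℕ} {P : (Fin n → {x : M // WW x}) → Prop} (v : Fin n → {x : M // WW x}) :
    wl P (fun i => (v i).1) ↔ P v := ⟨fun ⟨_, h⟩ => h, fun h => ⟨fun i => (v i).2, h⟩⟩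

theorem snoc_val {A : M → Prop} {n : ℕ} (v : Fin n → {x // A x}) (a : {x // A x}) :
    (fun i => ((Fin.snoc v a : Fin (n + 1) → {x // A x}) i).1) =
      (Fin.snoc (fun i => (v i).1) a.1 : Fin (n + 1) → M) := by
  funext i
  refine Fin.lastCases ?_ (fun j => ?_) i <;> simp

/-- Definability in the inner model. -/
noncomputable def WD (M : Type) [ZF M] : DS (sE (ZF.E (M := M)) WW) where
  R := fun P => (KD M).R (wl P)
  memVar := fun i j => wlDfn (Dfn.memVar i j) fun v => Iff.rfl
  eqVar := fun i j => wlDfn (Dfn.eqVar i j) fun v => Subtype.ext_iff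
  fal := wlDfn Dfn.falI fun v => Iff.rfl
  imp := fun {n P Q} hP hQ => wlDfn (Dfn.impI (hP := ⟨hP⟩) (hQ := ⟨hQ⟩)) fun v => by
    rw [wl_iff, wl_iff]
  all := fun {n P} hP => by
    have h1 : Dfn (KD M) (fun v : Fin (n + 1) → M => WW (v (Fin.last n)) → wl P v) :=
      Dfn.impI (hQ := ⟨hP⟩)
    refine wlDfn ⟨(KD M).all h1.out⟩ fun v => ?_
    simp only [Fin.snoc_last]
    constructor
    · intro h a ha
      rw [← snoc_val v ⟨a, ha⟩, wl_iff]
      exact h _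
    · intro h a
      have := h a.1 a.2
      rwa [← snoc_val v a, wl_iff] at this
  reidx := fun {n m P} σ hP => by
    refine wlDfn (Dfn.reindex ⟨hP⟩ σ) fun v => ?_
    exact (wl_iff (P := P) (fun i => v (σ i))).symm

theorem wd_iff {n : ℕ} {P : (Fin n → {x : M // WW x}) → Prop} : Dfn (WD M) P ↔ Dfn (KD M) (wl P) :=
  ⟨fun h => ⟨h.out⟩, fun h => ⟨h.out⟩⟩

theorem wd1 {P : {x : M // WW x} → Prop} (h : D1 (WD M) P) :
    D1 (KD M) (fun x => ∃ h : WW x, P ⟨x, h⟩) := ⟨by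
  refine (wd_iff.1 h.out).congr fun v => ?_
  constructor
  · rintro ⟨h, hp⟩
    exact ⟨fun i => by rw [Subsingleton.elim i 0]; exact h, hp⟩
  · rintro ⟨h, hp⟩
    exact ⟨h 0, hp⟩⟩

theorem wd2 {P : {x : M // WW x} → {x : M // WW x} → Prop} (h : D2 (WD M) P) :
    D2 (KD M) (fun x y => ∃ (h : WW x) (h' : WW y), P ⟨x, h⟩ ⟨y, h'⟩) := ⟨by
  refine (wd_iff.1 h.out).congr fun v => ?_
  constructor
  · rintro ⟨h, h', hp⟩
    exact ⟨by intro i; fin_cases i <;> assumption, hp⟩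
  · rintro ⟨h, hp⟩
    exact ⟨h 0, h 1, hp⟩⟩

theorem inS_of {y : M} (h : Dfn S (fun v : Fin 1 → M => v 0 = y)) : InS S y := ⟨h.out⟩

/-- The inner model is a model of ZF. -/
@[reducible] noncomputable def zfW (M : Type) [ZF M] : ZF {x : M // WW x} where
  E := sE ZF.E WW
  T := WD M
  ne := ⟨⟨emp, ww_ord od_emp⟩⟩
  consts := fun c => by
    have := ww_in c.2
    refine ⟨wlDfn (Q := fun v => v 0 = c.1) inferInstance fun v => Subtype.ext_iff⟩
  ext := by
    intro x y h
    apply Subtype.ext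
    apply ext
    intro z
    exact ⟨fun hz => (h ⟨z, ww_tr _ x.2 z hz⟩).1 hz, fun hz => (h ⟨z, ww_tr _ y.2 z hz⟩).2 hz⟩
  pair := by
    intro a b
    have := ww_in a.2
    have := ww_in b.2
    refine ⟨⟨up a.1 b.1, ww_def (inS_of inferInstance) ?_⟩, ?_⟩
    · intro z hz
      rcases mem_up.1 hz with rfl | rfl
      · exact a.2
      · exact b.2
    · intro z
      simp only [sE, mem_up, Subtype.ext_iff]
  union := by
    intro a
    have := ww_in a.2
    refine ⟨⟨sU a.1, ww_def (inS_of inferInstance) ?_⟩, ?_⟩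
    · intro z hz
      obtain ⟨y, hy, hz⟩ := mem_sU.1 hz
      exact ww_tr _ (ww_tr _ a.2 _ hy) _ hz
    · intro z
      simp only [sE, mem_sU]
      exact bex_abs ww_tr a _
  pow := by
    intro a
    have := ww_in a.2
    refine ⟨⟨sep (pw a.1) WW, ww_def (inS_of inferInstance) ?_⟩, ?_⟩
    · intro z hz
      exact (mem_sep.1 hz).2
    · intro z
      simp only [sE, mem_sep, mem_pw, SubE]
      rw [← ball_abs ww_tr z (fun x => x ∊ a.1)]
      exact ⟨fun h => h.1, fun h => ⟨h, z.2⟩⟩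
  inf := by
    refine ⟨⟨om, ww_ord lim_om.1⟩, ⟨⟨emp, ww_ord od_emp⟩, lim_om.emp_mem, fun z hz => ?_⟩, ?_⟩
    · exact not_mem_emp _ hz
    · intro y hy
      refine ⟨⟨sc y.1, ww_ord (od_sc (lim_om.1.mem hy))⟩, lim_om.2.2 _ hy, fun z => ?_⟩
      simp only [sE, mem_sc, Subtype.ext_iff]
  found := by
    intro a ⟨z, hz⟩
    obtain ⟨w, hw, hw2⟩ := ZF.found a.1 ⟨z.1, hz⟩
    exact ⟨⟨w, ww_tr _ a.2 w hw⟩, hw, fun z hz => hw2 z.1 hz⟩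
  sep := by
    intro P hP a
    have hP1 := wd1 hP
    obtain ⟨P', hP'⟩ : ∃ P' : M → Prop, ∀ x, P' x ↔ ∃ h : WW x, P ⟨x, h⟩ := ⟨_, fun _ => Iff.rfl⟩
    simp only [← hP'] at hP1
    have hP3 : D1 𝕋 P' := ⟨pDS_T hP1.out⟩
    have := ww_in a.2
    refine ⟨⟨sep a.1 (fun x => P' x), ww_def (inS_of ?_) ?_⟩, ?_⟩
    · have h4 : DFun (KD M) (fun v : Fin 1 → M => sep a.1 (fun x => P' x)) := inferInstance
      infer_instance
    · intro z hz
      exact ((hP' z).1 (mem_sep.1 hz).2).1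
    · intro z
      simp only [sE, mem_sep]
      rw [hP']
      exact ⟨fun h => ⟨h.1, h.2.2⟩, fun h => ⟨h.1, z.2, h.2⟩⟩
  repl := by
    intro P hP a hf
    have hP1 := wd2 hP
    obtain ⟨P', hP'⟩ : ∃ P' : M → M → Prop,
      ∀ x y, P' x y ↔ ∃ (h : WW x) (h' : WW y), P ⟨x, h⟩ ⟨y, h'⟩ := ⟨_, fun _ _ => Iff.rfl⟩
    simp only [← hP'] at hP1
    have hP3 : D2 𝕋 P' := ⟨pDS_T hP1.out⟩
    obtain ⟨b, hb⟩ := ZF.repl _ hP3 a.1 (by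
      intro x hx y y' h h'
      obtain ⟨h1, h2, h3⟩ := (hP' _ _).1 h
      obtain ⟨h1', h2', h3'⟩ := (hP' _ _).1 h'
      exact congrArg Subtype.val (hf ⟨x, h1⟩ hx ⟨y, h2⟩ ⟨y', h2'⟩ h3 h3'))
    have := ww_in a.2
    have hd : InS (KD M) b := by
      have h3 : Dfn (KD M) (fun v : Fin 1 → M => ∀ y, y ∊ v 0 ↔ ∃ x, x ∊ a.1 ∧ P' x y) := inferInstance
      refine inS_of (h3.congr fun v => ?_)
      constructor
      · intro h; rw [h]; exact hb
      · intro h; apply ext; intro z; rw [h, hb]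
    simp only [hP'] at hb
    refine ⟨⟨b, ww_def hd ?_⟩, ?_⟩
    · intro z hz
      obtain ⟨x, hx, h1, h2, h3⟩ := (hb z).1 hz
      exact h2
    · intro y
      refine (hb y.1).trans ?_
      constructor
      · rintro ⟨x, hx, h1, h2, h3⟩
        exact ⟨⟨x, h1⟩, hx, h3⟩
      · rintro ⟨x, hx, h3⟩
        exact ⟨x.1, hx, x.2, y.2, h3⟩

/-- Index of an element. -/
noncomputable def idx (x : M) : M := lst (fun α => x = eF α)
instance : F1 S (idx (M := M)) := ⟨by unfold idx; infer_instance⟩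

theorem od_abs (x : {x : M // WW x}) : OrdE (sE ZF.E WW) x ↔ Od x.1 := by
  have ht : ∀ x : {x : M // WW x}, TransE (sE ZF.E WW) x ↔ TransE ZF.E x.1 := by
    intro x
    unfold TransE
    rw [ball_abs ww_tr]
    refine forall_congr' fun y => imp_congr Iff.rfl ?_
    rw [ball_abs ww_tr]
  unfold Od OrdE
  rw [ht, ball_abs ww_tr]
  simp only [ht, sE]

theorem faintW (h : Faint M) : @Faint _ (zfW M) := by
  intro P hP
  have hP1 := wd2 hP
  have hP3 : D2 𝕋 (fun x y => ∃ (h : WW x) (h' : WW y), P ⟨x, h⟩ ⟨y, h'⟩) := ⟨pDS_T hP1.out⟩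
  intro h1 ξ hξ
  obtain ⟨α, β, A, B, h2, h3, h4, h5, ⟨_, wA, h6⟩, h7, ⟨_, wB, h8⟩⟩ := h _ hP3 (by
    intro α hα
    obtain ⟨⟨A, hA⟩, h3⟩ := h1 ⟨α, ww_ord hα⟩ ((od_abs _).2 hα)
    refine ⟨⟨A.1, ww_ord hα, A.2, hA⟩, ?_⟩
    rintro A ⟨h4, h5, h6⟩ z hz
    exact h3 ⟨A, h5⟩ h6 ⟨z, ww_tr _ h5 _ hz⟩ hz) ξ.1 ((od_abs ξ).1 hξ)
  exact ⟨⟨α, ww_ord h2⟩, ⟨β, ww_ord h3⟩, ⟨A, wA⟩, ⟨B, wB⟩, (od_abs _).2 h2, (od_abs _).2 h3, h4, h5,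
    h6, fun z => h7 z.1, h8⟩

/-- The index function of the inner model. -/
noncomputable def idxW (x : {x : M // WW x}) : {x : M // WW x} := ⟨idx x.1, ww_ord (od_lst _)⟩

theorem idxW_F1 : F1 (WD M) (idxW (M := M)) := ⟨⟨wd_iff.2 ⟨wlDfn
  (Q := fun v => v 1 = idx (v 0)) inferInstance fun v => Subtype.ext_iff⟩⟩⟩

theorem idxW_inj (x y : {x : M // WW x}) (h : idxW x = idxW y) : x = y := by
  have h := congrArg Subtype.val h
  have hx := (lst_spec (P := fun α => x.1 = eF α) (ww_kk x.2)).2.1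
  have hy := (lst_spec (P := fun α => y.1 = eF α) (ww_kk y.2)).2.1
  apply Subtype.ext
  rw [hx, hy]
  exact congrArg eF h

end
end Paper

namespace Paper

/-! ## Part 9: tools for the second step -/

section
variable {M : Type} [ZF M]

/-- A rank-monotone enumeration of the universe by ordinals. -/
structure En (e ix : M → M) : Prop where
  fe : F1 𝕋 e
  fi : F1 𝕋 ix
  od : ∀ x, Od (ix x)
  ei : ∀ x, e (ix x) = x
  ie : ∀ α, Od α → ix (e α) = α
  mono : ∀ α β, Od β → α ∊ β → Sb (rk (e α)) (rk (e β))

theorem exists_En (i0 : M → M) (h0 : F1 𝕋 i0) (ho : ∀ x, Od (i0 x))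
    (hi : ∀ x y, i0 x = i0 y → x = y) : ∃ e ix : M → M, En e ix := by
  have hT : D1 𝕋 (fun _ : M => True) := ⟨Dfn.congr (P := fun v : Fin 1 → M => v 0 = v 0)
    inferInstance (fun v => by simp)⟩
  have H : EnumH (fun _ : M => True) rk i0 i0 := by
    refine ⟨hT, inferInstance, h0, h0, fun x _ => od_rk x, fun x _ => ho x, fun x _ => ho x,
      fun x y _ _ _ h _ => hi x y h, ?_, ?_⟩
    · intro μ hμ
      refine ⟨Vh (sc μ), fun x _ h => ?_⟩
      rw [mem_V_iff (od_sc hμ)]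
      exact (mem_sc_iff hμ (od_rk x)).2 h
    · intro s
      obtain ⟨α, -, h⟩ := no_all_ord s
      exact ⟨α, trivial, h⟩
  have hQ : Q1 𝕋 (fun _ : M => True) := hT.out
  refine ⟨enum (fun _ => True) rk i0 i0, enumI (fun _ => True) rk i0 i0,
    enumF1 _ _ _ _, enumIF1 _ _ _ _, H.od_I, fun x => H.enum_I trivial, fun α h => H.I_enum h, ?_⟩
  intro α β hβ hαβ
  rcases H.mono hβ hαβ with h | ⟨h, -⟩
  · exact (od_rk _).sub h
  · rw [h]; exact Sb.rfl'

/-- The ordinal of indices of elements of `Vh ν`. -/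
noncomputable def tau (ix : M → M) (ν : M) : M := img ix (Vh ν)
theorem tauF {S : DS (ZF.E (M := M))} (ix : M → M) [h : F1 S ix] : F1 S (tau ix) :=
  ⟨by unfold tau; infer_instance⟩

variable {e ix : M → M}

theorem En.inj (H : En e ix) {x y : M} (h : ix x = ix y) : x = y := by
  rw [← H.ei x, h, H.ei]

theorem En.mem_tau (H : En e ix) {ν α : M} (hα : Od α) : α ∊ tau ix ν ↔ e α ∊ Vh ν := by
  have := H.fi
  unfold tau
  rw [mem_img]
  constructor
  · rintro ⟨x, hx, rfl⟩; rwa [H.ei]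
  · intro h; exact ⟨e α, h, (H.ie α hα).symm⟩

theorem En.tau_od (H : En e ix) {ν α : M} (h : α ∊ tau ix ν) : Od α := by
  have := H.fi
  unfold tau at h
  rw [mem_img] at h
  obtain ⟨x, hx, rfl⟩ := h
  exact H.od x

theorem En.od_tau (H : En e ix) {ν : M} (hν : Od ν) : Od (tau ix ν) := by
  have ho : ∀ y, y ∊ tau ix ν → Od y := fun y => H.tau_od
  refine ⟨fun y hy z hz => ?_, fun y hy => (ho y hy).1⟩
  have oy := ho y hy
  have oz := oy.mem hz
  rw [H.mem_tau oy, mem_V_iff hν] at hy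
  rw [H.mem_tau oz, mem_V_iff hν]
  exact mem_of_sub_mem (od_rk _) hν (H.mono z y oy hz) hy

theorem En.ix_tau (H : En e ix) {ν x : M} : ix x ∊ tau ix ν ↔ x ∊ Vh ν := by
  rw [H.mem_tau (H.od x), H.ei]

theorem En.sub_tau (H : En e ix) {ν : M} (hν : Od ν) : Sb ν (tau ix ν) := by
  by_contra hc
  have o := H.od_tau hν
  -- the ordinals below `ν` would inject
  have h1 : tau ix ν ∊ ν := by
    by_contra h; exact hc ((not_mem_iff o hν).1 h)
  have hf := H.fi
  -- rk (e α) ≥ α fails to be needed; use a least index argument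
  have key : ∀ α, Od α → Sb (rk (e α)) α := by
    have := H.fe
    apply ord_ind (fun α => Sb (rk (e α)) α)
    intro α hα ih
    by_contra hn
    have h2 : α ∊ rk (e α) := by
      by_contra h; exact hn ((not_mem_iff hα (od_rk _)).1 h)
    -- α itself has rank α, so its index is below α
    have h3 : ix α ∊ α ∨ ix α = α ∨ α ∊ ix α := trich (H.od α) hα
    rcases h3 with h | h | h
    · have := ih _ h
      rw [H.ei, rk_ord hα] at this
      exact mem_irrefl _ (this _ h)
    · have := H.ei α; rw [h] at this; rw [this, rk_ord hα] at h2; exact mem_irrefl _ h2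
    · have := H.mono α (ix α) (H.od α) h
      rw [H.ei, rk_ord hα] at this
      exact mem_irrefl _ (this _ h2)
  have : tau ix ν ∊ tau ix ν := by
    rw [H.mem_tau o, mem_V_iff hν]
    exact mem_of_sub_mem (od_rk _) hν (key _ o) h1
  exact mem_irrefl _ this

/-- Definition by cases. -/
noncomputable def cond (p : Prop) (a b : M) : M := the (fun r => (p ∧ r = a) ∨ (¬ p ∧ r = b))
instance condI {S : DS (ZF.E (M := M))} {n : ℕ} {P : (Fin n → M) → Prop} {f g : (Fin n → M) → M}
    [hP : Dfn S P] [hf : DFun S f] [hg : DFun S g] : DFun S (fun v => cond (P v) (f v) (g v)) := by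
  have := hf.weaken
  have := hg.weaken
  have := hP.reindex (Fin.castSucc (n := n))
  unfold cond; infer_instance
theorem cond_pos {p : Prop} (h : p) (a b : M) : cond p a b = a := by
  unfold cond; exact the_eq (Or.inl ⟨h, rfl⟩) (by rintro z (⟨_, h'⟩ | ⟨h', _⟩); exacts [h', (h' h).elim])
theorem cond_neg {p : Prop} (h : ¬ p) (a b : M) : cond p a b = b := by
  unfold cond; exact the_eq (Or.inr ⟨h, rfl⟩) (by rintro z (⟨h', _⟩ | ⟨_, h'⟩); exacts [(h h').elim, h'])

/-- Section of a set of pairs. -/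
noncomputable def sec (s α : M) : M := sep α (fun ξ => pr α ξ ∊ s)
theorem mem_sec {s α ξ : M} : ξ ∊ sec s α ↔ ξ ∊ α ∧ pr α ξ ∊ s := by unfold sec; rw [mem_sep]
instance {S : DS (ZF.E (M := M))} : F2 S (sec (M := M)) := ⟨by unfold sec; infer_instance⟩
theorem sec_sub {s α : M} : Sb (sec s α) α := fun _ h => (mem_sec.1 h).1

/-- `s` witnesses that `γ` is not faint. -/
def Bad (γ s : M) : Prop := ∀ α β, Lim α → Lim β → α ∊ β → β ∊ γ → bI (sec s β) α ≠ sec s α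
instance {S : DS (ZF.E (M := M))} : D2 S (Bad (M := M)) := ⟨by unfold Bad; infer_instance⟩

/-- Doubling. -/
noncomputable def dd : M → M := recI (fun _ s => iU (fun x => sc (sc x)) s)
instance {S : DS (ZF.E (M := M))} : F1 S (dd (M := M)) := by unfold dd; infer_instance

theorem mem_dd {ξ z : M} (h : Od ξ) : z ∊ dd ξ ↔ ∃ η, η ∊ ξ ∧ z ∊ sc (sc (dd η)) := by
  unfold dd
  rw [recI_eq _ h, mem_iU]
  constructor
  · rintro ⟨x, hx, hz⟩
    rw [mem_img] at hx
    obtain ⟨y, hy, rfl⟩ := hx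
    exact ⟨y, hy, hz⟩
  · rintro ⟨y, hy, hz⟩
    exact ⟨_, mem_img.2 ⟨y, hy, rfl⟩, hz⟩

theorem od_dd : ∀ ξ : M, Od ξ → Od (dd ξ) := by
  apply ord_ind (fun ξ => Od (dd ξ))
  intro ξ hξ ih
  have : dd ξ = iU (fun x => sc (sc (dd x))) ξ := by
    apply ext; intro z; rw [mem_dd hξ, mem_iU]
  rw [this]
  exact od_iU fun x hx => od_sc (od_sc (ih x hx))

theorem dd_lt {η ξ : M} (h : Od ξ) (hη : η ∊ ξ) : dd η ∊ dd ξ ∧ sc (dd η) ∊ dd ξ := by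
  rw [mem_dd h, mem_dd h]
  exact ⟨⟨η, hη, by simp⟩, ⟨η, hη, by simp⟩⟩

theorem dd_inj {η ξ : M} (hη : Od η) (hξ : Od ξ) (h : dd η = dd ξ) : η = ξ := by
  rcases trich hη hξ with h' | h' | h'
  · have := (dd_lt hξ h').1; rw [h] at this; exact (mem_irrefl _ this).elim
  · exact h'
  · have := (dd_lt hη h').1; rw [h] at this; exact (mem_irrefl _ this).elim

theorem dd_ne {η ξ : M} (hη : Od η) (hξ : Od ξ) : dd η ≠ sc (dd ξ) := by
  intro h
  rcases trich hη hξ with h' | h' | h'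
  · have := (dd_lt hξ h').1; rw [h] at this; exact mem_asymm this (by simp)
  · subst h'; have : dd η ∊ sc (dd η) := by simp
    rw [← h] at this; exact mem_irrefl _ this
  · have := (dd_lt hη h').2; rw [h] at this; exact mem_irrefl _ this

theorem sub_dd : ∀ ξ : M, Od ξ → Sb ξ (dd ξ) := by
  apply ord_ind (fun ξ => Sb ξ (dd ξ))
  intro ξ hξ ih z hz
  exact mem_of_sub_mem (hξ.mem hz) (od_dd ξ hξ) (ih z hz) (dd_lt hξ hz).1

theorem dd_mem : ∀ ξ : M, Od ξ → ∀ α, Lim α → ξ ∊ α → dd ξ ∊ α := by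
  apply ord_ind (fun ξ => ∀ α, Lim α → ξ ∊ α → dd ξ ∊ α)
  intro ξ hξ ih α hα hξα
  rcases zero_succ_lim hξ with h | ⟨β, hβ, h⟩ | h
  · have : dd ξ = emp := by
      rw [eq_emp_iff]; intro z hz
      rw [mem_dd hξ] at hz
      obtain ⟨η, h1, -⟩ := hz
      rw [h] at h1; simp at h1
    rw [this]; exact hα.emp_mem
  · subst h
    have h1 : dd β ∊ α := ih β (by simp) α hα (hα.1.trans (by simp) hξα)
    have h2 : sc (sc (dd β)) ∊ α := hα.2.2 _ (hα.2.2 _ h1)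
    refine mem_of_sub_mem (od_dd _ hξ) hα.1 ?_ h2
    intro z hz
    rw [mem_dd hξ] at hz
    obtain ⟨η, h3, hz⟩ := hz
    have ob := od_dd β hβ
    rcases mem_sc.1 h3 with h3 | rfl
    · have h4 : sc (sc (dd η)) ∊ sc (sc (dd β)) := by
        have h5 := (dd_lt hβ h3).2
        have h6 : Sb (sc (sc (dd η))) (dd β) := sc_sub ob h5
        rcases (sub_iff (od_sc (od_sc (od_dd _ (hβ.mem h3)))) ob).1 h6 with h | h
        · simp [h]
        · rw [h]; simp
      exact (od_sc (od_sc ob)).trans hz h4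
    · exact hz
  · refine mem_of_sub_mem (od_dd _ hξ) hα.1 ?_ hξα
    intro z hz
    rw [mem_dd hξ] at hz
    obtain ⟨η, h3, hz⟩ := hz
    exact hξ.trans hz (h.2.2 _ (h.2.2 _ (ih η h3 ξ h h3)))

/-- The code of a label and a set of ordinals. -/
noncomputable def code (l B : M) : M := bU (up emp (dd (sc l))) (img (fun ξ => sc (dd ξ)) B)
theorem mem_code {l B z : M} : z ∊ code l B ↔ z = emp ∨ z = dd (sc l) ∨ ∃ ξ, ξ ∊ B ∧ z = sc (dd ξ) := by
  unfold code; rw [mem_bU, mem_img, mem_up, or_assoc]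
instance {S : DS (ZF.E (M := M))} : F2 S (code (M := M)) := ⟨by unfold code; infer_instance⟩

theorem code_sub {α l B : M} (hα : Lim α) (hl : l ∊ α) (hB : Sb B α) : Sb (code l B) α := by
  intro z hz
  rw [mem_code] at hz
  rcases hz with rfl | rfl | ⟨ξ, h, rfl⟩
  · exact hα.emp_mem
  · exact dd_mem _ (hα.1.mem (hα.2.2 _ hl)) α hα (hα.2.2 _ hl)
  · exact hα.2.2 _ (dd_mem _ (hα.1.mem (hB _ h)) α hα (hB _ h))

theorem dd_sc_ne_emp {l : M} (hl : Od l) : dd (sc l) ≠ emp := by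
  intro h
  have := (dd_lt (od_sc hl) (by simp : l ∊ sc l)).1
  rw [h] at this; simp at this

theorem code_coh {α l l' B B' : M} (hα : Lim α) (hl : Od l) (hl' : Od l') (hB : ∀ x, x ∊ B → Od x)
    (hB' : Sb B' α) (h : ∀ z, z ∊ code l' B' ↔ z ∊ code l B ∧ z ∊ α) : l' = l ∧ bI B α = B' := by
  constructor
  · have h1 := ((h (dd (sc l'))).1 (mem_code.2 (Or.inr (Or.inl rfl)))).1
    rw [mem_code] at h1
    rcases h1 with h1 | h1 | ⟨ξ, h2, h1⟩
    · exact (dd_sc_ne_emp hl' h1).elim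
    · exact sc_inj (dd_inj (od_sc hl') (od_sc hl) h1)
    · exact (dd_ne (od_sc hl') (hB _ h2) h1).elim
  · apply ext
    intro ξ
    rw [mem_bI]
    constructor
    · rintro ⟨h1, h2⟩
      have h3 : sc (dd ξ) ∊ code l' B' := (h _).2 ⟨mem_code.2 (Or.inr (Or.inr ⟨ξ, h1, rfl⟩)),
        hα.2.2 _ (dd_mem _ (hα.1.mem h2) α hα h2)⟩
      rw [mem_code] at h3
      rcases h3 with h3 | h3 | ⟨ξ', h4, h3⟩
      · exact (sc_ne_emp _ h3).elim
      · exact (dd_ne (od_sc hl') (hB _ h1) h3.symm).elim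
      · have := dd_inj (hB _ h1) (hα.1.mem (hB' _ h4)) (sc_inj h3)
        rwa [this]
    · intro h1
      refine ⟨?_, hB' _ h1⟩
      have h3 := ((h (sc (dd ξ))).1 (mem_code.2 (Or.inr (Or.inr ⟨ξ, h1, rfl⟩)))).1
      have oξ := hα.1.mem (hB' _ h1)
      rw [mem_code] at h3
      rcases h3 with h3 | h3 | ⟨ξ', h4, h3⟩
      · exact (sc_ne_emp _ h3).elim
      · exact (dd_ne (od_sc hl) oξ h3.symm).elim
      · have := dd_inj oξ (hB _ h4) (sc_inj h3)
        rwa [this]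

theorem lemmaX {γ0 γ s0 : M} (hγ : Od γ) (hγ0 : Od γ0) (h0 : Bad γ0 s0) (L B : M → M)
    [fL : F1 𝕋 L] [fB : F1 𝕋 B]
    (hL : ∀ α, Lim α → α ∊ γ → ¬ α ∊ γ0 → L α ∊ α)
    (hB : ∀ α, Lim α → α ∊ γ → ¬ α ∊ γ0 → Sb (B α) α)
    (hn : ∀ α β, Lim α → Lim β → α ∊ β → β ∊ γ → ¬ α ∊ γ0 → L α = L β → bI (B β) α = B α → False) :
    ∃ s, Bad γ s := by
  obtain ⟨L', hL'⟩ : ∃ L' : M → M, L' = fun α => cond (α ∊ γ0) emp (sc (L α)) := ⟨_, rfl⟩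
  obtain ⟨B', hB'⟩ : ∃ B' : M → M, B' = fun α => cond (α ∊ γ0) (sec s0 α) (B α) := ⟨_, rfl⟩
  have fL' : F1 𝕋 L' := ⟨by rw [hL']; infer_instance⟩
  have fB' : F1 𝕋 B' := ⟨by rw [hB']; infer_instance⟩
  have l1 : ∀ α, Lim α → α ∊ γ → L' α ∊ α := by
    intro α h h'
    rw [hL']; beta_reduce
    by_cases hh : α ∊ γ0
    · rw [cond_pos hh]; exact h.emp_mem
    · rw [cond_neg hh]; exact h.2.2 _ (hL α h h' hh)
  have b1 : ∀ α, Lim α → α ∊ γ → Sb (B' α) α := by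
    intro α h h'
    rw [hB']; beta_reduce
    by_cases hh : α ∊ γ0
    · rw [cond_pos hh]; exact sec_sub
    · rw [cond_neg hh]; exact hB α h h' hh
  refine ⟨iU (fun α => img (fun ξ => pr α ξ) (code (L' α) (B' α))) γ, ?_⟩
  have hs : ∀ α, Lim α → α ∊ γ →
      sec (iU (fun α => img (fun ξ => pr α ξ) (code (L' α) (B' α))) γ) α = code (L' α) (B' α) := by
    intro α h h'
    apply ext
    intro z
    rw [mem_sec, mem_iU]
    constructor
    · rintro ⟨hz, β, hβ, h2⟩
      rw [mem_img] at h2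
      obtain ⟨x, hx, h2⟩ := h2
      obtain ⟨rfl, rfl⟩ := pr_inj.1 h2
      exact hx
    · intro hz
      exact ⟨code_sub h (l1 α h h') (b1 α h h') _ hz, α, h', mem_img.2 ⟨z, hz, rfl⟩⟩
  intro α β ha hb hab hbg heq
  have hag := hγ.trans hab hbg
  rw [hs β hb hbg, hs α ha hag] at heq
  obtain ⟨e1, e2⟩ := code_coh (l := L' β) (B := B' β) ha (hb.1.mem (l1 β hb hbg)) (ha.1.mem (l1 α ha hag))
    (fun x hx => hb.1.mem (b1 β hb hbg x hx)) (b1 α ha hag)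
    (fun z => by rw [← heq, mem_bI])
  rw [hL'] at e1
  rw [hB'] at e2
  by_cases h1 : β ∊ γ0
  · have h2 := hγ0.trans hab h1
    simp only [cond_pos h1, cond_pos h2] at e2
    exact h0 α β ha hb hab h1 e2
  · by_cases h2 : α ∊ γ0
    · simp only [cond_pos h2, cond_neg h1] at e1
      exact sc_ne_emp _ e1.symm
    · simp only [cond_neg h2, cond_neg h1] at e1 e2
      exact hn α β ha hb hab hbg h2 (sc_inj e1) e2

end
end Paper

namespace Paper

/-! ## Part 10: regular closed levels are set models -/

section
variable {M : Type} [ZF M]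

/-- Regularity with respect to definable functions. -/
def RegD (γ : M) : Prop := ∀ l, l ∊ γ → ∀ h : M → M, F1 𝕋 h → (∀ i, i ∊ l → h i ∊ γ) →
  ∃ δ, δ ∊ γ ∧ ∀ i, i ∊ l → ¬ δ ∊ h i

/-- The set `f` is a cofinal function from `l` to `γ`. -/
def Cof (γ l f : M) : Prop :=
  (∀ i, i ∊ l → ∃ y, y ∊ γ ∧ pr i y ∊ f) ∧ (∀ p, p ∊ f → ∃ i, i ∊ l ∧ ∃ y, y ∊ γ ∧ p = pr i y) ∧
  (∀ i y y', pr i y ∊ f → pr i y' ∊ f → y = y') ∧ ∀ δ, δ ∊ γ → ∃ i y, pr i y ∊ f ∧ δ ∊ y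
instance {S : DS (ZF.E (M := M))} : D3 S (Cof (M := M)) := ⟨by unfold Cof; infer_instance⟩

theorem regD_of_not_cof {γ : M} (h : ∀ l f, l ∊ γ → ¬ Cof γ l f) : RegD γ := by
  intro l hl g hg hgγ
  by_contra hc
  push Not at hc
  refine h l (gr g l) hl ⟨?_, ?_, ?_, ?_⟩
  · intro i hi; exact ⟨g i, hgγ i hi, mem_gr.2 ⟨i, hi, rfl⟩⟩
  · intro p hp
    obtain ⟨i, hi, rfl⟩ := mem_gr.1 hp
    exact ⟨i, hi, g i, hgγ i hi, rfl⟩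
  · intro i y y' h1 h2
    obtain ⟨j, _, h1⟩ := mem_gr.1 h1
    obtain ⟨j', _, h2⟩ := mem_gr.1 h2
    rw [pr_inj] at h1 h2
    rw [h1.2, h2.2, ← h1.1, ← h2.1]
  · intro δ hδ
    obtain ⟨i, hi, h⟩ := hc δ hδ
    exact ⟨i, g i, mem_gr.2 ⟨i, hi, rfl⟩, h⟩

variable {e ix : M → M}

theorem axB_V (H : En e ix) {γ : M} (hγ : Lim γ) (ho : om ∊ γ) : AxB ZF.E (Vh γ) := by
  have oγ := hγ.1
  refine ⟨V_trans oγ, ?_, ?_, ?_, ?_, ?_⟩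
  · intro a ha b hb
    exact ⟨up a b, V_up hγ ha hb, fun z _ => by rw [mem_up]⟩
  · intro a ha
    refine ⟨sU a, V_sU oγ ha, fun z _ => ?_⟩
    rw [mem_sU]
    exact ⟨fun ⟨y, h1, h2⟩ => ⟨y, V_trans oγ a ha y h1, h1, h2⟩, fun ⟨y, _, h1, h2⟩ => ⟨y, h1, h2⟩⟩
  · intro a ha
    refine ⟨pw a, V_pw hγ ha, fun z hz => ?_⟩
    rw [mem_pw]
    exact ⟨fun h w _ hw => h w hw, fun h w hw => h w (V_trans oγ z hz w hw) hw⟩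
  · have hsub : ∀ x, x ∊ om → x ∊ Vh γ := fun x hx =>
      V_trans oγ om ((ord_mem_V oγ lim_om.1).2 ho) x hx
    refine ⟨om, (ord_mem_V oγ lim_om.1).2 ho, ⟨emp, hsub _ lim_om.emp_mem, lim_om.emp_mem,
      fun z _ => not_mem_emp z⟩, fun y _ hy => ⟨sc y, hsub _ (lim_om.2.2 y hy), lim_om.2.2 y hy,
      fun z _ => mem_sc⟩⟩
  · intro a ha h1 h2
    have := H.fi
    obtain ⟨c, hc⟩ := ac_of_idx ix H.od (fun x y => H.inj) a
      (fun x hx => (h1 x (V_trans oγ a ha x hx) hx).imp fun z h => h.2)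
      (fun x y hx hy hne => by
        have := h2 x (V_trans oγ a ha x hx) y (V_trans oγ a ha y hy) hx hy hne
        rintro ⟨z, hz1, hz2⟩
        exact this ⟨z, V_trans oγ x (V_trans oγ a ha x hx) z hz1, hz1, hz2⟩)
    refine ⟨bI c (sU a), V_down oγ (V_sU oγ ha) (fun z hz => (mem_bI.1 hz).2), ?_⟩
    intro x hx hxa
    obtain ⟨z, z1, z2, z3⟩ := hc x hxa
    refine ⟨z, V_trans oγ x hx z z2, mem_bI.2 ⟨z1, mem_sU.2 ⟨x, hxa, z2⟩⟩, z2, ?_⟩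
    intro z' _ h3 h4
    exact z3 z' (mem_bI.1 h3).1 h4

theorem cl_V {V : M} (hV : ∀ x y : M, x ∊ V → y ∊ V → pr x y ∊ V) :
    Cl ZF.E V (fun x => x ∊ pw V) := by
  have hs : ∀ (P : M → Prop) [Q1 𝕋 P], sep V P ∊ pw V := fun P _ =>
    mem_pw.2 fun z hz => (mem_sep.1 hz).1
  simp only [Cl, pm_iff, isPr_iff]
  refine ⟨⟨emp, mem_pw.2 fun z hz => by simp at hz, fun t _ => not_mem_emp t⟩, ?_, ?_, ?_, ?_, ?_, ?_⟩
  · intro R _ R' _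
    refine ⟨_, hs (fun t => t ∊ R → t ∊ R'), fun t ht => ?_⟩
    rw [mem_sep, and_iff_right ht]
  · intro R _
    refine ⟨_, hs (fun t => ∀ a, a ∊ V → pr t a ∊ R), fun t ht => ?_⟩
    rw [mem_sep, and_iff_right ht]
  · refine ⟨_, hs (fun t => ∃ s a, t = pr (pr s a) a), ?_⟩
    rintro p hp s hs a ha rfl b hb
    rw [mem_sep, and_iff_right (hV _ _ hp hb)]
    constructor
    · rintro ⟨s', a', h⟩
      rw [pr_inj, pr_inj] at h
      rw [h.2, h.1.2]
    · rintro rfl; exact ⟨s, b, rfl⟩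
  · intro Q _
    refine ⟨_, hs (fun t => ∃ s a b, t = pr (pr s a) b ∧ pr s b ∊ Q), ?_⟩
    rintro p hp s hs a ha rfl b hb
    rw [mem_sep, and_iff_right (hV _ _ hp hb)]
    constructor
    · rintro ⟨s', a', b', h, h'⟩
      rw [pr_inj, pr_inj] at h
      rwa [h.2, h.1.1]
    · intro h; exact ⟨s, a, b, rfl, h⟩
  · intro Q _ Q' _
    refine ⟨_, hs (fun t => ∃ x, x ∊ V ∧ ∃ y, y ∊ V ∧ pr t x ∊ Q ∧ pr t y ∊ Q' ∧ x ∊ y), fun t ht => ?_⟩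
    rw [mem_sep, and_iff_right ht]
  · intro Q _ Q' _
    refine ⟨_, hs (fun t => ∃ x, x ∊ V ∧ ∃ y, y ∊ V ∧ pr t x ∊ Q ∧ pr t y ∊ Q' ∧ x = y), fun t ht => ?_⟩
    rw [mem_sep, and_iff_right ht]

theorem srd_V (H : En e ix) {γ : M} (hγ : Lim γ) (hr : RegD γ)
    (ht : ∀ ν, ν ∊ γ → tau ix ν ∊ γ) : SRD ZF.E (Vh γ) (pw (Vh γ)) := by
  have oγ := hγ.1
  have hfe := H.fe
  simp only [SRD, pm_iff, isPr_iff]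
  constructor
  · intro R _ t _ a ha
    refine ⟨sep a (fun z => pr t z ∊ R), V_down oγ ha fun z hz => (mem_sep.1 hz).1, fun z _ => ?_⟩
    rw [mem_sep]
  · intro R hR t htm a ha hfun
    have hav : rk a ∊ γ := (mem_V_iff oγ).1 ha
    have emV : emp ∊ Vh γ := (ord_mem_V oγ od_emp).2 hγ.emp_mem
    have hu : ∀ x y y', x ∊ a → (y ∊ Vh γ ∧ pr (pr t x) y ∊ R) → (y' ∊ Vh γ ∧ pr (pr t x) y' ∊ R) →
        y = y' := fun x y y' hx h h' =>
      hfun x (V_trans oγ a ha x hx) hx y h.1 y' h'.1 _ (V_pr hγ htm (V_trans oγ a ha x hx)) rfl h.2 h'.2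
    obtain ⟨k, hk⟩ : ∃ k : M → M, k = fun i => the (fun y => y ∊ Vh γ ∧ pr (pr t (e i)) y ∊ R) :=
      ⟨_, rfl⟩
    have fk : F1 𝕋 k := ⟨by rw [hk]; infer_instance⟩
    have kV : ∀ i, k i ∊ Vh γ := by
      intro i
      rw [hk]; beta_reduce
      by_cases h : ∃! y, y ∊ Vh γ ∧ pr (pr t (e i)) y ∊ R
      · exact (the_spec h).1
      · rw [the_junk h]; exact emV
    obtain ⟨δ, hδ, hb⟩ := hr _ (ht _ hav) (fun i => rk (k i)) ⟨inferInstance⟩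
      (fun i _ => (mem_V_iff oγ).1 (kV i))
    refine ⟨sep (Vh γ) (fun y => ∃ x, x ∊ a ∧ pr (pr t x) y ∊ R), ?_, ?_⟩
    · rw [mem_V oγ]
      refine ⟨sc δ, hγ.2.2 _ hδ, fun y hy => ?_⟩
      obtain ⟨hy, x, hx, hxy⟩ := mem_sep.1 hy
      have oδ := oγ.mem hδ
      rw [mem_V_iff (od_sc oδ), mem_sc_iff oδ (od_rk _)]
      have h1 : ix x ∊ tau ix (rk a) := H.ix_tau.2 (sub_V_rk a x hx)
      have h2 := hb _ h1
      have h3 : k (ix x) = y := by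
        rw [hk]; beta_reduce; rw [H.ei]
        exact the_eq ⟨hy, hxy⟩ fun z hz => hu x z y hx hz ⟨hy, hxy⟩
      rw [h3] at h2
      exact (not_mem_iff oδ (od_rk _)).1 h2
    · intro y hy
      rw [mem_sep, and_iff_right hy]
      constructor
      · rintro ⟨x, hx, h⟩
        exact ⟨x, V_trans oγ a ha x hx, hx, _, V_pr hγ htm (V_trans oγ a ha x hx), rfl, h⟩
      · rintro ⟨x, _, hx, p, _, rfl, h⟩
        exact ⟨x, hx, h⟩

theorem ppV (H : En e ix) {γ : M} (hγ : Lim γ) (ho : om ∊ γ) (hr : RegD γ)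
    (ht : ∀ ν, ν ∊ γ → tau ix ν ∊ γ) (φ : SetFormula 0) (hφ : Rel ZF.E (fun x => x ∊ Vh γ) φ ![]) :
    PP ZF.E φ (Vh γ) :=
  ⟨axB_V H hγ ho, hφ, pw (Vh γ), cl_V (fun _ _ hx hy => V_pr hγ hx hy), srd_V H hγ hr ht⟩

theorem zfcV (H : En e ix) {γ : M} (hγ : Lim γ) (ho : om ∊ γ) (hr : RegD γ)
    (ht : ∀ ν, ν ∊ γ → tau ix ν ∊ γ) : IsZFCE (sE ZF.E (fun x : M => x ∊ Vh γ)) :=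
  sub_ZFC (axB_V H hγ ho) (cl_V (fun _ _ hx hy => V_pr hγ hx hy)) (srd_V H hγ hr ht)

end
end Paper

namespace Paper

/-! ## Part 11: every ordinal is bad when there are no set models -/

section
variable {M : Type} [ZF M]

theorem od_absA {M : Type} {E : M → M → Prop} {A : M → Prop} (hA : ∀ x, A x → ∀ y, E y x → A y)
    (x : {x : M // A x}) : OrdE (sE E A) x ↔ OrdE E x.1 := by
  have ht : ∀ x : {x : M // A x}, TransE (sE E A) x ↔ TransE E x.1 := by
    intro x
    unfold TransE
    rw [ball_abs hA]
    refine forall_congr' fun y => imp_congr Iff.rfl ?_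
    rw [ball_abs hA]
  unfold OrdE
  rw [ht, ball_abs hA]
  simp only [ht, sE]

theorem relCons {V : M} {k : ℕ} (φ : SetFormula (k + 2)) (p : Fin k → M) :
    D2 𝕋 (fun z w => Rel ZF.E (fun x => x ∊ V) φ (Fin.cons z (Fin.cons w p))) := ⟨by
  have h0 : Dfn 𝕋 (fun w : Fin (k + 2) → M => Rel ZF.E (fun x => x ∊ V) φ w) := by
    have := relDfn 𝕋 (k := 0) (fun _ (x : M) => x ∊ V) inferInstance φ
    have h2 := this.reindex (m := k + 2) (fun i => i.cast (by omega))
    refine h2.congr fun v => ?_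
    have : (fun i => v (Fin.cast (by omega) (Fin.natAdd 0 i))) = v := by
      funext i; congr 1; ext; simp
    rw [this]
  refine Dfn.comp (m := 2) (fun v => Rel ZF.E (fun x => x ∊ V) φ v) h0
    (fun i v => (Fin.cons (v 0) (Fin.cons (v 1) p : Fin (k + 1) → M) : Fin (k + 2) → M) i) ?_
  intro i
  refine Fin.cases ?_ (fun j => ?_) i
  · simp only [Fin.cons_zero]; infer_instance
  · simp only [Fin.cons_succ]
    refine Fin.cases ?_ (fun j => ?_) j
    · simp only [Fin.cons_zero]; infer_instance
    · simp only [Fin.cons_succ]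
      infer_instance⟩

variable {e ix : M → M}

/-- The first bad set for `γ`. -/
noncomputable def sBad (e : M → M) (γ : M) : M := e (lst (fun α => Bad γ (e α)))
theorem sBadF {S : DS (ZF.E (M := M))} (e : M → M) [F1 S e] : F1 S (sBad e) :=
  ⟨by unfold sBad; infer_instance⟩

theorem En.sBad (H : En e ix) {γ : M} (h : ∃ s, Bad γ s) : Bad γ (sBad e γ) := by
  obtain ⟨s, hs⟩ := h
  have := H.fe
  unfold Paper.sBad
  exact (lst_spec (P := fun α => Bad γ (e α)) ⟨ix s, H.od s, by rwa [H.ei]⟩).2.1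

theorem a3_succ {δ : M} (hδ : Od δ) (h : ∃ s, Bad δ s) : ∃ s, Bad (sc δ) s := by
  obtain ⟨s0, h0⟩ := h
  refine lemmaX (od_sc hδ) hδ h0 (fun _ => emp) (fun _ => emp) (fL := ⟨inferInstance⟩)
    (fB := ⟨inferInstance⟩) (fun α h _ _ => h.emp_mem) (fun α _ _ _ z hz => by simp at hz) ?_
  intro α β _ _ hab hb hna _ _
  rcases mem_sc.1 hb with h | h
  · exact hna (hδ.trans hab h)
  · exact hna (h ▸ hab)

theorem a3_reg (H : En e ix) {γ : M} (hγ : Lim γ) (ih : ∀ δ, δ ∊ γ → ∃ s, Bad δ s)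
    (hc : ¬ ∃ s, Bad γ s) : RegD γ := by
  intro l hl h fh hh
  by_contra hcon
  push Not at hcon
  have fe := H.fe
  have fs := sBadF (S := 𝕋) e
  apply hc
  obtain ⟨s0, h0⟩ := ih _ (hγ.2.2 _ hl)
  have ol := hγ.1.mem hl
  obtain ⟨L, hL⟩ : ∃ L : M → M, L = fun α => lst (fun i => i ∊ l ∧ α ∊ h i) := ⟨_, rfl⟩
  have fL : F1 𝕋 L := ⟨by rw [hL]; infer_instance⟩
  have sL : ∀ α, α ∊ γ → L α ∊ l ∧ α ∊ h (L α) := by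
    intro α ha
    obtain ⟨i, hi, h1⟩ := hcon α ha
    rw [hL]; beta_reduce
    exact (lst_spec (P := fun i => i ∊ l ∧ α ∊ h i) ⟨i, ol.mem hi, hi, h1⟩).2.1
  refine lemmaX hγ.1 (od_sc ol) h0 L (fun α => sec (sBad e (h (L α))) α)
    (fB := ⟨inferInstance⟩) ?_ (fun _ _ _ _ => sec_sub) ?_
  · intro α ha hag hn
    have h1 := (not_mem_iff ha.1 (od_sc ol)).1 hn
    exact ha.1.trans (sL α hag).1 (h1 l (by simp))
  · intro α β ha hb hab hbg hn he hs
    rw [he] at hs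
    exact H.sBad (ih _ (hh _ (sL β hbg).1)) α β ha hb hab (sL β hbg).2 hs

theorem a3_tau (H : En e ix) {γ : M} (hγ : Lim γ) (ih : ∀ δ, δ ∊ γ → ∃ s, Bad δ s)
    (hc : ¬ ∃ s, Bad γ s) (hr : RegD γ) : ∀ ν, ν ∊ γ → tau ix ν ∊ γ := by
  have fe := H.fe
  have fi := H.fi
  have ft := tauF (S := 𝕋) ix
  suffices h : ∀ ν, Od ν → ν ∊ γ → tau ix ν ∊ γ from fun ν h1 => h ν (hγ.1.mem h1) h1
  apply ord_ind (fun ν => ν ∊ γ → tau ix ν ∊ γ)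
  intro ν hν ihν hνγ
  rcases zero_succ_lim hν with rfl | ⟨ρ, hρ, rfl⟩ | hlim
  · have : tau ix emp = emp := by
      rw [eq_emp_iff]; intro z hz
      rw [H.mem_tau (H.tau_od hz), mem_V hν] at hz
      obtain ⟨β, h, -⟩ := hz
      simp at h
    rw [this]; exact hγ.emp_mem
  · by_contra hcon
    have h1 : tau ix ρ ∊ γ := ihν ρ (by simp) (hγ.1.trans (by simp) hνγ)
    have o1 := H.od_tau hρ
    have h2 := (not_mem_iff (H.od_tau hν) hγ.1).1 hcon
    obtain ⟨s0, h0⟩ := ih _ (hγ.2.2 _ h1)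
    have hsub : ∀ α x, α ∊ γ → x ∊ img ix (e α) → x ∊ tau ix ρ := by
      intro α x ha hx
      obtain ⟨y, hy, rfl⟩ := mem_img.1 hx
      rw [H.ix_tau]
      have := (H.mem_tau (hγ.1.mem ha)).1 (h2 α ha)
      rw [V_sc hρ] at this
      exact this y hy
    have hle : ∀ α, Lim α → ¬ α ∊ sc (tau ix ρ) → Sb (tau ix ρ) α := fun α ha hn =>
      ha.1.sub ((not_mem_iff ha.1 (od_sc o1)).1 hn _ (by simp))
    apply hc
    refine lemmaX hγ.1 (od_sc o1) h0 (fun _ => emp) (fun α => img ix (e α)) (fL := ⟨inferInstance⟩)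
      (fB := ⟨inferInstance⟩) (fun α h _ _ => h.emp_mem) ?_ ?_
    · intro α ha hag hn x hx
      exact hle α ha hn x (hsub α x hag hx)
    · intro α β ha hb hab hbg hn _ he
      have h3 : img ix (e β) = img ix (e α) := by
        rw [← he]; apply ext; intro z; rw [mem_bI]
        exact ⟨fun h => ⟨h, hle α ha hn _ (hsub β z hbg h)⟩, fun h => h.1⟩
      have h4 : e β = e α := by
        apply ext; intro z
        have hz : ∀ γ, z ∊ e γ ↔ ix z ∊ img ix (e γ) := by
          intro γ; rw [mem_img]
          constructor
          · intro h; exact ⟨z, h, rfl⟩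
          · rintro ⟨x, hx, h⟩; rwa [H.inj h]
        rw [hz, hz, h3]
      have h5 : β = α := by rw [← H.ie β hb.1, h4, H.ie α ha.1]
      rw [h5] at hab; exact mem_irrefl _ hab
  · obtain ⟨δ, hδ, h1⟩ := hr ν hνγ (tau ix) inferInstance (fun η hη => ihν η hη (hγ.1.trans hη hνγ))
    refine mem_of_sub_mem (H.od_tau hν) hγ.1 ?_ hδ
    intro z hz
    have oz := H.tau_od hz
    rw [H.mem_tau oz, mem_V_iff hν] at hz
    have h2 : z ∊ tau ix (sc (rk (e z))) := by
      rw [H.mem_tau oz, mem_V_iff (od_sc (od_rk _))]; simp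
    have h3 := hlim.2.2 _ hz
    exact (not_mem_iff (hγ.1.mem hδ) (H.od_tau (hν.mem h3))).1 (h1 _ h3) z h2

theorem a3_faint (H : En e ix) {γ : M} (hγ : Lim γ) (ih : ∀ δ, δ ∊ γ → ∃ s, Bad δ s)
    (hc : ¬ ∃ s, Bad γ s) : OrdFaintDefE (sE ZF.E (fun x : M => x ∊ Vh γ)) := by
  intro k φ p hfam ξ hξ
  have fe := H.fe
  have oγ := hγ.1
  have hA : ∀ x : M, x ∊ Vh γ → ∀ y, y ∊ x → y ∊ Vh γ := V_trans oγ
  by_contra hcon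
  apply hc
  obtain ⟨Q, hQ⟩ : ∃ Q : M → M → Prop, ∀ x y, Q x y ↔ Rel ZF.E (fun x => x ∊ Vh γ) φ
    (Fin.cons x (Fin.cons y (fun i => (p i).1))) := ⟨_, fun _ _ => Iff.rfl⟩
  have dQ : D2 𝕋 Q := ⟨(relCons (V := Vh γ) φ (fun i => (p i).1)).out.congr fun v => hQ _ _⟩
  have hR : ∀ x y : {x : M // x ∊ Vh γ}, Realize (sE ZF.E (fun x : M => x ∊ Vh γ)) φ
      (Fin.cons x (Fin.cons y p)) ↔ Q x.1 y.1 := by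
    intro x y
    rw [hQ, rel_sub]
    have : (fun i => ((Fin.cons x (Fin.cons y p : Fin (k+1) → {x : M // x ∊ Vh γ}) :
        Fin (k+2) → {x : M // x ∊ Vh γ}) i).1) =
        (Fin.cons x.1 (Fin.cons y.1 (fun i => (p i).1) : Fin (k+1) → M) : Fin (k+2) → M) := by
      funext i
      refine Fin.cases ?_ (fun j => ?_) i
      · simp
      · refine Fin.cases ?_ (fun j => ?_) j <;> simp
    rw [this]
  simp only [hR] at hfam hcon
  obtain ⟨B, hB⟩ : ∃ B : M → M, B = fun α => e (lst (fun ρ => e ρ ∊ Vh γ ∧ Q α (e ρ))) := ⟨_, rfl⟩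
  have fB : F1 𝕋 B := ⟨by rw [hB]; infer_instance⟩
  have oξ : Od ξ.1 := (od_absA hA ξ).1 hξ
  have hξγ : ξ.1 ∊ γ := (ord_mem_V oγ oξ).1 ξ.2
  have sB : ∀ α, α ∊ γ → B α ∊ Vh γ ∧ Q α (B α) := by
    intro α ha
    have oa := oγ.mem ha
    have va := (ord_mem_V oγ oa).2 ha
    obtain ⟨A, h1⟩ := (hfam ⟨α, va⟩ ((od_absA hA ⟨α, va⟩).2 oa)).1
    rw [hB]; beta_reduce
    exact (lst_spec (P := fun ρ => e ρ ∊ Vh γ ∧ Q α (e ρ)) ⟨ix A.1, H.od _, by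
      rw [H.ei]; exact ⟨A.2, h1⟩⟩).2.1
  obtain ⟨s0, h0⟩ := ih _ (hγ.2.2 _ hξγ)
  refine lemmaX hγ.1 (od_sc oξ) h0 (fun _ => emp) B (fL := ⟨inferInstance⟩)
      (fun α h _ _ => h.emp_mem) ?_ ?_
  · intro α ha hag _ x hx
    have va := (ord_mem_V oγ ha.1).2 hag
    have h1 := (hfam ⟨α, va⟩ ((od_absA hA ⟨α, va⟩).2 ha.1)).2 ⟨B α, (sB α hag).1⟩ (sB α hag).2
    exact h1 ⟨x, hA _ (sB α hag).1 x hx⟩ hx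
  · intro α β ha hb hab hbg hn _ he
    have hag := oγ.trans hab hbg
    have va := (ord_mem_V oγ ha.1).2 hag
    have vb := (ord_mem_V oγ hb.1).2 hbg
    refine hcon ⟨⟨α, va⟩, ⟨β, vb⟩, ⟨B β, (sB β hbg).1⟩, ⟨B α, (sB α hag).1⟩,
      (od_absA hA ⟨α, va⟩).2 ha.1, (od_absA hA ⟨β, vb⟩).2 hb.1, ?_, hab, (sB β hbg).2, ?_, (sB α hag).2⟩
    · exact (not_mem_iff ha.1 (od_sc oξ)).1 hn _ (by simp)
    · intro z
      show z.1 ∊ B α ↔ z.1 ∊ B β ∧ z.1 ∊ α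
      rw [← he, mem_bI]

theorem a3 (H : En e ix) (φ : SetFormula 0)
    (h1 : ∀ (M : Type) (E : M → M → Prop), IsZFCE E → OrdFaintDefE E → Realize E φ ![])
    (hno : ∀ m : M, ¬ PP ZF.E φ m) : ∀ γ : M, Od γ → ∃ s, Bad γ s := by
  apply ord_ind (fun γ => ∃ s, Bad γ s)
  intro γ oγ ih
  by_contra hc
  have hγ : Lim γ := by
    rcases zero_succ_lim oγ with rfl | ⟨δ, hδ, rfl⟩ | h
    · exact (hc ⟨emp, fun α β _ _ _ h => by simp at h⟩).elim
    · exact (hc (a3_succ hδ (ih δ (by simp)))).elim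
    · exact h
  have ho : om ∊ γ := by
    rcases (sub_iff lim_om.1 oγ).1 (om_le hγ) with h | h
    · exact h
    · exact (hc ⟨emp, fun α β _ hb _ h' => (not_lim_of_mem_om (h ▸ h') hb).elim⟩).elim
  have hr := a3_reg H hγ ih hc
  have ht := a3_tau H hγ ih hc hr
  have hφ := h1 _ _ (zfcV H hγ ho hr ht) (a3_faint H hγ ih hc)
  have hφ2 := (rel_sub ZF.E (fun x : M => x ∊ Vh γ) φ ![]).1 hφ
  have e0 : (fun i => ((![] : Fin 0 → {x : M // x ∊ Vh γ}) i).1) = ![] := by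
    funext i; exact i.elim0
  rw [e0] at hφ2
  exact hno _ (ppV H hγ ho hr ht φ hφ2)

end
end Paper

namespace Paper

/-! ## Part 12: a faint universe has a set model -/

section
variable {M : Type} [ZF M] {e ix : M → M}

/-- Closure of `α` under `g`. -/
def ClO (g : M → M) (α : M) : Prop := ∀ η, η ∊ α → g η ∊ α
theorem clOD {S : DS (ZF.E (M := M))} (g : M → M) [F1 S g] : D1 S (ClO g) :=
  ⟨by unfold ClO; infer_instance⟩
/-- Least failure of closure. -/
noncomputable def lab (g : M → M) (α : M) : M := lst (fun η => η ∊ α ∧ ¬ g η ∊ α)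
theorem labF {S : DS (ZF.E (M := M))} (g : M → M) [F1 S g] : F1 S (lab g) :=
  ⟨by unfold lab; infer_instance⟩

theorem lab_spec (g : M → M) [F1 𝕋 g] {α : M} (hα : Od α) (h : ¬ ClO g α) :
    lab g α ∊ α ∧ ¬ g (lab g α) ∊ α := by
  unfold ClO at h
  push Not at h
  obtain ⟨η, h1, h2⟩ := h
  exact (lst_spec (P := fun η => η ∊ α ∧ ¬ g η ∊ α) ⟨η, hα.mem h1, h1, h2⟩).2.1

/-- The limit part of the family, below a failure of closure. -/
def Fn (e g : M → M) (α A : M) : Prop :=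
  Lim α ∧ ¬ ClO g α ∧ A = code (dd (lab g α)) (sec (sBad e (sc (g (lab g α)))) α)
/-- The limit part of the family, at closed points. -/
def Fc (ix g : M → M) (α A : M) : Prop :=
  Lim α ∧ ClO g α ∧ ∃ l f, l ∊ α ∧ Cof α l f ∧ A = code (sc (dd l)) (img ix f)
/-- The family. -/
def Ef (e ix g : M → M) (α A : M) : Prop :=
  (¬ om ∊ α ∧ A = emp) ∨ (om ∊ α ∧ ((∃ η, α = sc η ∧ A = up η η) ∨ Fn e g α A ∨ Fc ix g α A))

theorem efD (g : M → M) [fe : F1 𝕋 e] [fi : F1 𝕋 ix] [fg : F1 𝕋 g] : D2 𝕋 (Ef e ix g) := by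
  have := clOD (S := 𝕋) g
  have := labF (S := 𝕋) g
  have := sBadF (S := 𝕋) e
  have : D2 𝕋 (Fn e g) := ⟨by unfold Fn; infer_instance⟩
  have : D2 𝕋 (Fc ix g) := ⟨by unfold Fc; infer_instance⟩
  exact ⟨by unfold Ef; infer_instance⟩

theorem fn_sub {g : M → M} [F1 𝕋 g] {α A : M} (h : Fn e g α A) : Sb A α := by
  obtain ⟨h1, h2, rfl⟩ := h
  have h3 := (lab_spec g h1.1 h2).1
  exact code_sub h1 (dd_mem _ (h1.1.mem h3) α h1 h3) sec_sub

theorem En.img_sub (H : En e ix) {g : M → M} (hg : ∀ η, Od η → Od (g η) ∧ Sb (tau ix η) (g η))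
    {α l f : M} (h1 : Lim α) (h2 : ClO g α) (hl : l ∊ α) (hf : Cof α l f) : Sb (img ix f) α := by
  have := H.fi
  intro z hz
  obtain ⟨x, hx, rfl⟩ := mem_img.1 hz
  obtain ⟨i, hi, y, hy, rfl⟩ := hf.2.1 x hx
  have h3 : pr i y ∊ Vh α := V_pr h1 ((ord_mem_V h1.1 (h1.1.mem (h1.1.trans hi hl))).2 (h1.1.trans hi hl))
    ((ord_mem_V h1.1 (h1.1.mem hy)).2 hy)
  rw [mem_V_iff h1.1] at h3
  have h4 := h1.2.2 _ h3
  have o4 := h1.1.mem h4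
  have h5 : ix (pr i y) ∊ tau ix (sc (rk (pr i y))) := by
    rw [H.ix_tau, mem_V_iff o4]; simp
  exact h1.1.trans ((hg _ o4).2 _ h5) (h2 _ h4)

theorem fc_sub (H : En e ix) {g : M → M} (hg : ∀ η, Od η → Od (g η) ∧ Sb (tau ix η) (g η))
    {α A : M} (h : Fc ix g α A) : Sb A α := by
  obtain ⟨h1, h2, l, f, h3, h4, rfl⟩ := h
  exact code_sub h1 (h1.2.2 _ (dd_mem _ (h1.1.mem h3) α h1 h3)) (H.img_sub hg h1 h2 h3 h4)

theorem emp_code {l B : M} : emp ∊ code l B := mem_code.2 (Or.inl rfl)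

theorem not_om_sc_emp : ¬ om ∊ sc (emp : M) := by
  intro h
  rcases mem_sc.1 h with h | h
  · simp at h
  · have := (lim_om (M := M)).emp_mem; rw [h] at this; simp at this

theorem a4 (H : En e ix) (hF : Faint M) (φ : SetFormula 0) (hφ : Realize (ZF.E (M := M)) φ ![])
    (hbad : ∀ γ : M, Od γ → ∃ s, Bad γ s) : ∃ m : M, PP ZF.E φ m := by
  by_contra hno
  push Not at hno
  have fe := H.fe
  have fi := H.fi
  have ft := tauF (S := 𝕋) ix
  obtain ⟨g0, f0, o0, r0⟩ := reflect (M := M) φ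
  obtain ⟨g, hgd⟩ : ∃ g : M → M, g = fun η => bU (g0 η) (tau ix η) := ⟨_, rfl⟩
  have fg : F1 𝕋 g := ⟨by rw [hgd]; infer_instance⟩
  have hg : ∀ η, Od η → Od (g η) ∧ Sb (tau ix η) (g η) := by
    intro η hη; rw [hgd]
    exact ⟨od_bU (o0 η hη) (H.od_tau hη), fun z hz => mem_bU.2 (Or.inr hz)⟩
  have hg0 : ∀ η, Od η → Sb (g0 η) (g η) := by
    intro η hη; rw [hgd]
    exact fun z hz => mem_bU.2 (Or.inl hz)
  have dE := efD (e := e) (ix := ix) g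
  have hcof : ∀ α, om ∊ α → Lim α → ClO g α → ∃ l f, l ∊ α ∧ Cof α l f := by
    intro α ho hα hcl
    by_contra hc
    push Not at hc
    have hr := regD_of_not_cof hc
    have oα := hα.1
    have ht : ∀ ν, ν ∊ α → tau ix ν ∊ α := fun ν hν =>
      mem_of_sub_mem (H.od_tau (oα.mem hν)) oα (hg ν (oα.mem hν)).2 (hcl ν hν)
    have h0 : ∀ ν, ν ∊ α → g0 ν ∊ α := fun ν hν =>
      mem_of_sub_mem (o0 _ (oα.mem hν)) oα (hg0 ν (oα.mem hν)) (hcl ν hν)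
    exact hno _ (ppV H hα ho hr ht φ ((r0 α hα h0 ![] (fun i => i.elim0)).1 hφ))
  obtain ⟨α, β, A, B, oα, oβ, hα, hαβ, hA, hAB, hB⟩ := hF (Ef e ix g) dE (by
    intro α oα
    constructor
    · by_cases ho : om ∊ α
      · rcases zero_succ_lim oα with rfl | ⟨η, _, h⟩ | h
        · simp at ho
        · exact ⟨_, Or.inr ⟨ho, Or.inl ⟨η, h, rfl⟩⟩⟩
        · by_cases hcl : ClO g α
          · obtain ⟨l, f, h1, h2⟩ := hcof α ho h hcl
            exact ⟨_, Or.inr ⟨ho, Or.inr (Or.inr ⟨h, hcl, l, f, h1, h2, rfl⟩)⟩⟩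
          · exact ⟨_, Or.inr ⟨ho, Or.inr (Or.inl ⟨h, hcl, rfl⟩)⟩⟩
      · exact ⟨emp, Or.inl ⟨ho, rfl⟩⟩
    · rintro A (⟨_, rfl⟩ | ⟨_, ⟨η, rfl, rfl⟩ | h | h⟩)
      · intro z hz; exact (not_mem_emp z hz).elim
      · intro z hz
        have : z = η := by simpa using hz
        rw [this]; exact mem_sc.2 (Or.inr rfl)
      · exact fn_sub h
      · exact fc_sub H hg h) om lim_om.1
  have hAB : ∀ z, z ∊ B ↔ z ∊ A ∧ z ∊ α := hAB
  have oα : Od α := oα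
  have oβ : Od β := oβ
  have hβ : om ∊ β := Od.trans oβ hα hαβ
  have ea : emp ∊ α := emp_mem oα ⟨_, hα⟩
  -- unify the two limit cases
  have lim_emp : ∀ α A, Fn e g α A ∨ Fc ix g α A → emp ∊ A := by
    rintro α A (⟨_, _, rfl⟩ | ⟨_, _, l, f, _, _, rfl⟩) <;> exact emp_code
  rcases hA with ⟨h, _⟩ | ⟨_, hA⟩
  · exact h hβ
  rcases hB with ⟨h, _⟩ | ⟨_, hB⟩
  · exact h hα
  rcases hA with ⟨η', rfl, rfl⟩ | hA
  · rcases hB with ⟨η, rfl, rfl⟩ | hB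
    · have h1 : η = η' := by simpa using ((hAB η).1 (by simp)).1
      rw [h1] at hαβ; exact mem_irrefl _ hαβ
    · have h1 : emp = η' := by simpa using ((hAB emp).1 (lim_emp _ _ hB)).1
      rw [← h1] at hβ; exact not_om_sc_emp hβ
  · rcases hB with ⟨η, rfl, rfl⟩ | hB
    · have h1 : emp = η := by simpa using (hAB emp).2 ⟨lim_emp _ _ hA, ea⟩
      rw [← h1] at hα; exact not_om_sc_emp hα
    · rcases hA with ⟨b1, b2, rfl⟩ | ⟨b1, b2, l', f', b3, b4, rfl⟩
      · obtain ⟨b3, b4⟩ := lab_spec g b1.1 b2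
        have ob := b1.1.mem b3
        rcases hB with ⟨a1, a2, rfl⟩ | ⟨a1, a2, l, f, a3, a4, rfl⟩
        · obtain ⟨a3, a4⟩ := lab_spec g a1.1 a2
          have oa := a1.1.mem a3
          obtain ⟨e1, e2⟩ := code_coh a1 (od_dd _ ob) (od_dd _ oa)
            (fun x hx => b1.1.mem (sec_sub x hx)) sec_sub hAB
          have e3 := dd_inj oa ob e1
          rw [e3] at e2
          refine H.sBad (hbad _ (od_sc (hg _ ob).1)) α β a1 b1 hαβ ?_ e2
          exact (mem_sc_iff (hg _ ob).1 b1.1).2 ((not_mem_iff (hg _ ob).1 b1.1).1 b4)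
        · have oa := a1.1.mem a3
          obtain ⟨e1, e2⟩ := code_coh a1 (od_dd _ ob) (od_sc (od_dd _ oa))
            (fun x hx => b1.1.mem (sec_sub x hx)) (H.img_sub hg a1 a2 a3 a4) hAB
          exact dd_ne ob oa e1.symm
      · have ob := b1.1.mem b3
        have sb := H.img_sub hg b1 b2 b3 b4
        rcases hB with ⟨a1, a2, rfl⟩ | ⟨a1, a2, l, f, a3, a4, rfl⟩
        · obtain ⟨a3, a4⟩ := lab_spec g a1.1 a2
          have oa := a1.1.mem a3
          obtain ⟨e1, e2⟩ := code_coh a1 (od_sc (od_dd _ ob)) (od_dd _ oa)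
            (fun x hx => b1.1.mem (sb x hx)) sec_sub hAB
          exact dd_ne oa ob e1
        · have oa := a1.1.mem a3
          obtain ⟨e1, e2⟩ := code_coh a1 (od_sc (od_dd _ ob)) (od_sc (od_dd _ oa))
            (fun x hx => b1.1.mem (sb x hx)) (H.img_sub hg a1 a2 a3 a4) hAB
          have e3 := dd_inj oa ob (sc_inj e1)
          subst e3
          have hsub : ∀ x, x ∊ f → x ∊ f' := by
            intro x hx
            have h1 : ix x ∊ img ix f := mem_img.2 ⟨x, hx, rfl⟩
            rw [← e2, mem_bI, mem_img] at h1
            obtain ⟨⟨x', h2, h3⟩, _⟩ := h1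
            rwa [H.inj h3]
          obtain ⟨i, y, h1, h2⟩ := b4.2.2.2 α hαβ
          obtain ⟨i', hi, y', _, h3⟩ := b4.2.1 _ h1
          rw [pr_inj] at h3
          rw [← h3.1] at hi
          obtain ⟨z, hz, h4⟩ := a4.1 i hi
          have h5 := b4.2.2.1 i y z h1 (hsub _ h4)
          rw [h5] at h2
          exact mem_asymm h2 hz

theorem step2 (i0 : M → M) (h0 : F1 𝕋 i0) (ho : ∀ x, Od (i0 x)) (hi : ∀ x y, i0 x = i0 y → x = y)
    (hF : Faint M) (φ : SetFormula 0)
    (h1 : ∀ (M : Type) (E : M → M → Prop), IsZFCE E → OrdFaintDefE E → Realize E φ ![]) :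
    ∃ m : M, PP ZF.E φ m := by
  by_contra hno
  obtain ⟨e, ix, H⟩ := exists_En i0 h0 ho hi
  have hz : IsZFCE (ZF.E (M := M)) := isZFC_of (ac_of_idx i0 ho hi)
  exact hno (a4 H hF φ (h1 M _ hz (ordFaint_of hF)) (a3 H φ h1 (fun m hm => hno ⟨m, hm⟩)))

end

theorem step3 {M : Type} (E : M → M → Prop) (h : IsZFCE E) (hf : OrdFaintDefE E) (φ : SetFormula 0)
    (h1 : ∀ (M : Type) (E : M → M → Prop), IsZFCE E → OrdFaintDefE E → Realize E φ ![]) :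
    ∃ m : M, PP E φ m := by
  letI := zfOf h
  have hF : Faint M := faint_of h hf
  have hW := faintW hF
  obtain ⟨m, hm⟩ := @step2 {x : M // WW x} (zfW M) idxW idxW_F1
    (fun x => (od_abs _).2 (od_lst _)) idxW_inj hW φ h1
  exact ⟨m.1, pp_abs ww_tr φ m hm⟩

theorem main_aux {M : Type} (E : M → M → Prop) (h : IsZFCE E) (hf : OrdFaintDefE E) (φ : SetFormula 0)
    (h1 : ∀ (M : Type) (E : M → M → Prop), IsZFCE E → OrdFaintDefE E → Realize E φ ![])
    (h2 : ∀ (M : Type) (E : M → M → Prop), IsZFCE E → Realize E φ ![] → OrdFaintDefE E) : False := by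
  letI := zfOf h
  obtain ⟨m, hm, hmin⟩ := cfound (fun m : M => PP E φ m) (step3 E h hf φ h1)
  obtain ⟨ha, hr, D, hc, hs⟩ := hm
  have hz : IsZFCE (sE E (fun x => E x m)) := sub_ZFC (M := M) ha hc hs
  have hφ : Realize (sE E (fun x => E x m)) φ ![] := by
    rw [rel_sub]
    have e0 : (fun i => ((![] : Fin 0 → {x : M // E x m}) i).1) = ![] := by
      funext i; exact i.elim0
    rw [e0]; exact hr
  obtain ⟨m', hm'⟩ := step3 _ hz (h2 _ _ hz hφ) φ h1
  exact hmin m'.1 m'.2 (pp_abs (fun x hx y hy => ha.1 x hx y hy) φ m' hm')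

end Paper

namespace Paper

/-- **Corollary 1.10.** If the theory `ZFC + "Ord is essentially faint"` is
consistent, then no sentence `φ` of the language of set theory satisfies both:
(1) `ZFC + "Ord is essentially faint"` proves `φ`, and
(2) `ZFC + φ` proves the scheme "`Ord` is essentially faint".
(By the Gödel completeness theorem, consistency is rendered as the existence of a
model and provability as truth in all models.) -/
theorem ordFaint_not_finitely_axiomatizable
    (hcon : ∃ (M : Type) (E : M → M → Prop), IsZFCE E ∧ OrdFaintDefE E) :
    ¬ ∃ φ : SetFormula 0,
        (∀ (M : Type) (E : M → M → Prop), IsZFCE E → OrdFaintDefE E →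
          Realize E φ ![]) ∧
        ∀ (M : Type) (E : M → M → Prop), IsZFCE E → Realize E φ ![] →
          OrdFaintDefE E := by
  rintro ⟨φ, h1, h2⟩
  obtain ⟨M, E, h, hf⟩ := hcon
  exact main_aux E h hf φ h1 h2

end Paper
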